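/- Let 1 ≤ i₁, i₂ ≤ n²/2 and j₁, j₂ ∈ {0,1}. Then: (a) if 2i₁−1 ≥ n²−2i₂+1 and i₁ ≤ i₂, then P_{2i₁,j₁}⊗S_{2i₂,j₂} ≅ ⊕_{l=0}^{n²−2i₂} P_{n²+2i₁−2i₂−2l, \overline{j₁+j₂+l}}; (b) if 2i₁−1 ≥ n²−2i₂+1 and i₁ > i₂, then P_{2i₁,j₁}⊗S_{2i₂,j₂} ≅ ⊕_{l=0}^{i₁−i₂−1} (P_{2i₁−2i₂−2l, \overline{j₁+j₂+l}})^{⊕2} ⊕ ⊕_{l=0}^{n²−2i₁} P_{n²−2i₁+2i₂−2l, \overline{j₁+j₂+l}}; (c) if 2i₁−1 < n²−2i₂+1 and i₁ ≤ i₂, then P_{2i₁,j₁}⊗S_{2i₂,j₂} ≅ ⊕_{l=0}^{2i₁−2} P_{n²+2i₁−2i₂−2l, \overline{j₁+j₂+l}} ⊕ ⊕_{l=0}^{n²/2−i₁−i₂} (P_{n²−2i₁−2i₂+2−2l, \overline{j₁+j₂+l−1}})^{⊕2}; (d) if 2i₁−1 < n²−2i₂+1 and i₁ > i₂, then P_{2i₁,j₁}⊗S_{2i₂,j₂}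 ≅ ⊕_{l=0}^{i₁−i₂−1} (P_{2i₁−2i₂−2l, \overline{j₁+j₂+l}})^{⊕2} ⊕ ⊕_{l=0}^{2i₂−2} P_{n²−2i₁+2i₂−2l, \overline{j₁+j₂+l}} ⊕ ⊕_{l=0}^{n²/2−i₁−i₂} (P_{n²−2i₁−2i₂+2−2l, \overline{j₁+j₂+l−1}})^{⊕2}. (All subscripts 2r appearing satisfy 2 ≤ 2r ≤ n², and P_{2r,j} means the module indexed by i = r.) -/

import Mathlib

noncomputable section

open scoped TensorProduct

namespace QFL

/-- The defining relations of the quasi-Frobenius-Lusztig kernel `ũ_q(sl₂)`,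
on the free algebra on four generators `K = ι 0`, `K̂ = ι 1`, `E = ι 2`, `F = ι 3`. -/
inductive Rel (k : Type) [Field k] (n : ℕ) (q : k) :
    FreeAlgebra k (Fin 4) → FreeAlgebra k (Fin 4) → Prop
  | Kord : Rel k n q (FreeAlgebra.ι k (0 : Fin 4) ^ n) 1
  | Khord : Rel k n q (FreeAlgebra.ι k (1 : Fin 4) ^ n)
      ((FreeAlgebra.ι k (0 : Fin 4) ^ (n - 1)) ^ 2)
  | KKh : Rel k n q (FreeAlgebra.ι k (0 : Fin 4) * FreeAlgebra.ι k (1 : Fin 4))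
      (FreeAlgebra.ι k (1 : Fin 4) * FreeAlgebra.ι k (0 : Fin 4))
  | KE : Rel k n q
      (FreeAlgebra.ι k (0 : Fin 4) * FreeAlgebra.ι k (2 : Fin 4) *
        FreeAlgebra.ι k (0 : Fin 4) ^ (n - 1))
      (q ^ n • FreeAlgebra.ι k (2 : Fin 4))
  | KF : Rel k n q
      (FreeAlgebra.ι k (0 : Fin 4) * FreeAlgebra.ι k (3 : Fin 4) *
        FreeAlgebra.ι k (0 : Fin 4) ^ (n - 1))
      ((q ^ n)⁻¹ • FreeAlgebra.ι k (3 : Fin 4))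
  | KhE : Rel k n q
      (FreeAlgebra.ι k (1 : Fin 4) * FreeAlgebra.ι k (2 : Fin 4) *
        FreeAlgebra.ι k (1 : Fin 4) ^ (n ^ 2 - 1))
      ((q ^ n * (q ^ 2)⁻¹) • FreeAlgebra.ι k (2 : Fin 4))
  | KhF : Rel k n q
      (FreeAlgebra.ι k (1 : Fin 4) * FreeAlgebra.ι k (3 : Fin 4) *
        FreeAlgebra.ι k (1 : Fin 4) ^ (n ^ 2 - 1))
      (((q ^ n)⁻¹ * q ^ 2) • FreeAlgebra.ι k (3 : Fin 4))
  | Enil : Rel k n q (FreeAlgebra.ι k (2 : Fin 4) ^ n ^ 2) 0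
  | Fnil : Rel k n q (FreeAlgebra.ι k (3 : Fin 4) ^ n ^ 2) 0
  | EF : Rel k n q
      (FreeAlgebra.ι k (3 : Fin 4) * FreeAlgebra.ι k (2 : Fin 4) -
        q⁻¹ • (FreeAlgebra.ι k (2 : Fin 4) * FreeAlgebra.ι k (3 : Fin 4)))
      (1 - FreeAlgebra.ι k (0 : Fin 4) ^ (n - 1) * FreeAlgebra.ι k (1 : Fin 4))

/-- The algebra `ũ_q(sl₂)` as the quotient of the free algebra by the defining relations. -/
abbrev U (k : Type) [Field k] (n : ℕ) (q : k) := RingQuot (Rel k n q)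

variable (k : Type) [Field k] (n : ℕ) (q : k)

def K : U k n q := RingQuot.mkAlgHom k (Rel k n q) (FreeAlgebra.ι k (0 : Fin 4))
def Kh : U k n q := RingQuot.mkAlgHom k (Rel k n q) (FreeAlgebra.ι k (1 : Fin 4))
def E : U k n q := RingQuot.mkAlgHom k (Rel k n q) (FreeAlgebra.ι k (2 : Fin 4))
def F : U k n q := RingQuot.mkAlgHom k (Rel k n q) (FreeAlgebra.ι k (3 : Fin 4))

/-- `K⁻¹ = K^(n-1)`. -/
def Kinv : U k n q := K k n q ^ (n - 1)
/-- `K̂⁻¹ = K̂^(n²-1)`. -/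
def Khinv : U k n q := Kh k n q ^ (n ^ 2 - 1)

/-- `φ_{2i} = (2/n²) Σ_{t<n²/2} q^{-2it} (K⁻¹K̂)^t`. -/
def phi (i : ℕ) : U k n q :=
  ((n ^ 2 : k)⁻¹ * 2) • ∑ t ∈ Finset.range (n ^ 2 / 2),
    (q⁻¹ ^ (2 * i * t)) • (Kinv k n q * Kh k n q) ^ t

/-- `𝟙₀ = (1/2)(1 + KK̂^(n/2))` and `𝟙₁ = (1/2)(1 - KK̂^(n/2))`. -/
def oneJ (j : ℕ) : U k n q :=
  if j = 0 then (2 : k)⁻¹ • (1 + K k n q * Kh k n q ^ (n / 2))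
  else (2 : k)⁻¹ • (1 - K k n q * Kh k n q ^ (n / 2))

/-- The idempotent `e_{2i,j} = φ_{2i} 𝟙_j`. -/
def eIdem (i j : ℕ) : U k n q := phi k n q i * oneJ k n q j

/-- `α_{2i,j} = F^(n²-1) e_{2i,j}`. -/
def alpha (i j : ℕ) : U k n q := F k n q ^ (n ^ 2 - 1) * eIdem k n q i j

/-- `β_{2i,j} = E^(2i-2) α_{2i,j}`. -/
def beta (i j : ℕ) : U k n q := E k n q ^ (2 * i - 2) * alpha k n q i j

/-- The Gaussian number `s_q = 1 + q + ⋯ + q^(s-1)`. -/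
def gauss (x : k) (s : ℕ) : k := ∑ t ∈ Finset.range s, x ^ t

/-- The span of the PBW-type monomials `F^a K^c K̂^d E^b` with `a ≤ n²-2`, `b ≤ n²-1`,
`c ≤ n-1`, `d ≤ n²-1`. -/
def pbw : Submodule k (U k n q) :=
  Submodule.span k {x | ∃ a b c d : ℕ, a ≤ n ^ 2 - 2 ∧ b ≤ n ^ 2 - 1 ∧ c ≤ n - 1 ∧
    d ≤ n ^ 2 - 1 ∧ x = F k n q ^ a * K k n q ^ c * Kh k n q ^ d * E k n q ^ b}

/-- `γ_{2i,j}`: the unique element of the PBW span with `F·γ = β_{2i,j}`. -/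
def gam (i j : ℕ) : U k n q :=
  @dite _ (∃! x, x ∈ pbw k n q ∧ F k n q * x = beta k n q i j)
    (Classical.propDecidable _) (fun h => h.choose) (fun _ => 0)

/-- The left ideal `P_{2i,j} = u·γ_{2i,j}`. -/
def P (i j : ℕ) : Submodule (U k n q) (U k n q) :=
  Submodule.span (U k n q) {gam k n q i j}

/-- `S_{2i,j} = Soc(P_{2i,j})`, the sum of all simple submodules of `P_{2i,j}`. -/
def S (i j : ℕ) : Submodule (U k n q) (U k n q) :=
  sSup {N : Submodule (U k n q) (U k n q) | N ≤ P k n q i j ∧ IsSimpleModule (U k n q) N}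

end QFL

namespace QFL

variable (k : Type) [Field k] (n : ℕ) (q : k)

/-- `1_r = (1/n) Σ_{t<n} q̄^{(n-r)t} K^t`. -/
def oneIdem (r : ℕ) : U k n q :=
  (n : k)⁻¹ • ∑ t ∈ Finset.range n, ((q ^ n) ^ ((n - r) * t)) • K k n q ^ t

/-- `♭ = Σ_{r<n} q^{-r} 1_r` (an invertible element of `u`). -/
def flat : U k n q := ∑ r ∈ Finset.range n, (q⁻¹ ^ r) • oneIdem k n q r

/-- The property that `Δ` is the comultiplication of `ũ_q(sl₂)` (which exists and is the
unique algebra map with these values on the generators). -/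
def IsComul (Δ : U k n q →ₐ[k] (U k n q ⊗[k] U k n q)) : Prop :=
  Δ (K k n q) = K k n q ⊗ₜ[k] K k n q ∧
  Δ (Kh k n q) = Kh k n q ⊗ₜ[k] Kh k n q ∧
  Δ (E k n q) = (E k n q ⊗ₜ[k] Ring.inverse (flat k n q)) +
    (Kinv k n q ⊗ₜ[k] (oneIdem k n q 0 * E k n q)) +
    ((1 : U k n q) ⊗ₜ[k] ((∑ r ∈ Finset.Icc 1 (n - 1), oneIdem k n q r) * E k n q)) ∧
  Δ (F k n q) = (F k n q ⊗ₜ[k] flat k n q) +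
    ((Kinv k n q * Kh k n q) ⊗ₜ[k]
      (F k n q * ∑ r ∈ Finset.Icc 1 (n - 1), oneIdem k n q r)) +
    (Kh k n q ⊗ₜ[k] (F k n q * oneIdem k n q 0))

instance (N : Submodule (U k n q) (U k n q)) : SMulCommClass (U k n q) k N := by
  constructor
  intro a b m
  ext
  show a • b • (m : U k n q) = b • a • (m : U k n q)
  rw [smul_comm]

/-- The `u`-module structure on `M ⊗[k] N` obtained from left `u`-modules `M`, `N` by letting
`u` act through the comultiplication `Δ`. -/
def tensorModule (Δ : U k n q →ₐ[k] (U k n q ⊗[k] U k n q))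
    (M N : Type) [AddCommGroup M] [Module k M] [Module (U k n q) M]
    [IsScalarTower k (U k n q) M] [SMulCommClass (U k n q) k M]
    [AddCommGroup N] [Module k N] [Module (U k n q) N]
    [IsScalarTower k (U k n q) N] [SMulCommClass (U k n q) k N] :
    Module (U k n q) (M ⊗[k] N) :=
  Module.compHom (M ⊗[k] N)
    ((Module.endTensorEndAlgHom (R := k) (S := k) (A := k) (M := M) (N := N)).comp
      ((Algebra.TensorProduct.map (Algebra.lsmul k k M) (Algebra.lsmul k k N)).comp
        Δ)).toRingHom

end QFL

namespace QFLP

/-- A vector space with operators `E F L Z` satisfying the relations of `u` (in the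
generators `L = K⁻¹K̂`, `Z = K K̂^(n/2)`). -/
structure QS (k : Type) [Field k] (N : ℕ) (q : k) (M : Type) [AddCommGroup M] [Module k M] where
  E : Module.End k M
  F : Module.End k M
  L : Module.End k M
  Z : Module.End k M
  fe : ∀ x, F (E x) = q⁻¹ • E (F x) + (x - L x)
  le : ∀ x, L (E x) = (q ^ 2)⁻¹ • E (L x)
  lf : ∀ x, L (F x) = (q ^ 2) • F (L x)
  ze : ∀ x, Z (E x) = - E (Z x)
  zf : ∀ x, Z (F x) = - F (Z x)
  en : E ^ N = 0
  fn : F ^ N = 0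

/-- Gaussian number. -/
def gs {k : Type} [Field k] (q : k) (s : ℕ) : k := ∑ t ∈ Finset.range s, q ^ t

/-- structure constants -/
def cc {k : Type} [Field k] (q : k) (s : ℕ) (x : ℤ) : k :=
  q⁻¹ ^ s * gs q (s + 1) * (1 - q ^ (x - s))

section
variable {k : Type} [Field k] {N : ℕ} {q : k} 

theorem gs_ne {s : ℕ} (hq : IsPrimitiveRoot q N) (h1 : 0 < s) (h2 : s < N) : gs q s ≠ 0 := by
  intro h
  have := geom_sum_mul q s
  unfold gs at h
  rw [h, zero_mul] at this
  have h3 : q ^ s = 1 := by linear_combination -this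
  have := (hq.pow_eq_one_iff_dvd s).1 h3
  exact absurd (Nat.le_of_dvd h1 this) (by omega)

theorem cc_ne {s : ℕ} {x : ℤ} (hq : IsPrimitiveRoot q N) (h2 : s + 1 < N)
    (hx : ¬ (N : ℤ) ∣ x - s) : cc q s x ≠ 0 := by
  unfold cc
  have hq0 : q ≠ 0 := hq.ne_zero (by omega)
  refine mul_ne_zero (mul_ne_zero (pow_ne_zero _ (inv_ne_zero hq0)) (gs_ne hq (by omega) h2)) ?_
  intro h
  apply hx
  rw [← hq.zpow_eq_one_iff_dvd]
  linear_combination -h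

theorem cc_eq {s : ℕ} {x : ℤ} (hq : IsPrimitiveRoot q N)
    (hx : (N : ℤ) ∣ x - s) : cc q s x = 0 := by
  unfold cc
  rw [(hq.zpow_eq_one_iff_dvd _).2 hx]; simp

variable {M : Type} [AddCommGroup M] [Module k M] (S : QS k N q M)

namespace QS

theorem pE (s : ℕ) (x : M) : S.E ((S.E ^ s) x) = (S.E ^ (s+1)) x := by
  rw [pow_succ']; rfl
theorem pE' (s : ℕ) (x : M) : (S.E ^ s) (S.E x) = (S.E ^ (s+1)) x := by
  rw [pow_succ]; rfl
theorem pF (s : ℕ) (x : M) : S.F ((S.F ^ s) x) = (S.F ^ (s+1)) x := by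
  rw [pow_succ']; rfl
theorem pF' (s : ℕ) (x : M) : (S.F ^ s) (S.F x) = (S.F ^ (s+1)) x := by
  rw [pow_succ]; rfl
theorem pEE (s t : ℕ) (x : M) : (S.E ^ s) ((S.E ^ t) x) = (S.E ^ (s+t)) x := by
  rw [pow_add]; rfl
theorem pFF (s t : ℕ) (x : M) : (S.F ^ s) ((S.F ^ t) x) = (S.F ^ (s+t)) x := by
  rw [pow_add]; rfl
theorem E_ge {s : ℕ} (h : N ≤ s) (x : M) : (S.E ^ s) x = 0 := by
  rw [← Nat.sub_add_cancel h, pow_add, S.en]; simp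
theorem F_ge {s : ℕ} (h : N ≤ s) (x : M) : (S.F ^ s) x = 0 := by
  rw [← Nat.sub_add_cancel h, pow_add, S.fn]; simp

theorem lEs (hq0 : q ≠ 0) (s : ℕ) {y : M} {x : ℤ} (hy : S.L y = q ^ x • y) :
    S.L ((S.E ^ s) y) = q ^ (x - 2 * s) • (S.E ^ s) y := by
  induction s with
  | zero => simpa using hy
  | succ s ih =>
    rw [← pE, S.le, ih, map_smul, smul_smul]
    congr 1
    rw [← zpow_natCast, ← zpow_neg, ← zpow_add₀ hq0]
    congr 1; push_cast; ring

theorem lF (hq0 : q ≠ 0) {y : M} {x : ℤ} (hy : S.L y = q ^ x • y) :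
    S.L (S.F y) = q ^ (x + 2) • S.F y := by
  rw [S.lf, hy, map_smul, smul_smul]
  congr 1
  rw [← zpow_natCast, ← zpow_add₀ hq0]
  congr 1; push_cast; ring

theorem zEs (s : ℕ) {y : M} {c : k} (hy : S.Z y = c • y) :
    S.Z ((S.E ^ s) y) = (c * (-1) ^ s) • (S.E ^ s) y := by
  induction s with
  | zero => simpa using hy
  | succ s ih =>
    rw [← pE, S.ze, ih, map_smul, ← neg_smul]
    congr 1; ring

/-- The fundamental commutation formula. -/
theorem fEs (hq0 : q ≠ 0) (s : ℕ) {y : M} {x : ℤ} (hy : S.L y = q ^ x • y) :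
    S.F ((S.E ^ (s+1)) y) = q⁻¹ ^ (s+1) • (S.E ^ (s+1)) (S.F y) + cc q s x • (S.E ^ s) y := by
  induction s with
  | zero =>
    simp only [zero_add, pow_one, S.fe, hy, cc, gs, pow_zero, Finset.range_one,
      Finset.sum_singleton, Nat.cast_zero, sub_zero, one_mul, sub_smul, one_smul]
    simp
  | succ s ih =>
    rw [← pE, S.fe, ih, S.lEs hq0 (s+1) hy, map_add, map_smul, map_smul, pE, pE, smul_add,
      smul_smul, smul_smul, ← pow_succ', add_assoc]
    congr 1
    have e1 : (S.E ^ (s + 1)) y - q ^ (x - 2 * ((s+1 : ℕ) : ℤ)) • (S.E ^ (s + 1)) y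
      = (1 - q ^ (x - 2 * ((s+1 : ℕ) : ℤ))) • (S.E ^ (s + 1)) y := by rw [sub_smul, one_smul]
    rw [e1, ← add_smul]
    congr 1
    have h1 : q ^ (x - 2 * ((s+1 : ℕ) : ℤ)) = q ^ x * q⁻¹ ^ (s+1) * q⁻¹ ^ (s+1) := by
      rw [← zpow_natCast, inv_zpow, ← zpow_neg, ← zpow_add₀ hq0, ← zpow_add₀ hq0]
      congr 1; push_cast; ring
    have h2 : ∀ t : ℕ, q ^ (x - (t : ℤ)) = q ^ x * q⁻¹ ^ t := by
      intro t
      rw [← zpow_natCast, inv_zpow, ← zpow_neg, ← zpow_add₀ hq0]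
      congr 1
    have h3 : gs q (s + 1 + 1) = gs q (s+1) + q ^ (s+1) := by
      simp only [gs]; rw [Finset.sum_range_succ]
    have h4 : gs q (s + 1 + 1) = q * gs q (s+1) + 1 := by
      simp only [gs]; rw [geom_sum_succ]
    have h5 : q⁻¹ * q = 1 := inv_mul_cancel₀ hq0
    have h6 : q⁻¹ ^ (s+1) * q ^ (s+1) = 1 := by rw [← mul_pow, h5, one_pow]
    unfold cc
    rw [h1, h2, h2]
    have h7 : q⁻¹ ^ (s + 1) * gs q (s + 1 + 1) * (1 - q ^ x * q⁻¹ ^ (s + 1))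
      = q⁻¹ ^ (s + 1) * (gs q (s+1) + q ^ (s+1)) -
        q⁻¹ ^ (s + 1) * (q * gs q (s+1) + 1) * (q ^ x * q⁻¹ ^ (s + 1)) := by
      rw [← h3, ← h4]; ring
    rw [h7]
    have h8 : q⁻¹ ^ (s+1) * q = q⁻¹ ^ s := by rw [pow_succ, mul_assoc, h5, mul_one]
    have h9 : q⁻¹ ^ (s+1) = q⁻¹ ^ s * q⁻¹ := pow_succ _ _
    linear_combination (-1) * h6 + (gs q (s+1) * q ^ x * q⁻¹ ^ (s+1)) * h8 

/-- Same formula for lowest vectors. -/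
theorem fEs0 (hq0 : q ≠ 0) (s : ℕ) {y : M} {x : ℤ} (hy : S.L y = q ^ x • y) (hF : S.F y = 0) :
    S.F ((S.E ^ (s+1)) y) = cc q s x • (S.E ^ s) y := by
  rw [S.fEs hq0 s hy, hF]; simp

/-- The data of the images of the two canonical generators. -/
structure PairL (i : ℕ) (a g : M) : Prop where
  la : S.L a = q ^ (2 * (i:ℤ) - 2) • a
  fa : S.F a = 0
  lg : S.L g = q ^ (-(2 * (i:ℤ))) • g
  fg : S.F g = (S.E ^ (2 * i - 2)) a

variable {S}

/-- going down from `E^(r+t) a` to `E^t a` -/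
theorem down (hq0 : q ≠ 0) {y : M} {x : ℤ} (hy : S.L y = q ^ x • y) (hF : S.F y = 0) (r t : ℕ) :
    ∃ c : k, (S.F ^ r) ((S.E ^ (r + t)) y) = c • (S.E ^ t) y ∧
      ((∀ s, t ≤ s → s < r + t → cc q s x ≠ 0) → c ≠ 0) := by
  induction r with
  | zero => exact ⟨1, by simp, by simp⟩
  | succ r ih =>
    obtain ⟨c, h1, h2⟩ := ih
    refine ⟨cc q (r+t) x * c, ?_, ?_⟩
    · rw [← pF', show r + 1 + t = (r + t) + 1 by ring, S.fEs0 hq0 _ hy hF, map_smul, h1, smul_smul]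
    · intro h
      exact mul_ne_zero (h _ (by omega) (by omega)) (h2 fun s hs hs' => h s hs (by omega))

section pair
variable {i : ℕ} {a g : M} (hp : S.PairL i a g) (hq : IsPrimitiveRoot q N) 
  (hi : 1 ≤ i) (hiN : 2 * i ≤ N)
include hp hq hi hiN

theorem PairL.q0 : q ≠ 0 := hq.ne_zero (by omega)

theorem PairL.cca {s : ℕ} (h : s + 1 < N) (h' : s ≠ 2 * i - 2) : cc q s (2 * (i:ℤ) - 2) ≠ 0 := by
  apply cc_ne hq h
  rintro ⟨c, hc⟩
  rcases lt_trichotomy c 0 with h0 | h0 | h0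
  · nlinarith
  · subst h0; omega
  · nlinarith

theorem PairL.ccg {s : ℕ} (h : s + 1 < N) (h' : s ≠ N - 2 * i) : cc q s (-(2 * (i:ℤ))) ≠ 0 := by
  apply cc_ne hq h
  rintro ⟨c, hc⟩
  rcases lt_trichotomy c (-1) with h0 | h0 | h0
  · nlinarith
  · subst h0; omega
  · nlinarith

theorem PairL.f_top : S.F ((S.E ^ (2 * i - 1)) a) = 0 := by
  rw [show 2 * i - 1 = (2 * i - 2) + 1 by omega, S.fEs0 (hp.q0 hq hi hiN) _ hp.la hp.fa,
    cc_eq hq, zero_smul]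
  rw [Nat.cast_sub (by omega)]; simp

theorem PairL.f_g (s : ℕ) : S.F ((S.E ^ (s+1)) g) =
    q⁻¹ ^ (s+1) • (S.E ^ (s + 1 + (2 * i - 2))) a + cc q s (-(2 * (i:ℤ))) • (S.E ^ s) g := by
  rw [S.fEs (hp.q0 hq hi hiN) _ hp.lg, hp.fg, pEE]

/-- `F^(N-1) E^(N-2i) g` is a nonzero multiple of `a`. -/
theorem PairL.p1 : ∃ c : k, c ≠ 0 ∧ (S.F ^ (N-1)) ((S.E ^ (N - 2 * i)) g) = c • a := by
  have hq0 := hp.q0 hq hi hiN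
  have key : ∀ s, s ≤ N - 2 * i → ∃ c c' : k, c ≠ 0 ∧
      (S.F ^ s) ((S.E ^ s) g) = c • g + c' • (S.E ^ (2 * i - 1)) a := by
    intro s
    induction s with
    | zero => intro _; exact ⟨1, 0, one_ne_zero, by simp⟩
    | succ s ih =>
      intro hs
      obtain ⟨c, c', h1, h2⟩ := ih (by omega)
      obtain ⟨c2, h3, -⟩ := down hq0 hp.la hp.fa s (2 * i - 1)
      refine ⟨cc q s (-(2 * (i:ℤ))) * c,  q⁻¹ ^ (s+1) * c2 + cc q s (-(2 * (i:ℤ))) * c',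
        mul_ne_zero (hp.ccg hq hi hiN (by omega) (by omega)) h1, ?_⟩
      rw [← pF', hp.f_g hq hi hiN, map_add, map_smul, map_smul,
        show s + 1 + (2 * i - 2) = s + (2 * i - 1) by omega, h3, h2]
      module
  obtain ⟨c, c', h1, h2⟩ := key _ le_rfl
  obtain ⟨c2, h3, h4⟩ := down hq0 hp.la hp.fa (2 * i - 2) 0
  refine ⟨c * c2, mul_ne_zero h1 (h4 ?_), ?_⟩
  · intro s _ hs
    exact hp.cca hq hi hiN (by omega) (by omega)
  · have : N - 1 = (2 * i - 2) + 1 + (N - 2 * i) := by omega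
    rw [this, ← pFF, h2, map_add, map_smul, map_smul, ← pF', ← pF', hp.f_top hq hi hiN, hp.fg]
    simp only [add_zero, pow_zero, Module.End.one_apply] at h3
    rw [h3]; simp [smul_smul]

/-- `F^(N-1) E^(N-1) g` is a nonzero multiple of `E^(2i-1) a`. -/
theorem PairL.p2 : ∃ c : k, c ≠ 0 ∧
    (S.F ^ (N-1)) ((S.E ^ (N - 1)) g) = c • (S.E ^ (2 * i - 1)) a := by
  have hq0 := hp.q0 hq hi hiN
  have key : ∀ s, s ≤ 2 * i - 2 → ∃ c : k, c ≠ 0 ∧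
      (S.F ^ s) ((S.E ^ (s + (N - 2 * i + 1))) g) = c • (S.E ^ (N - 2 * i + 1)) g := by
    intro s
    induction s with
    | zero => intro _; exact ⟨1, one_ne_zero, by simp⟩
    | succ s ih =>
      intro hs
      obtain ⟨c, h1, h2⟩ := ih (by omega)
      refine ⟨cc q (s + (N - 2 * i + 1)) (-(2 * (i:ℤ))) * c,
        mul_ne_zero (hp.ccg hq hi hiN (by omega) (by omega)) h1, ?_⟩
      rw [← pF', show s + 1 + (N - 2 * i + 1) = s + (N - 2 * i + 1) + 1 by omega,
        hp.f_g hq hi hiN, S.E_ge (by omega), smul_zero, zero_add, map_smul, h2, smul_smul]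
  obtain ⟨c, h1, h2⟩ := key _ le_rfl
  obtain ⟨c2, h3, h4⟩ := down hq0 hp.la hp.fa (N - 2 * i) (2 * i - 1)
  refine ⟨c * q⁻¹ ^ (N - 2 * i + 1) * c2, mul_ne_zero (mul_ne_zero h1 (pow_ne_zero _ (inv_ne_zero hq0)))
    (h4 ?_), ?_⟩
  · intro s hs hs'
    exact hp.cca hq hi hiN (by omega) (by omega)
  · have e1 : N - 1 = (N - 2 * i) + 1 + (2 * i - 2) := by omega
    have e2 : (S.E ^ (N - 1)) g = (S.E ^ (2 * i - 2 + (N - 2 * i + 1))) g := by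
      congr 2; omega
    rw [e2, e1, ← pFF, h2, map_smul, ← pF', hp.f_g hq hi hiN, cc_eq hq, zero_smul, add_zero,
      map_smul, show N - 2 * i + 1 + (2 * i - 2) = N - 2 * i + (2 * i - 1) by omega, h3]
    · simp [smul_smul, mul_assoc]
    · rw [Nat.cast_sub hiN]; exact ⟨-1, by push_cast; ring⟩

theorem PairL.p3 : (S.F ^ (N-1)) ((S.E ^ (N - 1)) a) = 0 := by
  have hq0 := hp.q0 hq hi hiN
  obtain ⟨c2, h3, h4⟩ := down hq0 hp.la hp.fa (N - 2 * i) (2 * i - 1)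
  have e1 : N - 1 = (2 * i - 2) + 1 + (N - 2 * i) := by omega
  have e2 : (S.E ^ (N - 1)) a = (S.E ^ (N - 2 * i + (2 * i - 1))) a := by
      congr 2; omega
  rw [e2, e1, ← pFF, h3, map_smul, ← pF', hp.f_top hq hi hiN]
  simp

end pair

/-- existence of `g` from exactness -/
theorem exists_g (hq0 : q ≠ 0) {i : ℕ} {a : M} (hi : 1 ≤ i) (hiN : 2 * i ≤ N)
    (la : S.L a = q ^ (2 * (i:ℤ) - 2) • a) (fa : S.F a = 0)
    (hex : ∀ x, S.F x = 0 → ∃ y, (S.F ^ (N-1)) y = x) :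
    ∃ g, S.F g = (S.E ^ (2 * i - 2)) a := by
  have key : ∀ r, r ≤ N - 1 → ∀ x, (S.F ^ r) x = 0 → ∃ y, (S.F ^ (N - r)) y = x := by
    intro r
    induction r with
    | zero => intro _ x hx; exact ⟨0, by simpa using hx.symm⟩
    | succ r ih =>
      intro hr x hx
      obtain ⟨y, hy⟩ := hex ((S.F ^ r) x) (by rw [pF]; exact hx)
      obtain ⟨z, hz⟩ := ih (by omega) (x - (S.F ^ (N - (r+1))) y) (by
        rw [map_sub, pFF, ← hy, show r + (N - (r+1)) = N - 1 by omega, sub_self])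
      refine ⟨y + S.F z, ?_⟩
      rw [map_add, pF', show N - (r+1) + 1 = N - r by omega, hz]; abel
  obtain ⟨c2, h3, h4⟩ := down hq0 la fa (2 * i - 2) 0
  obtain ⟨y, hy⟩ := key (N-1) le_rfl ((S.E ^ (2 * i - 2)) a) (by
    rw [show N - 1 = (N - 2 * i) + 1 + (2 * i - 2) by omega, ← pFF]
    simp only [add_zero, pow_zero, Module.End.one_apply] at h3
    rw [h3, map_smul, ← pF', fa]; simp)
  refine ⟨y, ?_⟩
  rw [← hy, show N - (N - 1) = 1 by omega, pow_one]

end QS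
end
end QFLP

namespace QFLP

section indep
variable {k : Type} [Field k] {M : Type} [AddCommGroup M] [Module k M]

theorem nilp_coef {ι : Type} [Fintype ι] {N : ℕ} (T : Module.End k M) (hT : T ^ N = 0) (w : ι → M)
    (h : LinearIndependent k (fun l => (T ^ (N-1)) (w l))) (f : ι × Fin N → k) (r : ℕ) (hr : r ≤ N)
    (hx : ∀ s < r, (T ^ (N - 1 - s)) (∑ x, f x • (T ^ (x.2 : ℕ)) (w x.1)) = 0) :
    ∀ s : ℕ, s < r → ∀ hs : s < N, ∀ l, f (l, ⟨s, hs⟩) = 0 := by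
  rw [Fintype.linearIndependent_iff] at h
  have hge : ∀ s, N ≤ s → ∀ x, (T ^ s) x = 0 := by
    intro s hs x
    rw [← Nat.sub_add_cancel hs, pow_add, hT]; simp
  intro s
  induction s using Nat.strong_induction_on with
  | _ s ih =>
    intro hsr hs
    apply h (fun l => f (l, ⟨s, hs⟩))
    have h1 := hx s hsr
    rw [map_sum, Fintype.sum_prod_type] at h1
    rw [← h1]
    refine Finset.sum_congr rfl fun l _ => ?_
    rw [Finset.sum_eq_single (⟨s, hs⟩ : Fin N)]
    · rw [map_smul, ← Module.End.mul_apply, ← pow_add, Nat.sub_add_cancel (by omega)]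
    · intro t _ ht
      rcases lt_trichotomy (t : ℕ) s with h2 | h2 | h2
      · rw [show t = ⟨(t:ℕ), t.2⟩ from rfl, ih t h2 (by omega)]; simp
      · exact absurd (Fin.ext h2) ht
      · rw [map_smul, ← Module.End.mul_apply, ← pow_add, hge (N - 1 - s + (t:ℕ)) (by omega), smul_zero]
    · intro h; exact absurd (Finset.mem_univ _) h

theorem nilp_indep {ι : Type} [Fintype ι] {N : ℕ} (T : Module.End k M) (hT : T ^ N = 0) (w : ι → M)
    (h : LinearIndependent k (fun l => (T ^ (N-1)) (w l))) :
    LinearIndependent k (fun x : ι × Fin N => (T ^ (x.2 : ℕ)) (w x.1)) := by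
  rw [Fintype.linearIndependent_iff]
  intro f hf
  rintro ⟨l, s⟩
  exact nilp_coef T hT w h f N le_rfl (by intro s _; rw [hf, map_zero]) s s.2 s.2 l

theorem nilp_exact {ι : Type} [Fintype ι] {N : ℕ} (T : Module.End k M) (hT : T ^ N = 0) (w : ι → M)
    (h : LinearIndependent k (fun l => (T ^ (N-1)) (w l)))
    (hc : Fintype.card ι * N = Module.finrank k M) (hN : 0 < N) [Module.Finite k M]
    (x : M) (hx : T x = 0) : ∃ y, (T ^ (N-1)) y = x := by
  classical
  have hind := nilp_indep T hT w h
  have hsp := hind.span_eq_top_of_card_eq_finrank' (by simp [hc])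
  have hxs : x ∈ Submodule.span k (Set.range (fun x : ι × Fin N => (T ^ (x.2 : ℕ)) (w x.1))) := by
    rw [hsp]; trivial
  obtain ⟨f, hf⟩ := (Submodule.mem_span_range_iff_exists_fun k).1 hxs
  have h0 := nilp_coef T hT w h f (N-1) (by omega) (by
    intro s hs
    rw [hf, show N - 1 - s = (N - 1 - s - 1) + 1 by omega, pow_succ, Module.End.mul_apply, hx, map_zero])
  refine ⟨∑ l, f (l, ⟨N-1, by omega⟩) • w l, ?_⟩
  rw [← hf, map_sum, Fintype.sum_prod_type]
  refine Finset.sum_congr rfl fun l _ => ?_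
  rw [Finset.sum_eq_single (⟨N-1, by omega⟩ : Fin N), map_smul]
  · intro t _ ht
    have : (t:ℕ) ≠ N - 1 := fun h => ht (Fin.ext h)
    rw [show f (l, t) = 0 from h0 t (by omega) t.2 l, zero_smul]
  · intro h; exact absurd (Finset.mem_univ _) h

end indep

namespace QS
variable {k : Type} [Field k] {N : ℕ} {q : k} {M : Type} [AddCommGroup M] [Module k M]
  {S : QS k N q M}

/-- Independence of all the vectors obtained from a family of pairs. -/
theorem pairs_indep (hq : IsPrimitiveRoot q N) {ι : Type} [Fintype ι] (i : ι → ℕ) (a g : ι → M)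
    (hi : ∀ l, 1 ≤ i l) (hiN : ∀ l, 2 * i l ≤ N) (hp : ∀ l, S.PairL (i l) (a l) (g l))
    (h : LinearIndependent k (fun l => (S.E ^ (N-1)) (a l))) :
    LinearIndependent k (fun x : (ι ⊕ ι) × Fin N => (S.E ^ (x.2 : ℕ)) (Sum.elim a g x.1)) := by
  apply nilp_indep _ S.en
  have h' := nilp_indep _ S.en a h
  rw [Fintype.linearIndependent_iff] at h ⊢
  intro f hf
  rw [Fintype.sum_sum_type] at hf
  simp only [Sum.elim_inl, Sum.elim_inr] at hf
  have hr : ∀ l, f (Sum.inr l) = 0 := by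
    have h1 := congrArg (S.F ^ (N-1)) hf
    choose c hc0 hc using fun l => (hp l).p2 hq (hi l) (hiN l)
    rw [map_zero, map_add, map_sum, map_sum] at h1
    simp only [map_smul, (hp _).p3 hq (hi _) (hiN _), smul_zero, Finset.sum_const_zero, zero_add,
      hc, smul_smul] at h1
    have hlt : ∀ l, 2 * i l - 1 < N := fun l => by have := hi l; have := hiN l; omega
    have h2 := h'.comp (fun l => (l, (⟨2 * i l - 1, hlt l⟩ : Fin N))) (by
      intro l l' hl; exact (Prod.ext_iff.1 hl).1)
    rw [Fintype.linearIndependent_iff] at h2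
    intro l
    have := h2 (fun l => f (Sum.inr l) * c l) h1 l
    exact (mul_eq_zero.1 this).resolve_right (hc0 l)
  have hl : ∀ l, f (Sum.inl l) = 0 := by
    apply h (fun l => f (Sum.inl l))
    simpa [hr] using hf
  rintro (l | l)
  · exact hl l
  · exact hr l

/-- A grading (bounded below) compatible with the operators. -/
structure Gr (S : QS k N q M) (V : ℕ → Submodule k M) (C : ℤ) : Prop where
  hE : ∀ d y, y ∈ V d → S.E y ∈ V (d+1)
  hF : ∀ d y, y ∈ V (d+1) → S.F y ∈ V d
  hF0 : ∀ y, y ∈ V 0 → S.F y = 0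
  hL : ∀ d y, y ∈ V d → S.L y = q ^ (C - 1 - 2 * (d:ℤ)) • y

section gr
variable {V : ℕ → Submodule k M} {C : ℤ} (G : Gr S V C) (hq : IsPrimitiveRoot q N) (hN : 0 < N)
include G

theorem Gr.hEs (s d : ℕ) (y : M) (hy : y ∈ V d) : (S.E ^ s) y ∈ V (d + s) := by
  induction s with
  | zero => simpa using hy
  | succ s ih => rw [← pE]; exact G.hE _ _ ih

include hq hN

theorem Gr.key (e : ℕ) (T : Submodule k M) (hT : ∀ z ∈ V e, S.F (S.E z) ∈ T)
    (hbad : ∀ d', d' ≤ e → (∀ d'' < d', ∀ y ∈ V d'', (S.E ^ (e - d'')) y ∈ T) →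
      (e - d' + 1 < N ∧ ¬ (N:ℤ) ∣ C - 1 - d' - e) ∨ ∀ y ∈ V d', (S.E ^ (e - d')) y ∈ T) :
    ∀ d', d' ≤ e → ∀ y ∈ V d', (S.E ^ (e - d')) y ∈ T := by
  have hq0 : q ≠ 0 := hq.ne_zero (by omega)
  intro d'
  induction d' using Nat.strong_induction_on with
  | _ d' ih =>
    intro hd y hy
    rcases hbad d' hd (fun d'' h y hy => ih d'' h (by omega) y hy) with ⟨h1, h2⟩ | h
    · have h3 := S.fEs hq0 (e - d') (G.hL _ _ hy)
      have h4 : S.F ((S.E ^ (e - d' + 1)) y) ∈ T := by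
        rw [← pE]; apply hT
        have := G.hEs (e - d') d' y hy
        rwa [show d' + (e - d') = e by omega] at this
      have h5 : (S.E ^ (e - d' + 1)) (S.F y) ∈ T := by
        rcases Nat.eq_zero_or_pos d' with h0 | h0
        · subst h0
          rw [G.hF0 _ hy]; simp
        · obtain ⟨d'', rfl⟩ : ∃ d'', d' = d'' + 1 := ⟨d' - 1, by omega⟩
          have := ih d'' (by omega) (by omega) _ (G.hF _ _ hy)
          rwa [show e - (d'' + 1) + 1 = e - d'' by omega]
      have h6 : cc q (e - d') (C - 1 - 2 * (d':ℤ)) • (S.E ^ (e - d')) y ∈ T := by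
        have : cc q (e - d') (C - 1 - 2 * (d':ℤ)) • (S.E ^ (e - d')) y
          = S.F ((S.E ^ (e - d' + 1)) y) - q⁻¹ ^ (e - d' + 1) • (S.E ^ (e - d' + 1)) (S.F y) := by
          rw [h3]; abel
        rw [this]
        exact T.sub_mem h4 (T.smul_mem _ h5)
      have h7 : cc q (e - d') (C - 1 - 2 * (d':ℤ)) ≠ 0 := by
        apply cc_ne hq h1
        convert h2 using 2
        rw [Nat.cast_sub hd]; ring
      exact (T.smul_mem_iff h7).1 h6
    · exact h y hy

theorem Gr.low (d : ℕ) (y : M) (hy : y ∈ V d)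
    (h : ∀ d' < d, d - d' < N ∧ ¬ (N:ℤ) ∣ C - d' - d) :
    ∃ z, S.F (y + S.E z) = 0 ∧ y + S.E z ∈ V d ∧ (∀ d', d = d' + 1 → z ∈ V d') ∧ (d = 0 → z = 0) := by
  rcases d with _ | e
  · exact ⟨0, by simpa using G.hF0 _ hy, by simpa using hy, by simp, by simp⟩
  · have := G.key hq hN e ((V e).map (S.F * S.E)) (fun z hz => ⟨z, hz, rfl⟩) (by
      intro d' hd _
      left
      obtain ⟨h1, h2⟩ := h d' (by omega)
      refine ⟨by omega, ?_⟩
      convert h2 using 2; push_cast; ring) e le_rfl _ (G.hF _ _ hy)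
    rw [Nat.sub_self, pow_zero] at this
    obtain ⟨z, hz, hz'⟩ := this
    refine ⟨-z, ?_, ?_, ?_, by simp⟩
    · change S.F (S.E z) = S.F y at hz'
      simp [hz']
    · exact (V _).add_mem hy (G.hE _ _ ((V e).neg_mem hz))
    · intro d' hd'
      obtain rfl : e = d' := by omega
      exact (V _).neg_mem hz

theorem Gr.special [Module.Finite k M] (A : ℕ → M) {p : ℕ} (hA : ∀ d, A d ∈ V d)
    (hgen0 : ∀ y ∈ V 0, ∃ c : k, y = c • A 0)
    (hgen : ∀ d, d + 1 < p → ∀ y ∈ V (d+1), ∃ c : k, ∃ z ∈ V d, y = c • A (d+1) + S.E z)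
    (hlift : ∀ d x, S.F x ∈ V d → ∃ x' ∈ V (d+1), S.F x' = S.F x)
    (hex : ∀ x, S.F x = 0 → ∃ y, (S.F ^ (N-1)) y = x)
    (h l : ℕ) (hl : l < h) (hC : C = N + 2 * h - 1) (hp : 2 * h < p + 1) (hpN : p < N)
    (hAl : (S.E ^ (N-1)) (A l) ≠ 0) (y : M) (hy : y ∈ V (N + l)) :
    ∃ z, S.F (y + S.E z) = 0 ∧ y + S.E z ∈ V (N + l) := by
  have hq0 : q ≠ 0 := hq.ne_zero (by omega)
  obtain ⟨i, rfl⟩ : ∃ i, h = l + i := ⟨h - l, by omega⟩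
  have hi : 1 ≤ i := by omega
  have hiN : 2 * i ≤ N := by omega
  obtain ⟨z, hz1, hz2, hz3, hz4⟩ := G.low hq hN l (A l) (hA l) (by
    intro d' hd'
    refine ⟨by omega, ?_⟩
    rintro ⟨c, hc⟩
    have h1 : 1 < c ∨ c ≤ 1 := by omega
    rcases h1 with h1 | h1
    · rw [hC] at hc; push_cast at hc; nlinarith
    · rw [hC] at hc; push_cast at hc; nlinarith)
  set a := A l + S.E z with ha
  have hEa : (S.E ^ (N-1)) a ≠ 0 := by
    rw [ha, map_add, pE', S.E_ge (s := N - 1 + 1) (by omega), add_zero]; exact hAl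
  have hEa' : ∀ s < N, (S.E ^ s) a ≠ 0 := by
    intro s hs h0
    apply hEa
    rw [show N - 1 = (N - 1 - s) + s by omega, ← pEE, h0, map_zero]
  -- V l is spanned by a modulo E
  have hVl : ∀ y ∈ V l, ∃ c : k, ∃ z' : M, y = c • a + S.E z' ∧ (∀ d', l = d' + 1 → z' ∈ V d') ∧
      (l = 0 → z' = 0) := by
    intro y hy
    rcases l with _ | l
    · obtain ⟨c, hc⟩ := hgen0 y hy
      refine ⟨c, 0, ?_, by simp, by simp⟩
      rw [ha, hz4 rfl]; simpa using hc
    · obtain ⟨c, z', hz', hc⟩ := hgen l (by omega) y hy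
      refine ⟨c, z' - c • z, ?_, ?_, by simp⟩
      · rw [hc, ha, map_sub, map_smul, smul_add]; abel
      · intro d' hd'
        obtain rfl : l = d' := by omega
        exact (V _).sub_mem hz' ((V _).smul_mem _ (hz3 _ rfl))
  have la : S.L a = q ^ (2 * (i:ℤ) - 2) • a := by
    rw [G.hL _ _ hz2]
    congr 1
    rw [hC, show ((N:ℤ) + 2 * ((l + i : ℕ):ℤ) - 1 - 1 - 2 * (l:ℤ)) = (2 * (i:ℤ) - 2) + N by push_cast; ring,
      zpow_add₀ hq0, zpow_natCast, hq.pow_eq_one, mul_one]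
  obtain ⟨g0, hg0⟩ := exists_g hq0 hi hiN la hz1 hex
  obtain ⟨g, hg1, hg2⟩ := hlift (l + (2 * i - 2)) g0 (by rw [hg0]; exact G.hEs _ _ _ hz2)
  rw [hg0] at hg2
  have P : S.PairL i a g := by
    refine ⟨la, hz1, ?_, hg2⟩
    rw [G.hL _ _ hg1]
    congr 1
    rw [hC, show ((N:ℤ) + 2 * ((l + i : ℕ):ℤ) - 1 - 1 - 2 * ((l + (2 * i - 2) + 1 : ℕ):ℤ)) = -(2 * (i:ℤ)) + N by
       push_cast [Nat.cast_sub (show 2 ≤ 2 * i by omega)]; ring,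
      zpow_add₀ hq0, zpow_natCast, hq.pow_eq_one, mul_one]
  have hVd2 : ∀ y ∈ V (l + (2 * i - 2) + 1), ∃ c : k, ∃ z' ∈ V (l + (2 * i - 2)),
      y = c • g + S.E z' := by
    obtain ⟨c, z', hz', hc⟩ := hgen (l + (2 * i - 2)) (by omega) g hg1
    by_cases hc0 : c = 0
    · exfalso
      rw [hc0, zero_smul, zero_add] at hc
      have hsurj := G.key hq hN (l + (2 * i - 2)) ((V (l + (2 * i - 2))).map (S.F * S.E))
        (fun z hz => ⟨z, hz, rfl⟩) (by
          intro d' hd' ih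
          by_cases hdl : d' = l
          · right
            subst hdl
            intro y hy
            obtain ⟨c, z1, h1, h2, h3⟩ := hVl y hy
            rw [show d' + (2 * i - 2) - d' = 2 * i - 2 by omega, h1, map_add, map_smul]
            refine Submodule.add_mem _ (Submodule.smul_mem _ _ ⟨z', hz', ?_⟩) ?_
            · change S.F (S.E z') = _
              rw [← hc, hg2]
            · rcases d' with _ | d'
              · rw [h3 rfl]; simp
              · have := ih d' (by omega) z1 (h2 _ rfl)
                rwa [show d' + 1 + (2 * i - 2) - d' = 2 * i - 2 + 1 by omega, ← pE'] at this
          · left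
            refine ⟨by omega, ?_⟩
            rintro ⟨c, hc⟩
            rw [hC] at hc; push_cast [Nat.cast_sub (show 2 ≤ 2 * i by omega)] at hc
            have : (c = 1) ∨ c < 1 ∨ 1 < c := by omega
            rcases this with h1 | h1 | h1
            · subst h1; apply hdl; omega
            · have : c ≤ 0 := by omega
              have : (d':ℤ) ≤ l + 2 * i - 2 := by omega
              nlinarith
            · have : 2 ≤ c := by omega
              nlinarith)
        (l + (2 * i - 2)) le_rfl
      -- restrict FE to V
      have hmem : ∀ x ∈ V (l + (2 * i - 2)), (S.F * S.E) x ∈ V (l + (2 * i - 2)) := by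
        intro x hx
        exact G.hF _ _ (G.hE _ _ hx)
      let R := (S.F * S.E).restrict hmem
      have hR : Function.Surjective R := by
        rintro ⟨x, hx⟩
        have := hsurj x hx
        rw [Nat.sub_self, pow_zero] at this
        obtain ⟨z, hz, hz'⟩ := this
        exact ⟨⟨z, hz⟩, Subtype.ext hz'⟩
      have hRi := LinearMap.injective_iff_surjective.2 hR
      have h0 : R ⟨(S.E ^ (2 * i - 2)) a, G.hEs _ _ _ hz2⟩ = 0 := by
        apply Subtype.ext
        change S.F (S.E ((S.E ^ (2 * i - 2)) a)) = 0
        rw [pE, show 2 * i - 2 + 1 = 2 * i - 1 by omega, P.f_top hq hi hiN]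
      have h1 := hRi (h0.trans (map_zero R).symm)
      exact hEa' (2 * i - 2) (by omega) (congrArg Subtype.val h1)
    · intro y hy
      obtain ⟨c1, z1, hz1, hc1⟩ := hgen (l + (2 * i - 2)) (by omega) y hy
      refine ⟨c1 * c⁻¹, z1 - (c1 * c⁻¹) • z', (V _).sub_mem hz1 ((V _).smul_mem _ hz'), ?_⟩
      rw [hc1, map_sub, map_smul]
      have h9 : (c1 * c⁻¹) • g = c1 • A (l + (2 * i - 2) + 1) + (c1 * c⁻¹) • S.E z' := by
        nth_rw 1 [hc]
        rw [smul_add, smul_smul, mul_assoc, inv_mul_cancel₀ hc0, mul_one]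
      rw [h9]; abel
  -- the main step
  have hgV : (S.E ^ (N - 2 * i)) g ∈ V (N + l - 1) := by
    have := G.hEs (N - 2 * i) _ _ hg1
    rwa [show l + (2 * i - 2) + 1 + (N - 2 * i) = N + l - 1 by omega] at this
  have hmain := G.key hq hN (N + l - 1) ((V (N + l - 1)).map (S.F * S.E) ⊔
      Submodule.span k {(S.E ^ (N - 2 * i)) g}) (fun z hz => Submodule.mem_sup_left ⟨z, hz, rfl⟩) (by
      intro d' hd' ih
      by_cases h1 : d' < l
      · right
        intro y hy
        rw [S.E_ge (s := N + l - 1 - d') (by omega)]; simp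
      by_cases h2 : d' = l
      · right
        subst h2
        intro y hy
        obtain ⟨c, z1, h1, -, -⟩ := hVl y hy
        rw [show N + d' - 1 - d' = N - 1 by omega, h1, map_add, map_smul, pE', S.E_ge (s := N - 1 + 1) (by omega),
          add_zero]
        apply Submodule.smul_mem
        have h3 := P.f_g hq hi hiN (N - 2 * i)
        rw [show N - 2 * i + 1 + (2 * i - 2) = N - 1 by omega] at h3
        have h5 : q⁻¹ ^ (N - 2 * i + 1) ≠ 0 := pow_ne_zero _ (inv_ne_zero hq0)
        rw [← Submodule.smul_mem_iff _ h5]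
        rw [eq_sub_of_add_eq h3.symm]
        refine Submodule.sub_mem _ (Submodule.mem_sup_left ⟨_, hgV, ?_⟩)
          (Submodule.mem_sup_right (Submodule.smul_mem _ _ (Submodule.mem_span_singleton_self _)))
        change S.F (S.E _) = _
        rw [pE]
      by_cases h3 : d' = l + (2 * i - 2) + 1
      · right
        subst h3
        intro y hy
        obtain ⟨c, z1, h1, h2⟩ := hVd2 y hy
        rw [h2, map_add, map_smul, pE']
        refine Submodule.add_mem _ (Submodule.smul_mem _ _ (Submodule.mem_sup_right ?_)) ?_
        · rw [show N + l - 1 - (l + (2 * i - 2) + 1) = N - 2 * i by omega]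
          exact Submodule.mem_span_singleton_self _
        · have := ih (l + (2 * i - 2)) (by omega) z1 h1
          rwa [show N + l - 1 - (l + (2 * i - 2)) = N + l - 1 - (l + (2 * i - 2) + 1) + 1 by omega] at this
      · left
        refine ⟨by omega, ?_⟩
        rintro ⟨c, hc⟩
        rw [hC] at hc; push_cast [Nat.cast_sub (show 1 ≤ N + l by omega)] at hc
        have : (c = 0) ∨ c < 0 ∨ 0 < c := by omega
        rcases this with h4 | h4 | h4
        · subst h4; apply h3; omega
        · have : c ≤ -1 := by omega
          have : (d':ℤ) ≤ N + l - 1 := by omega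
          nlinarith
        · have : 1 ≤ c := by omega
          nlinarith) (N + l - 1) le_rfl (S.F y) (by
      apply G.hF
      rwa [show N + l - 1 + 1 = N + l by omega])
  rw [Nat.sub_self, pow_zero] at hmain
  obtain ⟨u, ⟨z', hz', rfl⟩, w, hw, hsum⟩ := Submodule.mem_sup.1 hmain
  obtain ⟨v, rfl⟩ := Submodule.mem_span_singleton.1 hw
  change S.F (S.E z') + _ = S.F y at hsum
  obtain ⟨c, hc0, hc⟩ := P.p1 hq hi hiN
  have hv : v = 0 := by
    have h1 := congrArg (S.F ^ (N-1)) hsum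
    rw [map_add, pF', pF', map_smul, hc, S.F_ge (s := N-1+1) (by omega), S.F_ge (s := N-1+1) (by omega),
      zero_add, smul_smul] at h1
    have h2 : a ≠ 0 := by simpa using hEa' 0 hN
    have := (smul_eq_zero.1 h1).resolve_right h2
    exact (mul_eq_zero.1 this).resolve_right hc0
  rw [hv, zero_smul, add_zero] at hsum
  refine ⟨-z', by simp [hsum], (V _).add_mem hy ?_⟩
  have := G.hE _ _ ((V _).neg_mem hz')
  rwa [show N + l - 1 + 1 = N + l by omega] at this

end gr
end QS
end QFLP

namespace QFLP
namespace QS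
variable {k : Type} [Field k] {N : ℕ} {q : k} {M : Type} [AddCommGroup M] [Module k M]

/-- Pairs together with the `Z`-signs. -/
structure PairZ (S : QS k N q M) (i j : ℕ) (a g : M) : Prop extends S.PairL i a g where
  za : S.Z a = (-1 : k) ^ (j + 1) • a
  zg : S.Z g = (-1 : k) ^ j • g

/-- the vectors generated by a pair -/
def fam (S : QS k N q M) (a g : M) (x : (Unit ⊕ Unit) × Fin N) : M :=
  (S.E ^ (x.2 : ℕ)) (Sum.elim (fun _ => a) (fun _ => g) x.1)

/-- `M` is freely generated by the pair `(a, g)`. -/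
structure Full (S : QS k N q M) (i j : ℕ) (a g : M) : Prop extends S.PairZ i j a g where
  hq : IsPrimitiveRoot q N
  hi : 1 ≤ i
  hiN : 2 * i ≤ N
  ind : LinearIndependent k (S.fam a g)
  sp : ⊤ ≤ Submodule.span k (Set.range (S.fam a g))

namespace Full
variable {S : QS k N q M} {i j : ℕ} {a g : M} (H : S.Full i j a g)
include H

def bas : Module.Basis ((Unit ⊕ Unit) × Fin N) k M := Module.Basis.mk H.ind H.sp

theorem bas_a (s : Fin N) : H.bas (Sum.inl (), s) = (S.E ^ (s:ℕ)) a := by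
  simp [bas, fam]
theorem bas_g (s : Fin N) : H.bas (Sum.inr (), s) = (S.E ^ (s:ℕ)) g := by
  simp [bas, fam]

theorem fin : Module.Finite k M := Module.Finite.of_basis H.bas
theorem rank : Module.finrank k M = 2 * N := by
  rw [Module.finrank_eq_card_basis H.bas]; simp

theorem ext' {M' : Type} [AddCommGroup M'] [Module k M'] {f f' : M →ₗ[k] M'}
    (h1 : ∀ s : ℕ, f ((S.E ^ s) a) = f' ((S.E ^ s) a))
    (h2 : ∀ s : ℕ, f ((S.E ^ s) g) = f' ((S.E ^ s) g)) : f = f' := by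
  apply H.bas.ext
  rintro ⟨⟨⟩ | ⟨⟩, s⟩
  · rw [bas_a]; exact h1 s
  · rw [bas_g]; exact h2 s

theorem hN : 0 < N := by have := H.hi; have := H.hiN; omega
theorem hq0 : q ≠ 0 := H.hq.ne_zero H.hN.ne'

theorem E_a_ne : (S.E ^ (N-1)) a ≠ 0 := by
  have := H.ind.ne_zero (Sum.inl (), (⟨N - 1, by have := H.hN; omega⟩ : Fin N))
  simpa [fam] using this

theorem exact (x : M) (hx : S.F x = 0) : ∃ y, (S.F ^ (N-1)) y = x := by
  have := H.fin
  obtain ⟨c1, hc1, h1⟩ := H.toPairL.p1 H.hq H.hi H.hiN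
  obtain ⟨c2, hc2, h2⟩ := H.toPairL.p2 H.hq H.hi H.hiN
  have hi := H.hi
  have hiN := H.hiN
  refine nilp_exact (ι := Unit ⊕ Unit) S.F S.fn
    (Sum.elim (fun _ => c1⁻¹ • (S.E ^ (N - 2 * i)) g) (fun _ => c2⁻¹ • (S.E ^ (N-1)) g)) ?_ ?_ H.hN x hx
  · have h3 := H.ind.comp (Sum.elim (fun _ => (Sum.inl (), (⟨0, H.hN⟩ : Fin N)))
      (fun _ => (Sum.inl (), (⟨2 * i - 1, by omega⟩ : Fin N))) : Unit ⊕ Unit → _) (by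
        rintro (⟨⟩ | ⟨⟩) (⟨⟩ | ⟨⟩) h
        · rfl
        · simp at h; omega
        · simp at h; omega
        · rfl)
    convert h3 using 1
    funext l
    rcases l with ⟨⟩ | ⟨⟩
    · simp only [Sum.elim_inl, map_smul, h1, Function.comp, fam]
      rw [smul_smul, inv_mul_cancel₀ hc1]; simp
    · simp only [Sum.elim_inr, map_smul, h2, Function.comp, fam]
      rw [smul_smul, inv_mul_cancel₀ hc2]; simp
  · rw [H.rank]; simp

/-- degrees of basis vectors -/
def deg (i : ℕ) (x : (Unit ⊕ Unit) × Fin N) : ℤ :=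
  Sum.elim (fun _ => 0) (fun _ => 2 * (i:ℤ) - 1) x.1 + (x.2 : ℕ)

/-- projection to degree `d` -/
def pr (d : ℤ) : Module.End k M :=
  H.bas.constr k (fun x => if deg i x = d then H.bas x else 0)

theorem pr_a (d : ℤ) (s : ℕ) : H.pr d ((S.E ^ s) a) = if (s:ℤ) = d then (S.E ^ s) a else 0 := by
  by_cases hs : s < N
  · have := H.bas.constr_basis k (fun x => if deg i x = d then H.bas x else 0) (Sum.inl (), ⟨s, hs⟩)
    rw [bas_a] at this
    unfold pr
    rw [this]; simp [deg]
  · rw [S.E_ge (by omega)]; simp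

theorem pr_g (d : ℤ) (s : ℕ) :
    H.pr d ((S.E ^ s) g) = if 2 * (i:ℤ) - 1 + s = d then (S.E ^ s) g else 0 := by
  by_cases hs : s < N
  · have := H.bas.constr_basis k (fun x => if deg i x = d then H.bas x else 0) (Sum.inr (), ⟨s, hs⟩)
    rw [bas_g] at this
    unfold pr
    rw [this]; simp [deg]; rfl
  · rw [S.E_ge (by omega)]; simp

theorem pr_pr (d : ℤ) (x : M) : H.pr d (H.pr d x) = H.pr d x := by
  have : H.pr d ∘ₗ H.pr d = H.pr d := by
    apply H.ext'
    · intro s; simp only [LinearMap.comp_apply, H.pr_a]; split_ifs with h <;> simp [H.pr_a, h]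
    · intro s; simp only [LinearMap.comp_apply, H.pr_g]; split_ifs with h <;> simp [H.pr_g, h]
  exact LinearMap.congr_fun this x

theorem pr_E (d : ℤ) (x : M) : H.pr (d+1) (S.E x) = S.E (H.pr d x) := by
  have : H.pr (d+1) ∘ₗ S.E = S.E ∘ₗ H.pr d := by
    apply H.ext'
    · intro s; simp only [LinearMap.comp_apply, H.pr_a, pE]
      split_ifs with h h' <;> simp [pE] <;> (exfalso; push_cast at h; omega)
    · intro s; simp only [LinearMap.comp_apply, H.pr_g, pE]
      split_ifs with h h' <;> simp [pE] <;> (exfalso; push_cast at h; omega)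
  exact LinearMap.congr_fun this x

theorem pr_F (d : ℤ) (x : M) : H.pr d (S.F x) = S.F (H.pr (d+1) x) := by
  have hi := H.hi
  have : H.pr d ∘ₗ S.F = S.F ∘ₗ H.pr (d+1) := by
    apply H.ext'
    · intro s; simp only [LinearMap.comp_apply, H.pr_a]
      rcases s with _ | s
      · simp only [pow_zero, Module.End.one_apply, H.fa, map_zero]
        split_ifs <;> simp [H.fa]
      · rw [S.fEs0 H.hq0 _ H.la H.fa, map_smul, H.pr_a]
        split_ifs with h h' h'
        · rw [S.fEs0 H.hq0 _ H.la H.fa]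
        · exfalso; push_cast at h'; omega
        · exfalso; push_cast at h'; omega
        · simp
    · intro s; simp only [LinearMap.comp_apply, H.pr_g]
      rcases s with _ | s
      · simp only [pow_zero, Module.End.one_apply, H.fg, map_zero, H.pr_a]
        split_ifs with h h' h'
        · rw [H.fg]
        · exfalso; push_cast at h'; omega
        · exfalso; push_cast at h'; omega
        · simp
      · rw [H.toPairL.f_g H.hq H.hi H.hiN, map_add, map_smul, map_smul, H.pr_a, H.pr_g]
        by_cases h : 2 * (i:ℤ) - 1 + ((s + 1 : ℕ) : ℤ) = d + 1
        · rw [if_pos h, if_pos (by push_cast at h ⊢; omega), if_pos (by push_cast at h ⊢; omega),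
            H.toPairL.f_g H.hq H.hi H.hiN]
        · rw [if_neg h, if_neg (by push_cast at h ⊢; omega), if_neg (by push_cast at h ⊢; omega)]
          simp
  exact LinearMap.congr_fun this x

theorem L_a (s : ℕ) : S.L ((S.E ^ s) a) = q ^ (2 * (i:ℤ) - 2 - 2 * s) • (S.E ^ s) a := 
  S.lEs H.hq0 s H.la
theorem L_g (s : ℕ) : S.L ((S.E ^ s) g) = q ^ (2 * (i:ℤ) - 2 - 2 * (2 * (i:ℤ) - 1 + s)) • (S.E ^ s) g := by
  rw [S.lEs H.hq0 s H.lg]; congr 2; ring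

theorem pr_L (d : ℤ) (x : M) : S.L (H.pr d x) = q ^ (2 * (i:ℤ) - 2 - 2 * d) • H.pr d x := by
  have : S.L ∘ₗ H.pr d = q ^ (2 * (i:ℤ) - 2 - 2 * d) • H.pr d := by
    apply H.ext'
    · intro s; simp only [LinearMap.comp_apply, LinearMap.smul_apply, H.pr_a]
      split_ifs with h
      · rw [H.L_a, h]
      · simp
    · intro s; simp only [LinearMap.comp_apply, LinearMap.smul_apply, H.pr_g]
      split_ifs with h
      · rw [H.L_g, h]
      · simp
  exact LinearMap.congr_fun this x

theorem pr_L' (d : ℤ) (x : M) : H.pr d (S.L x) = S.L (H.pr d x) := by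
  rw [pr_L]
  have : H.pr d ∘ₗ S.L = q ^ (2 * (i:ℤ) - 2 - 2 * d) • H.pr d := by
    apply H.ext'
    · intro s; simp only [LinearMap.comp_apply, LinearMap.smul_apply, H.pr_a, H.L_a, map_smul]
      split_ifs with h
      · rw [h]
      · simp
    · intro s; simp only [LinearMap.comp_apply, LinearMap.smul_apply, H.pr_g, H.L_g, map_smul]
      split_ifs with h
      · rw [h]
      · simp
  exact LinearMap.congr_fun this x

theorem pr_Z (d : ℤ) (x : M) : S.Z (H.pr d x) = (-1 : k) ^ ((j:ℤ) + 1 + d) • H.pr d x := by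
  have hm : (-1 : k) ≠ 0 := by simp
  have : S.Z ∘ₗ H.pr d = (-1 : k) ^ ((j:ℤ) + 1 + d) • H.pr d := by
    apply H.ext'
    · intro s; simp only [LinearMap.comp_apply, LinearMap.smul_apply, H.pr_a]
      split_ifs with h
      · rw [S.zEs s H.za, ← h]
        congr 1
        rw [zpow_add₀ hm]
        norm_cast
      · simp
    · intro s; simp only [LinearMap.comp_apply, LinearMap.smul_apply, H.pr_g]
      split_ifs with h
      · rw [S.zEs s H.zg, ← h]
        congr 1
        rw [show (j:ℤ) + 1 + (2 * (i:ℤ) - 1 + s) = ((j:ℤ) + s) + 2 * i by ring, zpow_add₀ hm,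
          zpow_add₀ hm, zpow_mul]
        norm_cast; simp
      · simp
  exact LinearMap.congr_fun this x

theorem pr_neg (d : ℤ) (hd : d < 0) (x : M) : H.pr d x = 0 := by
  have hi := H.hi
  have : H.pr d = 0 := by
    apply H.ext'
    · intro s; rw [H.pr_a, if_neg (by omega)]; simp
    · intro s; rw [H.pr_g, if_neg (by omega)]; simp
  rw [this]; rfl

theorem pr_small (d : ℕ) (hd : d < 2 * i - 1) (x : M) : ∃ c : k, H.pr d x = c • (S.E ^ d) a := by
  have : LinearMap.range (H.pr d) ≤ Submodule.span k {(S.E ^ d) a} := by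
    unfold pr
    rw [Module.Basis.constr_range, Submodule.span_le]
    rintro _ ⟨⟨⟨⟩ | ⟨⟩, s⟩, rfl⟩
    · dsimp only
      split_ifs with h
      · simp only [deg, Sum.elim_inl] at h
        rw [H.bas_a, show (s:ℕ) = d by omega]
        exact Submodule.mem_span_singleton_self _
      · exact Submodule.zero_mem _
    · dsimp only
      rw [if_neg (by simp only [deg, Sum.elim_inr]; omega)]
      exact Submodule.zero_mem _
  obtain ⟨c, hc⟩ := Submodule.mem_span_singleton.1 (this ⟨x, rfl⟩)
  exact ⟨c, hc.symm⟩

end Full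
end QS
end QFLP

namespace QFLP
open QS
variable {k : Type} [Field k] {N : ℕ} {q : k} {P M : Type} [AddCommGroup P] [Module k P]
   [AddCommGroup M] [Module k M]

/-- `M` looks like the tensor product of `P` with an `m`-dimensional simple module. -/
structure Ten (SP : QS k N q P) (SM : QS k N q M) (m c j2 : ℕ) where
  θ : ℕ → P →ₗ[k] M
  π : ℕ → M →ₗ[k] P
  φ : ℕ → k
  πθ : ∀ s t x, t < m → π s (θ t x) = if s = t then x else 0
  θ0 : ∀ t, m ≤ t → θ t = 0
  π0 : ∀ t, m ≤ t → π t = 0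
  sum : ∀ x, ∑ t ∈ Finset.range m, θ t (π t x) = x
  tE : ∀ t x, t < m → SM.E (θ t x) = q ^ (c + t) • θ t (SP.E x) + θ (t+1) x
  tF : ∀ t x, t + 1 < m → SM.F (θ (t+1) x) = q⁻¹ ^ (c + t + 1) • θ (t+1) (SP.F x) + φ t • θ t (SP.L x)
  tF0 : ∀ x, 0 < m → SM.F (θ 0 x) = q⁻¹ ^ c • θ 0 (SP.F x)
  tL : ∀ t x, t < m → SM.L (θ t x) = q ^ ((m:ℤ) - 1 - 2 * t) • θ t (SP.L x)
  tZ : ∀ t x, t < m → SM.Z (θ t x) = (-1 : k) ^ ((j2:ℤ) + t) • θ t (SP.Z x)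

namespace Ten
variable {SP : QS k N q P} {SM : QS k N q M} {m c j2 : ℕ} (T : Ten SP SM m c j2)

theorem ext' {X : Type} [AddCommGroup X] [Module k X] {f f' : M →ₗ[k] X}
    (h : ∀ t y, t < m → f (T.θ t y) = f' (T.θ t y)) (x : M) : f x = f' x := by
  rw [← T.sum x, map_sum, map_sum]
  exact Finset.sum_congr rfl fun t ht => h t _ (Finset.mem_range.1 ht)

theorem eqπ {x y : M} (h : ∀ t, t < m → T.π t x = T.π t y) : x = y := by
  rw [← T.sum x, ← T.sum y]
  exact Finset.sum_congr rfl fun t ht => by rw [h t (Finset.mem_range.1 ht)]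

theorem πF (s : ℕ) (x : M) : T.π s (SM.F x) =
    q⁻¹ ^ (c + s) • SP.F (T.π s x) + T.φ s • SP.L (T.π (s+1) x) := by
  refine T.ext' (f := T.π s ∘ₗ SM.F)
    (f' := q⁻¹ ^ (c + s) • (SP.F ∘ₗ T.π s) + T.φ s • (SP.L ∘ₗ T.π (s+1))) ?_ x
  intro t y ht
  simp only [LinearMap.comp_apply, LinearMap.add_apply, LinearMap.smul_apply]
  rcases t with _ | t
  · rw [T.tF0 _ ht, map_smul, T.πθ _ _ _ ht, T.πθ _ _ _ ht, T.πθ _ _ _ ht, if_neg (Nat.succ_ne_zero s)]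
    by_cases hs : s = 0
    · subst hs; simp
    · simp [hs]
  · rw [T.tF _ _ ht, map_add, map_smul, map_smul, T.πθ _ _ _ ht, T.πθ _ _ _ ht, T.πθ _ _ _ ht,
      T.πθ _ _ _ (by omega)]
    by_cases hs : s = t + 1
    · subst hs; simp [add_assoc]
    · by_cases hs' : s = t
      · subst hs'; simp
      · simp [hs, hs']

theorem πE0 (x : M) (hm : 0 < m) : T.π 0 (SM.E x) = q ^ c • SP.E (T.π 0 x) := by
  refine T.ext' (f := T.π 0 ∘ₗ SM.E) (f' := q ^ c • (SP.E ∘ₗ T.π 0)) ?_ x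
  intro t y ht
  simp only [LinearMap.comp_apply, LinearMap.add_apply, LinearMap.smul_apply]
  rw [T.tE _ _ ht, map_add, map_smul, T.πθ _ _ _ ht, T.πθ _ _ _ ht]
  have : T.π 0 (T.θ (t+1) y) = 0 := by
    by_cases h : t + 1 < m
    · rw [T.πθ _ _ _ h]; simp
    · rw [T.θ0 _ (by omega)]; simp
  rw [this]
  by_cases h : 0 = t
  · subst h; simp
  · simp [h]

theorem πE (s : ℕ) (hs : s + 1 < m) (x : M) : T.π (s+1) (SM.E x) =
    q ^ (c + (s+1)) • SP.E (T.π (s+1) x) + T.π s x := by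
  refine T.ext' (f := T.π (s+1) ∘ₗ SM.E) (f' := q ^ (c + (s+1)) • (SP.E ∘ₗ T.π (s+1)) + T.π s) ?_ x
  intro t y ht
  simp only [LinearMap.comp_apply, LinearMap.add_apply, LinearMap.smul_apply]
  rw [T.tE _ _ ht, map_add, map_smul, T.πθ _ _ _ ht, T.πθ _ _ _ ht, T.πθ _ _ _ ht]
  have : T.π (s+1) (T.θ (t+1) y) = if s = t then y else 0 := by
    by_cases h : t + 1 < m
    · rw [T.πθ _ _ _ h]; simp
    · rw [T.θ0 _ (by omega), if_neg (by omega)]; simp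
  rw [this]
  by_cases h : s + 1 = t
  · subst h; simp
  · simp [h]

theorem πL (s : ℕ) (x : M) : T.π s (SM.L x) = q ^ ((m:ℤ) - 1 - 2 * s) • SP.L (T.π s x) := by
  refine T.ext' (f := T.π s ∘ₗ SM.L) (f' := q ^ ((m:ℤ) - 1 - 2 * s) • (SP.L ∘ₗ T.π s)) ?_ x
  intro t y ht
  simp only [LinearMap.comp_apply, LinearMap.smul_apply]
  rw [T.tL _ _ ht, map_smul, T.πθ _ _ _ ht, T.πθ _ _ _ ht]
  by_cases h : s = t
  · subst h; simp
  · simp [h]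

theorem πZ (s : ℕ) (x : M) : T.π s (SM.Z x) = (-1 : k) ^ ((j2:ℤ) + s) • SP.Z (T.π s x) := by
  refine T.ext' (f := T.π s ∘ₗ SM.Z) (f' := (-1 : k) ^ ((j2:ℤ) + s) • (SP.Z ∘ₗ T.π s)) ?_ x
  intro t y ht
  simp only [LinearMap.comp_apply, LinearMap.smul_apply]
  rw [T.tZ _ _ ht, map_smul, T.πθ _ _ _ ht, T.πθ _ _ _ ht]
  by_cases h : s = t
  · subst h; simp
  · simp [h]

/-- element with prescribed coordinates -/
def mkv (f : ℕ → P) : M := ∑ t ∈ Finset.range m, T.θ t (f t)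

theorem π_mkv (f : ℕ → P) (s : ℕ) (hs : s < m) : T.π s (T.mkv f) = f s := by
  unfold mkv
  rw [map_sum, Finset.sum_eq_single s]
  · rw [T.πθ _ _ _ hs, if_pos rfl]
  · intro t ht hne
    rw [T.πθ _ _ _ (Finset.mem_range.1 ht), if_neg (Ne.symm hne)]
  · intro h; exact absurd (Finset.mem_range.2 hs) h

def equiv : M ≃ₗ[k] (Fin m → P) where
  toFun x t := T.π t x
  map_add' x y := by ext; simp
  map_smul' r x := by ext; simp
  invFun f := T.mkv (fun t => if h : t < m then f ⟨t, h⟩ else 0)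
  left_inv x := by
    apply T.eqπ
    intro t ht
    rw [T.π_mkv _ _ ht]; simp [ht]
  right_inv f := by
    funext t
    refine (T.π_mkv _ _ t.2).trans ?_
    simp

include T in
theorem exact (hq0 : q ≠ 0) (hex : ∀ x, SP.F x = 0 → ∃ y, (SP.F ^ (N-1)) y = x) (x : M)
    (hx : SM.F x = 0) : ∃ y, (SM.F ^ (N-1)) y = x := by
  have hpow : ∀ r t y, t < m → (∀ s, t < s → T.π s ((SM.F ^ r) (T.θ t y)) = 0) ∧
      T.π t ((SM.F ^ r) (T.θ t y)) = (q⁻¹ ^ (c + t)) ^ r • (SP.F ^ r) y := by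
    intro r t y ht
    induction r with
    | zero =>
      refine ⟨fun s hs => ?_, ?_⟩
      · simp [T.πθ _ _ _ ht, hs.ne']
      · simp [T.πθ _ _ _ ht]
    | succ r ih =>
      refine ⟨fun s hs => ?_, ?_⟩
      · rw [← SM.pF, T.πF, ih.1 s hs, ih.1 (s+1) (by omega)]; simp
      · rw [← SM.pF, T.πF, ih.2, ih.1 (t+1) (by omega), map_zero, smul_zero, add_zero, map_smul,
          smul_smul, SP.pF, ← pow_succ']
  have key : ∀ t, ∀ x, SM.F x = 0 → (∀ s, t ≤ s → T.π s x = 0) → ∃ y, (SM.F ^ (N-1)) y = x := by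
    intro t
    induction t with
    | zero =>
      intro x _ h
      refine ⟨0, ?_⟩
      rw [map_zero]
      exact T.eqπ fun s _ => by rw [h s (by omega), map_zero]
    | succ t ih =>
      intro x hx h
      by_cases ht : t < m
      · have h1 := T.πF t x
        rw [hx, h (t+1) le_rfl, map_zero, map_zero, smul_zero, add_zero] at h1
        have h2 : SP.F (T.π t x) = 0 :=
          (smul_eq_zero.1 h1.symm).resolve_left (pow_ne_zero _ (inv_ne_zero hq0))
        obtain ⟨p, hp⟩ := hex _ h2
        have hu : (q⁻¹ ^ (c + t)) ^ (N-1) ≠ 0 := pow_ne_zero _ (pow_ne_zero _ (inv_ne_zero hq0))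
        set y := ((q⁻¹ ^ (c + t)) ^ (N-1))⁻¹ • T.θ t p with hy
        have hF : SM.F ((SM.F ^ (N-1)) y) = 0 := by
          rw [SM.pF, SM.F_ge (by omega)]
        obtain ⟨z, hz⟩ := ih (x - (SM.F ^ (N-1)) y) (by rw [map_sub, hx, hF, sub_zero]) (by
          intro s hs
          rcases Nat.eq_or_lt_of_le hs with h3 | h3
          · subst h3
            rw [map_sub, hy, map_smul, map_smul, (hpow _ _ _ ht).2, smul_smul, inv_mul_cancel₀ hu,
              one_smul, hp, sub_self]
          · rw [map_sub, hy, map_smul, map_smul, (hpow _ _ _ ht).1 s h3, h s h3]; simp)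
        exact ⟨z + y, by rw [map_add, hz]; abel⟩
      · refine ih x hx fun s hs => ?_
        rw [T.π0 s (by omega)]; rfl
  exact key m x hx fun s hs => by rw [T.π0 s hs]; rfl

section full
variable {i j1 : ℕ} {a g : P} (H : SP.Full i j1 a g)

/-- grading on `M` -/
def V (d : ℤ) : Submodule k M where
  carrier := {x | ∀ t, H.pr (d - (t:ℕ)) (T.π t x) = T.π t x}
  add_mem' := by intro x y hx hy t; simp only [map_add]; rw [hx t, hy t]
  zero_mem' := by intro t; simp
  smul_mem' := by intro r x hx t; simp only [map_smul]; rw [hx t]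

theorem mem_V (d : ℤ) (x : M) : x ∈ T.V H d ↔ ∀ t : ℕ, H.pr (d - (t:ℕ)) (T.π t x) = T.π t x := Iff.rfl

theorem mem_V' (d : ℤ) (x : M) : x ∈ T.V H d ↔
    ∀ t : ℕ, t < m → H.pr (d - (t:ℕ)) (T.π t x) = T.π t x := by
  refine ⟨fun h t _ => h t, fun h t => ?_⟩
  by_cases ht : t < m
  · exact h t ht
  · rw [T.π0 t (by omega)]; simp

theorem V_E (d : ℤ) (x : M) (hx : x ∈ T.V H d) : SM.E x ∈ T.V H (d+1) := by
  rw [mem_V'] 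
  intro t ht
  rcases t with _ | t
  · rw [T.πE0 _ ht, map_smul]
    have := hx 0
    have e : d + 1 - ((0:ℕ):ℤ) = (d - ((0:ℕ):ℤ)) + 1 := by ring
    rw [e, H.pr_E, this]
  · rw [T.πE _ ht, map_add, map_smul]
    have e : d + 1 - ((t+1:ℕ):ℤ) = (d - ((t+1:ℕ):ℤ)) + 1 := by ring
    have e' : d - ((t+1:ℕ):ℤ) + 1 = d - (t:ℕ) := by push_cast; ring
    rw [e, H.pr_E, hx (t+1), e', hx t]

theorem V_F (d : ℤ) (x : M) (hx : x ∈ T.V H (d+1)) : SM.F x ∈ T.V H d := by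
  intro t
  rw [T.πF, map_add, map_smul, map_smul, H.pr_F, H.pr_L']
  have e : d - (t:ℕ) + 1 = d + 1 - (t:ℕ) := by ring
  have e' : d - (t:ℕ) = d + 1 - ((t + 1 : ℕ):ℤ) := by push_cast; ring
  rw [e, hx t, e', hx (t+1)]

theorem V_neg (d : ℤ) (hd : d < 0) (x : M) (hx : x ∈ T.V H d) : x = 0 := by
  apply T.eqπ
  intro t _
  rw [← hx t, H.pr_neg _ (by omega), map_zero]

theorem V_L (d : ℤ) (x : M) (hx : x ∈ T.V H d) :
    SM.L x = q ^ ((2 * (i:ℤ) + m - 2) - 1 - 2 * d) • x := by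
  apply T.eqπ
  intro t _
  rw [T.πL, map_smul, ← hx t, H.pr_L, smul_smul, ← zpow_add₀ H.hq0]
  congr 2; ring

theorem V_Z (d : ℤ) (x : M) (hx : x ∈ T.V H d) :
    SM.Z x = (-1 : k) ^ ((j1:ℤ) + j2 + d + 1) • x := by
  apply T.eqπ
  intro t _
  have hm : (-1 : k) ≠ 0 := by simp
  rw [T.πZ, map_smul, ← hx t, H.pr_Z, smul_smul, ← zpow_add₀ hm]
  congr 2; ring

theorem V_lift (d : ℤ) (x : M) (hx : SM.F x ∈ T.V H d) : ∃ x' ∈ T.V H (d+1), SM.F x' = SM.F x := by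
  have h1 : ∀ t, T.π t (T.mkv fun t => H.pr (d + 1 - (t:ℕ)) (T.π t x)) = H.pr (d + 1 - (t:ℕ)) (T.π t x) := by
    intro t
    by_cases ht : t < m
    · rw [T.π_mkv _ _ ht]
    · rw [T.π0 t (by omega)]; simp
  refine ⟨T.mkv (fun t => H.pr (d + 1 - (t:ℕ)) (T.π t x)), ?_, ?_⟩
  · intro t
    rw [h1, H.pr_pr]
  · apply T.eqπ
    intro t _
    rw [← hx t, T.πF, T.πF, h1, h1, map_add, map_smul, map_smul, H.pr_F, H.pr_L']
    have e : d - (t:ℕ) + 1 = d + 1 - (t:ℕ) := by ring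
    have e' : d - (t:ℕ) = d + 1 - ((t + 1 : ℕ):ℤ) := by push_cast; ring
    rw [e, e']

theorem gr : Gr SM (fun d : ℕ => T.V H d) (2 * (i:ℤ) + m - 2) where
  hE d y hy := by have := T.V_E H d y hy; push_cast; exact this
  hF d y hy := by apply T.V_F H d; push_cast at hy; exact hy
  hF0 y hy := by
    apply T.V_neg H (-1) (by omega)
    apply T.V_F H; simpa using hy
  hL d y hy := T.V_L H d y hy

/-- generators -/
def Y (a g : P) (x : ℕ ⊕ ℕ) : M := Sum.elim (fun t => T.θ t a) (fun t => T.θ t g) x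

theorem θ_mem_a (t s : ℕ) : T.θ t ((SP.E ^ s) a) ∈ T.V H (t + s : ℕ) := by
  by_cases ht : t < m
  · intro t'
    rw [T.πθ _ _ _ ht]
    split_ifs with h
    · subst h; rw [H.pr_a, if_pos (by push_cast; ring)]
    · simp
  · rw [T.θ0 t (by omega)]; exact Submodule.zero_mem _

theorem θ_mem_g (t s : ℕ) : T.θ t ((SP.E ^ s) g) ∈ T.V H (t + s + (2 * i - 1) : ℕ) := by
  have hi := H.hi
  by_cases ht : t < m
  · intro t'
    rw [T.πθ _ _ _ ht]
    split_ifs with h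
    · subst h; rw [H.pr_g, if_pos (by push_cast [Nat.cast_sub (show 1 ≤ 2 * i by omega)]; ring)]
    · simp
  · rw [T.θ0 t (by omega)]; exact Submodule.zero_mem _

theorem θ_E (hq0 : q ≠ 0) (t : ℕ) (x : P) : T.θ t (SP.E x) =
    (q ^ (c + t))⁻¹ • (SM.E (T.θ t x) - T.θ (t+1) x) := by
  by_cases ht : t < m
  · rw [T.tE _ _ ht, add_sub_cancel_right, smul_smul, inv_mul_cancel₀ (pow_ne_zero _ hq0), one_smul]
  · rw [T.θ0 t (by omega), T.θ0 (t+1) (by omega)]; simp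

theorem gen_step (d : ℕ) : ∀ s t : ℕ, t + s = d + 1 →
    ∃ c : k, ∃ z ∈ T.V H d, T.θ t ((SP.E ^ s) a) = c • T.θ (d+1) a + SM.E z := by
  intro s
  induction s with
  | zero =>
    intro t ht
    obtain rfl : t = d + 1 := by omega
    exact ⟨1, 0, Submodule.zero_mem _, by simp⟩
  | succ s ih =>
    intro t ht
    obtain ⟨c1, z1, hz1, h1⟩ := ih (t+1) (by omega)
    rw [← SP.pE, T.θ_E H.hq0, h1]
    refine ⟨-((q ^ (c + t))⁻¹ * c1), (q ^ (c + t))⁻¹ • (T.θ t ((SP.E ^ s) a) - z1), ?_, ?_⟩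
    · apply Submodule.smul_mem
      apply Submodule.sub_mem _ _ hz1
      have := T.θ_mem_a H t s
      rwa [show t + s = d by omega] at this
    · rw [map_smul, map_sub]; module

theorem gen0 (y : M) (hy : y ∈ T.V H (0:ℕ)) : ∃ c : k, y = c • T.θ 0 a := by
  have hi := H.hi
  by_cases hm : 0 < m
  · obtain ⟨c, hc⟩ := H.pr_small 0 (by omega) (T.π 0 y)
    refine ⟨c, T.eqπ fun t ht => ?_⟩
    rw [map_smul, T.πθ _ _ _ hm, ← hy t]
    rcases t with _ | t
    · simpa using hc
    · rw [H.pr_neg _ (by push_cast; omega)]; simp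
  · exact ⟨0, T.eqπ fun t ht => by omega⟩

theorem gen (d : ℕ) (hd : d + 1 < 2 * i - 1) (y : M) (hy : y ∈ T.V H (d+1 : ℕ)) :
    ∃ c : k, ∃ z ∈ T.V H d, y = c • T.θ (d+1) a + SM.E z := by
  have hterm : ∀ t : ℕ, ∃ c : k, ∃ z ∈ T.V H d, T.θ t (T.π t y) = c • T.θ (d+1) a + SM.E z := by
    intro t
    rw [← hy t]
    by_cases ht : t ≤ d + 1
    · obtain ⟨c1, hc1⟩ := H.pr_small (d + 1 - t) (by omega) (T.π t y)
      obtain ⟨c2, z, hz, h2⟩ := T.gen_step H d (d + 1 - t) t (by omega)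
      rw [show ((d + 1 : ℕ):ℤ) - (t:ℕ) = ((d + 1 - t : ℕ):ℤ) by omega, hc1, map_smul, h2]
      exact ⟨c1 * c2, c1 • z, Submodule.smul_mem _ _ hz, by rw [map_smul]; module⟩
    · rw [H.pr_neg _ (by omega), map_zero]
      exact ⟨0, 0, Submodule.zero_mem _, by simp⟩
  choose c z hz h using hterm
  refine ⟨∑ t ∈ Finset.range m, c t, ∑ t ∈ Finset.range m, z t, Submodule.sum_mem _ fun t _ => hz t, ?_⟩
  rw [map_sum, Finset.sum_smul, ← Finset.sum_add_distrib]
  conv_lhs => rw [← T.sum y]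
  exact Finset.sum_congr rfl fun t _ => h t

include T H in
theorem finM : Module.Finite k M := by
  have := H.fin
  exact Module.Finite.equiv T.equiv.symm

include T H in
theorem rankM : Module.finrank k M = m * (2 * N) := by
  have := H.fin
  rw [T.equiv.finrank_eq, Module.finrank_pi_fintype]
  simp [H.rank]

include T H in
theorem indY : LinearIndependent k
    (fun l : Fin m ⊕ Fin m => (SM.E ^ (N-1)) (T.Y a g (Sum.map (fun t : Fin m => (t:ℕ)) (fun t : Fin m => (t:ℕ)) l))) := by
  have hfin := T.finM H
  have hN := H.hN
  set fm : (Fin m ⊕ Fin m) × Fin N → M := fun x => (SM.E ^ (x.2:ℕ))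
    (T.Y a g (Sum.map (fun t : Fin m => (t:ℕ)) (fun t : Fin m => (t:ℕ)) x.1)) with hfm
  have hE : ∀ x ∈ Submodule.span k (Set.range fm), SM.E x ∈ Submodule.span k (Set.range fm) := by
    intro x hx
    induction hx using Submodule.span_induction with
    | mem x hx =>
      obtain ⟨⟨l, s⟩, rfl⟩ := hx
      simp only [hfm, SM.pE]
      by_cases hs : (s:ℕ) + 1 < N
      · exact Submodule.subset_span ⟨(l, ⟨(s:ℕ) + 1, hs⟩), rfl⟩
      · rw [SM.E_ge (by omega)]; exact Submodule.zero_mem _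
    | zero => simp
    | add x y _ _ hx hy => rw [map_add]; exact Submodule.add_mem _ hx hy
    | smul r x _ hx => rw [map_smul]; exact Submodule.smul_mem _ _ hx
  have hstep : ∀ v : P, (∀ t, T.θ t v ∈ Submodule.span k (Set.range fm)) → ∀ s t,
      T.θ t ((SP.E ^ s) v) ∈ Submodule.span k (Set.range fm) := by
    intro v hv s
    induction s with
    | zero => intro t; simpa using hv t
    | succ s ih =>
      intro t
      rw [← SP.pE, T.θ_E H.hq0]
      exact Submodule.smul_mem _ _ (Submodule.sub_mem _ (hE _ (ih t)) (ih (t+1)))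
  have ha : ∀ s t, T.θ t ((SP.E ^ s) a) ∈ Submodule.span k (Set.range fm) := by
    apply hstep
    intro t
    by_cases ht : t < m
    · refine Submodule.subset_span ⟨(Sum.inl ⟨t, ht⟩, ⟨0, hN⟩), ?_⟩
      simp [hfm, Y]
    · rw [T.θ0 t (by omega)]; exact Submodule.zero_mem _
  have hg : ∀ s t, T.θ t ((SP.E ^ s) g) ∈ Submodule.span k (Set.range fm) := by
    apply hstep
    intro t
    by_cases ht : t < m
    · refine Submodule.subset_span ⟨(Sum.inr ⟨t, ht⟩, ⟨0, hN⟩), ?_⟩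
      simp [hfm, Y]
    · rw [T.θ0 t (by omega)]; exact Submodule.zero_mem _
  have htop : ⊤ ≤ Submodule.span k (Set.range fm) := by
    intro x _
    rw [← T.sum x]
    refine Submodule.sum_mem _ fun t _ => ?_
    have : (⊤ : Submodule k P) ≤ (Submodule.span k (Set.range fm)).comap (T.θ t) := by
      refine H.sp.trans (Submodule.span_le.2 ?_)
      rintro _ ⟨⟨⟨⟩ | ⟨⟩, s⟩, rfl⟩
      · exact ha _ _
      · exact hg _ _
    exact this trivial
  have hind : LinearIndependent k fm := by
    apply linearIndependent_of_top_le_span_of_card_eq_finrank htop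
    rw [T.rankM H]; simp; ring
  have := hind.comp (fun l => (l, (⟨N-1, by omega⟩ : Fin N))) (by
    intro l l' h; exact (Prod.ext_iff.1 h).1)
  exact this

/-- degree of the generators -/
def dY (i : ℕ) (x : ℕ ⊕ ℕ) : ℕ := Sum.elim (fun t => t) (fun t => t + (2 * i - 1)) x
def tY (x : ℕ ⊕ ℕ) : ℕ := Sum.elim (fun t => t) (fun t => t) x

/-- the numerical condition under which a generator yields a direct summand -/
def Good (N m i j1 j2 : ℕ) (x : ℕ ⊕ ℕ) (i' j' : ℕ) : Prop :=
  1 ≤ i' ∧ 2 * i' ≤ N ∧ tY x < m ∧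
  (N:ℤ) ∣ (2 * (i:ℤ) + m - 2) - 1 - 2 * (dY i x : ℕ) - (2 * (i':ℤ) - 2) ∧
  (j1 + j2 + dY i x + j') % 2 = 0 ∧
  ((∀ d' < dY i x, dY i x - d' < N ∧ ¬ (N:ℤ) ∣ (2 * (i:ℤ) + m - 2) - d' - (dY i x : ℕ)) ∨
   ∃ h l : ℕ, dY i x = N + l ∧ l < h ∧ l < m ∧ 2 * i + m - 1 = N + 2 * h ∧ h < i)

include T H in
theorem good_pair {x : ℕ ⊕ ℕ} {i' j' : ℕ} (hG : Good N m i j1 j2 x i' j') :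
    ∃ a' g', SM.PairZ i' j' a' g' ∧ (SM.E ^ (N-1)) a' = (SM.E ^ (N-1)) (T.Y a g x) := by
  have hfin := T.finM H
  have hN := H.hN
  have hi := H.hi
  have hiN := H.hiN
  obtain ⟨h1, h2, h3, h4, h5, h6⟩ := hG
  have hmem : T.Y a g x ∈ T.V H (dY i x : ℕ) := by
    rcases x with t | t
    · exact T.θ_mem_a H t 0
    · exact T.θ_mem_g H t 0
  have hex := T.exact H.hq0 H.exact
  obtain ⟨z, hz1, hz2⟩ : ∃ z, SM.F (T.Y a g x + SM.E z) = 0 ∧ T.Y a g x + SM.E z ∈ T.V H (dY i x : ℕ) := by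
    rcases h6 with h6 | ⟨h, l, e1, e2, e3, e4, e5⟩
    · obtain ⟨z, hz1, hz2, -, -⟩ := (T.gr H).low H.hq hN (dY i x) _ hmem h6
      exact ⟨z, hz1, hz2⟩
    · rw [e1] at hmem ⊢
      refine (T.gr H).special H.hq hN (fun t => T.θ t a) (p := 2 * i - 1) ?_ (T.gen0 H) (T.gen H) ?_ hex
        h l e2 (by omega) (by omega) (by omega) ?_ _ hmem
      · intro d; exact T.θ_mem_a H d 0
      · intro d x hx
        have := T.V_lift H d x hx
        push_cast
        exact this
      · have := (T.indY H).ne_zero (Sum.inl ⟨l, e3⟩)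
        simpa [Y] using this
  set a' := T.Y a g x + SM.E z with ha'
  have hperiod : ∀ u v : ℤ, (N:ℤ) ∣ u - v → q ^ u = q ^ v := by
    intro u v huv
    have := (H.hq.zpow_eq_one_iff_dvd _).2 huv
    rw [zpow_sub₀ H.hq0] at this
    exact eq_of_div_eq_one this
  have hsgn : ∀ (u : ℤ) (v : ℕ), (u - v) % 2 = 0 → (-1 : k) ^ u = (-1) ^ v := by
    intro u v huv
    obtain ⟨w, hw⟩ := Int.dvd_of_emod_eq_zero huv
    have hm : (-1 : k) ≠ 0 := by simp
    rw [show u = (v:ℤ) + 2 * w by omega, zpow_add₀ hm, zpow_mul]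
    norm_cast; simp
  have la : SM.L a' = q ^ (2 * (i':ℤ) - 2) • a' := by
    rw [T.V_L H _ _ hz2]
    congr 1
    exact hperiod _ _ h4
  obtain ⟨g0, hg0⟩ := exists_g H.hq0 h1 h2 la hz1 hex
  obtain ⟨g', hg1, hg2⟩ := T.V_lift H ((dY i x + (2 * i' - 2) : ℕ)) g0 (by
    rw [hg0]; exact (T.gr H).hEs _ _ _ hz2)
  rw [hg0] at hg2
  refine ⟨a', g', ⟨⟨la, hz1, ?_, hg2⟩, ?_, ?_⟩, ?_⟩
  · rw [T.V_L H _ _ hg1]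
    congr 1
    apply hperiod
    convert h4 using 1
    push_cast [Nat.cast_sub (show 2 ≤ 2 * i' by omega)]; ring
  · rw [T.V_Z H _ _ hz2]
    congr 1
    apply hsgn; push_cast; omega
  · rw [T.V_Z H _ _ hg1]
    congr 1
    apply hsgn; push_cast; omega
  · rw [ha', map_add, SM.pE', SM.E_ge (s := N - 1 + 1) (by omega), add_zero]

include T H in
theorem main {ι : Type} [Fintype ι] (hι : Fintype.card ι = m) (e : ι → ℕ ⊕ ℕ) (he : Function.Injective e)
    (i' j' : ι → ℕ) (hG : ∀ l, Good N m i j1 j2 (e l) (i' l) (j' l)) :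
    ∃ a' g' : ι → M, (∀ l, SM.PairZ (i' l) (j' l) (a' l) (g' l)) ∧
      ⊤ ≤ Submodule.span k (Set.range
        (fun x : (ι ⊕ ι) × Fin N => (SM.E ^ (x.2 : ℕ)) (Sum.elim a' g' x.1))) := by
  choose a' g' hp hE using fun l => T.good_pair H (hG l)
  refine ⟨a', g', hp, ?_⟩
  have hfin := T.finM H
  have hind : LinearIndependent k (fun l => (SM.E ^ (N-1)) (a' l)) := by
    have hlt : ∀ l, tY (e l) < m := fun l => (hG l).2.2.1
    let e' : ι → Fin m ⊕ Fin m := fun l =>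
      match e l, hlt l with
      | Sum.inl t, h => Sum.inl ⟨t, h⟩
      | Sum.inr t, h => Sum.inr ⟨t, h⟩
    have hee : ∀ l, Sum.map (fun t : Fin m => (t:ℕ)) (fun t : Fin m => (t:ℕ)) (e' l) = e l := by
      intro l
      simp only [e']
      split <;> simp_all
    have := (T.indY H).comp e' (by
      intro l l' h
      apply he
      rw [← hee, ← hee, h])
    convert this using 1
    funext l
    simp only [Function.comp, hee, hE]
  have h2 := pairs_indep H.hq i' a' g' (fun l => (hG l).1) (fun l => (hG l).2.1) (fun l => (hp l).toPairL) hind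
  rw [h2.span_eq_top_of_card_eq_finrank' (by rw [T.rankM H]; simp [hι]; ring)]

end full
end Ten
end QFLP

namespace QFLP
open Ten

theorem low1 {N C : ℤ} {d d' : ℕ} (h : d' < d) (h1 : 2 * (d:ℤ) ≤ C) (h2 : C < N + d) :
    ¬ N ∣ C - d' - d := by
  rintro ⟨c, hc⟩
  have : c ≤ 0 ∨ 1 ≤ c := by omega
  rcases this with h3 | h3 <;> nlinarith

theorem low2 {N C : ℤ} {d d' : ℕ} (hN : 0 < N) (h : d' < d) (h1 : N + 2 * (d:ℤ) ≤ C) (h2 : C < 2 * N + d) :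
    ¬ N ∣ C - d' - d := by
  rintro ⟨c, hc⟩
  have : c ≤ 1 ∨ 2 ≤ c := by omega
  rcases this with h3 | h3 <;> nlinarith

theorem good1 {N m i j1 j2 : ℕ} {x : ℕ ⊕ ℕ} {i' j' : ℕ} (h1 : 1 ≤ i') (h2 : 2 * i' ≤ N)
    (h3 : tY x < m) (h4 : (2 * (i:ℤ) + m - 2) - 1 - 2 * (dY i x : ℕ) - (2 * (i':ℤ) - 2) = 0)
    (h5 : (j1 + j2 + dY i x + j') % 2 = 0)
    (h6 : 2 * (dY i x : ℤ) ≤ 2 * (i:ℤ) + m - 2) (h7 : 2 * (i:ℤ) + m - 2 < N + dY i x) :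
    Good N m i j1 j2 x i' j' := by
  refine ⟨h1, h2, h3, ⟨0, by rw [h4]; ring⟩, h5, Or.inl fun d' hd => ⟨by omega, low1 hd h6 h7⟩⟩

theorem good2 {N m i j1 j2 : ℕ} {x : ℕ ⊕ ℕ} {i' j' : ℕ} (h1 : 1 ≤ i') (h2 : 2 * i' ≤ N)
    (h3 : tY x < m) (h4 : (2 * (i:ℤ) + m - 2) - 1 - 2 * (dY i x : ℕ) - (2 * (i':ℤ) - 2) = N)
    (h5 : (j1 + j2 + dY i x + j') % 2 = 0)
    (h6 : N + 2 * (dY i x : ℤ) ≤ 2 * (i:ℤ) + m - 2) (h7 : 2 * (i:ℤ) + m - 2 < 2 * N + dY i x) :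
    Good N m i j1 j2 x i' j' := by
  refine ⟨h1, h2, h3, ⟨1, by rw [h4]; ring⟩, h5, Or.inl fun d' hd => ⟨by omega, low2 (by omega) hd h6 h7⟩⟩

theorem good3 {N m i j1 j2 : ℕ} {x : ℕ ⊕ ℕ} {i' j' : ℕ} (h1 : 1 ≤ i') (h2 : 2 * i' ≤ N)
    (h3 : tY x < m) (h4 : (2 * (i:ℤ) + m - 2) - 1 - 2 * (dY i x : ℕ) - (2 * (i':ℤ) - 2) = -N)
    (h5 : (j1 + j2 + dY i x + j') % 2 = 0) (h l : ℕ)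
    (h6 : dY i x = N + l) (h7 : l < h) (h8 : l < m) (h9 : 2 * i + m - 1 = N + 2 * h) (h10 : h < i) :
    Good N m i j1 j2 x i' j' := by
  refine ⟨h1, h2, h3, ⟨-1, by rw [h4]; ring⟩, h5, Or.inr ⟨h, l, h6, h7, h8, h9, h10⟩⟩

section
variable {N i1 i2 j1 j2 : ℕ} (hN : N % 4 = 0) (h1 : 1 ≤ i1) (h1' : i1 ≤ N / 2) (h2 : 1 ≤ i2) (h2' : i2 ≤ N / 2)
include hN h1 h1' h2 h2'

theorem good_a (hA : N - 2 * i2 + 1 ≤ 2 * i1 - 1) (hB : i1 ≤ i2) (l : Fin (N - 2 * i2 + 1)) :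
    Good N (N - 2 * i2 + 1) i1 j1 j2 (Sum.inl (l:ℕ)) (N / 2 + i1 - i2 - l) ((j1 + j2 + l) % 2) := by
  obtain ⟨l, hl⟩ := l
  apply good1 <;> simp only [tY, dY, Sum.elim_inl] <;> omega

def eB (N i1 i2 w : ℕ) : (Fin (i1 - i2) ⊕ Fin (i1 - i2)) ⊕ Fin w → ℕ ⊕ ℕ :=
  Sum.elim (Sum.elim (fun l => Sum.inl l) (fun l => Sum.inr (N + l - (2 * i1 - 1))))
    (fun l => Sum.inl (2 * (i1 - i2) + l))

def iB (N i1 i2 w : ℕ) : (Fin (i1 - i2) ⊕ Fin (i1 - i2)) ⊕ Fin w → ℕ :=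
  Sum.elim (Sum.elim (fun l => i1 - i2 - l) (fun l => i1 - i2 - l)) (fun l => N / 2 - i1 + i2 - l)

def jB (i1 i2 w j1 j2 : ℕ) : (Fin (i1 - i2) ⊕ Fin (i1 - i2)) ⊕ Fin w → ℕ :=
  Sum.elim (Sum.elim (fun l => (j1 + j2 + l) % 2) (fun l => (j1 + j2 + l) % 2)) (fun l => (j1 + j2 + l) % 2)

theorem good_b (w : ℕ) (hw : w ≤ N - 2 * i1 + 1) (hw' : w ≤ 2 * i2 - 1) (hB : i2 < i1)
    (l : (Fin (i1 - i2) ⊕ Fin (i1 - i2)) ⊕ Fin w) :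
    Good N (N - 2 * i2 + 1) i1 j1 j2 (eB N i1 i2 w l) (iB N i1 i2 w l) (jB i1 i2 w j1 j2 l) := by
  rcases l with (⟨l, hl⟩ | ⟨l, hl⟩) | ⟨l, hl⟩
  · apply good2 <;> simp only [tY, dY, Sum.elim_inl, eB, iB, jB, Sum.elim_inr] <;> omega
  · apply good3 (h := i1 - i2) (l := l) <;> (try simp only [tY, dY, Sum.elim_inl, eB, iB, jB, Sum.elim_inr]) <;> omega
  · apply good1 <;> simp only [tY, dY, Sum.elim_inl, eB, iB, jB, Sum.elim_inr] <;> omega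

theorem inj_b (w : ℕ) (hB : i2 < i1) : Function.Injective (eB N i1 i2 w) := by
  rintro ((⟨l, hl⟩ | ⟨l, hl⟩) | ⟨l, hl⟩) ((⟨l', hl'⟩ | ⟨l', hl'⟩) | ⟨l', hl'⟩) h <;>
    simp only [eB, Sum.elim_inl, Sum.elim_inr, Sum.inl.injEq, Sum.inr.injEq, reduceCtorEq] at h ⊢ <;>
    (try simp only [Fin.mk.injEq]) <;> omega

def eD (i1 i2 w : ℕ) : (Fin w ⊕ Fin w) → ℕ ⊕ ℕ :=
  Sum.elim (fun l => Sum.inl (2 * i1 - 1 + l)) (fun l => Sum.inr l)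
def iD (N i1 i2 w : ℕ) : (Fin w ⊕ Fin w) → ℕ :=
  Sum.elim (fun l => N / 2 - i1 - i2 + 1 - l) (fun l => N / 2 - i1 - i2 + 1 - l)
def jD (w j1 j2 : ℕ) : (Fin w ⊕ Fin w) → ℕ :=
  Sum.elim (fun l => (j1 + j2 + l + 1) % 2) (fun l => (j1 + j2 + l + 1) % 2)

theorem good_d (hA : 2 * i1 - 1 < N - 2 * i2 + 1) 
    (l : (Fin (N / 2 - i1 - i2 + 1) ⊕ Fin (N / 2 - i1 - i2 + 1))) :
    Good N (N - 2 * i2 + 1) i1 j1 j2 (eD i1 i2 _ l) (iD N i1 i2 _ l) (jD _ j1 j2 l) := by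
  rcases l with ⟨l, hl⟩ | ⟨l, hl⟩
  · apply good1 <;> simp only [tY, dY, Sum.elim_inl, eD, iD, jD, Sum.elim_inr] <;> omega
  · apply good1 <;> simp only [tY, dY, Sum.elim_inl, eD, iD, jD, Sum.elim_inr] <;> omega

theorem good_c (hA : 2 * i1 - 1 < N - 2 * i2 + 1) (hB : i1 ≤ i2) (l : Fin (2 * i1 - 1)) :
    Good N (N - 2 * i2 + 1) i1 j1 j2 (Sum.inl (l:ℕ)) (N / 2 + i1 - i2 - l) ((j1 + j2 + l) % 2) := by
  obtain ⟨l, hl⟩ := l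
  apply good1 <;> simp only [tY, dY, Sum.elim_inl] <;> omega

theorem inj_c : Function.Injective (Sum.elim (fun l : Fin (2 * i1 - 1) => Sum.inl (l:ℕ))
    (eD i1 i2 (N / 2 - i1 - i2 + 1))) := by
  rintro (⟨l, hl⟩ | (⟨l, hl⟩ | ⟨l, hl⟩)) (⟨l', hl'⟩ | (⟨l', hl'⟩ | ⟨l', hl'⟩)) h <;>
    simp only [eD, Sum.elim_inl, Sum.elim_inr, Sum.inl.injEq, Sum.inr.injEq, reduceCtorEq] at h ⊢ <;>
    (try simp only [Fin.mk.injEq]) <;> omega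

theorem inj_d (hA : 2 * i1 - 1 < N - 2 * i2 + 1) (hB : i2 < i1) : Function.Injective (Sum.elim (eB N i1 i2 (2 * i2 - 1))
    (eD i1 i2 (N / 2 - i1 - i2 + 1))) := by
  rintro (((⟨l, hl⟩ | ⟨l, hl⟩) | ⟨l, hl⟩) | (⟨l, hl⟩ | ⟨l, hl⟩)) (((⟨l', hl'⟩ | ⟨l', hl'⟩) | ⟨l', hl'⟩) | (⟨l', hl'⟩ | ⟨l', hl'⟩)) h <;>
    simp only [eB, eD, Sum.elim_inl, Sum.elim_inr, Sum.inl.injEq, Sum.inr.injEq, reduceCtorEq] at h ⊢ <;>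
    (try simp only [Fin.mk.injEq]) <;> omega

end
end QFLP

namespace QFLP
section
variable {k : Type} [Field k]

/-- the standing hypotheses -/
structure Hyp (n : ℕ) (q : k) : Prop where
  hn : 0 < n
  h4 : 4 ∣ n
  hq : IsPrimitiveRoot q (n ^ 2)

/-- `q`-commutation -/
def QC {A : Type} [Ring A] [Algebra k A] (c : k) (x y : A) : Prop := x * y = c • (y * x)

namespace QC
variable {A : Type} [Ring A] [Algebra k A] {c c' : k} {x x' xi y y' : A}

theorem of (h : x * y * xi = c • y) (h1 : xi * x = 1) : QC c x y := by
  unfold QC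
  calc x * y = x * y * (xi * x) := by rw [h1, mul_one]
    _ = (x * y * xi) * x := by simp only [mul_assoc]
    _ = _ := by rw [h, smul_mul_assoc]

theorem mul (h : QC c x y) (h' : QC c' x' y) : QC (c * c') (x * x') y := by
  unfold QC at *
  rw [mul_assoc, h', mul_smul_comm, ← mul_assoc, h, smul_mul_assoc, smul_smul, mul_assoc, mul_comm c']

theorem pow (h : QC c x y) (r : ℕ) : QC (c ^ r) (x ^ r) y := by
  induction r with
  | zero => simp [QC]
  | succ r ih => rw [pow_succ, pow_succ]; exact ih.mul h

theorem inv (h : QC c x y) (hc : c ≠ 0) (h1 : xi * x = 1) (h2 : x * xi = 1) : QC c⁻¹ xi y := by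
  unfold QC at *
  have : y * xi = c • (xi * y) := by
    calc y * xi = (xi * x) * y * xi := by rw [h1, one_mul]
      _ = xi * (x * y) * xi := by simp only [mul_assoc]
      _ = c • (xi * (y * (x * xi))) := by rw [h, mul_smul_comm, smul_mul_assoc]; simp only [mul_assoc]
      _ = _ := by rw [h2, mul_one]
  rw [this, smul_smul, inv_mul_cancel₀ hc, one_smul]
end QC

variable {n : ℕ} {q : k}

namespace Hyp
variable (h : Hyp n q)
include h

theorem q0 : q ≠ 0 := h.hq.ne_zero (by have := h.hn; positivity)
theorem N4 : n ^ 2 % 4 = 0 := by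
  obtain ⟨w, rfl⟩ := h.h4
  rw [show (4 * w) ^ 2 = 4 * (4 * w ^ 2) by ring]; omega
theorem N0 : 0 < n ^ 2 := by have := h.hn; positivity
theorem qN : q ^ (n ^ 2) = 1 := h.hq.pow_eq_one
theorem qhalf : q ^ (n ^ 2 / 2) = -1 := by
  have h1 := h.N4
  have h2 := h.N0
  have h3 : q ^ (n ^ 2 / 2) * q ^ (n ^ 2 / 2) = 1 := by
    rw [← pow_add, show n ^ 2 / 2 + n ^ 2 / 2 = n ^ 2 by omega, h.qN]
  rcases mul_self_eq_one_iff.1 h3 with h4 | h4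
  · exfalso
    exact h.hq.pow_ne_one_of_pos_of_lt (by omega) (by omega) h4
  · exact h4
end Hyp

variable (k n q) in
def uL : QFL.U k n q := QFL.Kinv k n q * QFL.Kh k n q
variable (k n q) in
def uZ : QFL.U k n q := QFL.K k n q * QFL.Kh k n q ^ (n / 2)

local notation "uK" => QFL.K k n q
local notation "uKh" => QFL.Kh k n q
local notation "uE" => QFL.E k n q
local notation "uF" => QFL.F k n q
local notation "uKi" => QFL.Kinv k n q
local notation "uLL" => uL k n q
local notation "uZZ" => uZ k n q

theorem rK : uK ^ n = 1 := by
  have := RingQuot.mkAlgHom_rel k (QFL.Rel.Kord (k := k) (n := n) (q := q))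
  simpa [QFL.K] using this
theorem rKh : uKh ^ n = uKi ^ 2 := by
  have := RingQuot.mkAlgHom_rel k (QFL.Rel.Khord (k := k) (n := n) (q := q))
  simpa only [QFL.K, QFL.Kh, QFL.Kinv, map_pow] using this
theorem rKKh : Commute uK uKh := by
  have := RingQuot.mkAlgHom_rel k (QFL.Rel.KKh (k := k) (n := n) (q := q))
  simp only [map_mul] at this
  exact this
theorem rE : uE ^ (n ^ 2) = 0 := by
  have := RingQuot.mkAlgHom_rel k (QFL.Rel.Enil (k := k) (n := n) (q := q))
  simpa only [QFL.E, map_pow, map_zero] using this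
theorem rF : uF ^ (n ^ 2) = 0 := by
  have := RingQuot.mkAlgHom_rel k (QFL.Rel.Fnil (k := k) (n := n) (q := q))
  simpa only [QFL.F, map_pow, map_zero] using this
theorem rFE : uF * uE = q⁻¹ • (uE * uF) + (1 - uLL) := by
  have := RingQuot.mkAlgHom_rel k (QFL.Rel.EF (k := k) (n := n) (q := q))
  simp only [map_sub, map_mul, map_smul, map_one, map_pow] at this
  rw [sub_eq_iff_eq_add'] at this
  exact this

theorem cKi : Commute uKi uKh := rKKh.pow_left _
theorem cKiK : Commute uKi uK := (Commute.refl _).pow_left _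
theorem cLK : Commute uLL uK := cKiK.mul_left rKKh.symm
theorem cLKh : Commute uLL uKh := cKi.mul_left (Commute.refl _)
theorem cLKi : Commute uLL uKi := cLK.pow_right _
theorem cZL : Commute uZZ uLL := cLK.symm.mul_left (cLKh.symm.pow_left _)

variable (h : Hyp n q)
include h

theorem rKiK : uKi * uK = 1 := by
  unfold QFL.Kinv; rw [← pow_succ, Nat.sub_add_cancel h.hn, rK]
theorem rKKi : uK * uKi = 1 := by
  unfold QFL.Kinv; rw [← pow_succ', Nat.sub_add_cancel h.hn, rK]
omit h in
theorem rKin : uKi ^ n = 1 := by unfold QFL.Kinv; rw [← pow_mul, mul_comm, pow_mul, rK, one_pow]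
omit h in
theorem rKhN : uKh ^ (n ^ 2) = 1 := by
  rw [sq, pow_mul, rKh, ← pow_mul, mul_comm, pow_mul, rKin, one_pow]

theorem qKE : QC (q ^ n) uK uE := by
  have := RingQuot.mkAlgHom_rel k (QFL.Rel.KE (k := k) (n := n) (q := q))
  simp only [map_sub, map_mul, map_smul, map_one, map_pow] at this
  exact QC.of this (rKiK h)
theorem qKF : QC (q ^ n)⁻¹ uK uF := by
  have := RingQuot.mkAlgHom_rel k (QFL.Rel.KF (k := k) (n := n) (q := q))
  simp only [map_sub, map_mul, map_smul, map_one, map_pow] at this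
  exact QC.of this (rKiK h)
theorem rKhi : uKh ^ (n ^ 2 - 1) * uKh = 1 := by
  rw [← pow_succ, Nat.sub_add_cancel h.N0, rKhN]
theorem qKhE : QC (q ^ n * (q ^ 2)⁻¹) uKh uE := by
  have := RingQuot.mkAlgHom_rel k (QFL.Rel.KhE (k := k) (n := n) (q := q))
  simp only [map_sub, map_mul, map_smul, map_one, map_pow] at this
  exact QC.of this (rKhi h)
theorem qKhF : QC ((q ^ n)⁻¹ * q ^ 2) uKh uF := by
  have := RingQuot.mkAlgHom_rel k (QFL.Rel.KhF (k := k) (n := n) (q := q))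
  simp only [map_sub, map_mul, map_smul, map_one, map_pow] at this
  exact QC.of this (rKhi h)
theorem qKiE : QC (q ^ n)⁻¹ uKi uE := (qKE h).inv (pow_ne_zero _ h.q0) (rKiK h) (rKKi h)
theorem qKiF : QC (q ^ n) uKi uF := by
  have := (qKF h).inv (inv_ne_zero (pow_ne_zero _ h.q0)) (rKiK h) (rKKi h)
  rwa [inv_inv] at this
theorem qLE : QC (q ^ 2)⁻¹ uLL uE := by
  have := (qKiE h).mul (qKhE h)
  rwa [← mul_assoc, inv_mul_cancel₀ (pow_ne_zero _ h.q0), one_mul] at this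
theorem qLF : QC (q ^ 2) uLL uF := by
  have := (qKiF h).mul (qKhF h)
  rwa [← mul_assoc, mul_inv_cancel₀ (pow_ne_zero _ h.q0), one_mul] at this
theorem qpow1 : q ^ n * (q ^ n * (q ^ 2)⁻¹) ^ (n / 2) = -1 := by
  have hq := h.q0
  obtain ⟨w, hw⟩ := h.h4
  have e1 : n / 2 = 2 * w := by omega
  rw [← h.qhalf, show n ^ 2 / 2 = 8 * w ^ 2 by rw [hw, show (4 * w) ^ 2 = (8 * w ^ 2) * 2 by ring]; omega, e1, hw,
    mul_pow, inv_pow, ← pow_mul, ← pow_mul]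
  rw [← mul_assoc, ← pow_add, mul_inv_eq_iff_eq_mul₀ (pow_ne_zero _ hq), ← pow_add]
  congr 1; ring
theorem qZE : QC (-1 : k) uZZ uE := by
  have := (qKE h).mul ((qKhE h).pow (n / 2))
  rwa [qpow1 h] at this
theorem qZF : QC (-1 : k) uZZ uF := by
  have := (qKF h).mul ((qKhF h).pow (n / 2))
  have e : (q ^ n)⁻¹ * ((q ^ n)⁻¹ * q ^ 2) ^ (n / 2) = (-1)⁻¹ := by
    rw [← qpow1 h, mul_inv, ← inv_pow (q ^ n * (q ^ 2)⁻¹), mul_inv, inv_inv]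
  rw [e, inv_neg, inv_one] at this
  exact this
theorem rL : uLL ^ (n ^ 2 / 2) = 1 := by
  obtain ⟨w, hw⟩ := h.h4
  have e : n ^ 2 / 2 = n * (2 * w) := by
    rw [show n ^ 2 = n * (2 * w) * 2 by rw [sq, mul_assoc]; congr 1; omega]; omega
  unfold uL
  rw [cKi.mul_pow, e, pow_mul, pow_mul uKh n, rKin, rKh, one_pow, one_mul, ← pow_mul,
    show 2 * (2 * w) = n by omega, rKin]
theorem rZ : uZZ * uZZ = 1 := by
  obtain ⟨w, hw⟩ := h.h4
  unfold uZ
  rw [← sq, (rKKh.pow_right _).mul_pow, ← pow_mul, show n / 2 * 2 = n by omega, rKh,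
    ← cKiK.symm.mul_pow, rKKi h, one_pow]
theorem rKhL : uKh = uK * uLL := by
  unfold uL; rw [← mul_assoc, rKKi h, one_mul]
omit h in
theorem rLn : uLL ^ n = uKi ^ 2 := by
  unfold uL; rw [cKi.mul_pow, rKin, rKh, one_mul]
theorem rKZ : uK = uZZ * uLL ^ (n ^ 2 / 4 - n / 2) := by
  obtain ⟨w, hw⟩ := h.h4
  have hw0 : 0 < w := by have := h.hn; omega
  have e0 : n ^ 2 / 4 = n * w := by
    rw [show n ^ 2 = n * w * 4 by rw [sq, mul_assoc]; congr 1; omega]; omega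
  have e1 : n ^ 2 / 4 - n / 2 + n / 2 = n * w := by
    rw [e0]; apply Nat.sub_add_cancel
    calc n / 2 ≤ n := Nat.div_le_self _ _
      _ ≤ n * w := Nat.le_mul_of_pos_right _ hw0
  unfold uZ uL
  rw [cKi.mul_pow, (cKi.pow_pow _ _).eq, mul_assoc, ← mul_assoc (uKh ^ _) (uKh ^ _), ← pow_add, add_comm (n/2), e1,
    pow_mul, rKh, ← pow_mul, ← pow_add, show 2 * w = n / 2 by omega, add_comm, e1, pow_mul, rKin, one_pow, mul_one]

/-- induction principle -/
theorem uInd {p : QFL.U k n q → Prop} (alg : ∀ c : k, p (algebraMap k _ c)) (add : ∀ x y, p x → p y → p (x + y))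
    (mul : ∀ x y, p x → p y → p (x * y)) (hE : p uE) (hF : p uF) (hL : p uLL) (hZ : p uZZ) (u : QFL.U k n q) : p u := by
  have hpow : ∀ x, p x → ∀ r : ℕ, p (x ^ r) := by
    intro x hx r
    induction r with
    | zero => simpa using alg 1
    | succ r ih => rw [pow_succ]; exact mul _ _ ih hx
  have hK : p uK := by rw [rKZ h]; exact mul _ _ hZ (hpow _ hL _)
  have hKh : p uKh := by rw [rKhL h]; exact mul _ _ hK hL
  obtain ⟨x, rfl⟩ := RingQuot.mkAlgHom_surjective k (QFL.Rel k n q) u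
  induction x using FreeAlgebra.induction with
  | grade0 r => rw [AlgHom.commutes]; exact alg r
  | grade1 x =>
    fin_cases x
    · exact hK
    · exact hKh
    · exact hE
    · exact hF
  | mul a b ha hb => rw [map_mul]; exact mul _ _ ha hb
  | add a b ha hb => rw [map_add]; exact add _ _ ha hb

section rep
variable {M : Type} [AddCommGroup M] [Module k M] (ρ : QFL.U k n q →ₐ[k] Module.End k M)

theorem qc_app {c : k} {x y : QFL.U k n q} (hc : QC c x y) (m : M) : ρ x (ρ y m) = c • ρ y (ρ x m) := by
  rw [← Module.End.mul_apply, ← map_mul, hc, map_smul, map_mul]; rfl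

/-- the operators of a representation -/
def qs : QS k (n ^ 2) q M where
  E := ρ uE
  F := ρ uF
  L := ρ uLL
  Z := ρ uZZ
  fe x := by
    rw [← Module.End.mul_apply, ← map_mul, rFE]
    simp
  le x := qc_app h ρ (qLE h) x
  lf x := qc_app h ρ (qLF h) x
  ze x := by rw [qc_app h ρ (qZE h) x]; simp
  zf x := by rw [qc_app h ρ (qZF h) x]; simp
  en := by rw [← map_pow, rE, map_zero]
  fn := by rw [← map_pow, rF, map_zero]

theorem qs_E (x : M) : (qs h ρ).E x = ρ uE x := rfl
theorem qs_F (x : M) : (qs h ρ).F x = ρ uF x := rfl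
theorem qs_L (x : M) : (qs h ρ).L x = ρ uLL x := rfl
theorem qs_Z (x : M) : (qs h ρ).Z x = ρ uZZ x := rfl
theorem qs_Ep (s : ℕ) (x : M) : ((qs h ρ).E ^ s) x = ρ (uE ^ s) x := by rw [map_pow]; rfl
theorem qs_Fp (s : ℕ) (x : M) : ((qs h ρ).F ^ s) x = ρ (uF ^ s) x := by rw [map_pow]; rfl

theorem intertwine {M' : Type} [AddCommGroup M'] [Module k M'] (ρ' : QFL.U k n q →ₐ[k] Module.End k M')
    (f : M →ₗ[k] M') (hE : ∀ x, f (ρ uE x) = ρ' uE (f x)) (hF : ∀ x, f (ρ uF x) = ρ' uF (f x))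
    (hL : ∀ x, f (ρ uLL x) = ρ' uLL (f x)) (hZ : ∀ x, f (ρ uZZ x) = ρ' uZZ (f x)) (u : QFL.U k n q) (x : M) :
    f (ρ u x) = ρ' u (f x) := by
  revert x
  refine uInd h (p := fun u => ∀ x, f (ρ u x) = ρ' u (f x)) ?_ ?_ ?_ hE hF hL hZ u
  · intro c x; rw [AlgHom.commutes, AlgHom.commutes]; simp [Module.algebraMap_end_apply]
  · intro a b ha hb x; simp [ha, hb]
  · intro a b ha hb x; simp [ha, hb]

theorem stable (W : Submodule k M) (hE : ∀ x ∈ W, ρ uE x ∈ W) (hF : ∀ x ∈ W, ρ uF x ∈ W)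
    (hL : ∀ x ∈ W, ρ uLL x ∈ W) (hZ : ∀ x ∈ W, ρ uZZ x ∈ W) (u : QFL.U k n q) : ∀ x ∈ W, ρ u x ∈ W := by
  refine uInd h (p := fun u => ∀ x ∈ W, ρ u x ∈ W) ?_ ?_ ?_ hE hF hL hZ u
  · intro c x hx; rw [AlgHom.commutes]; simp [Module.algebraMap_end_apply, W.smul_mem c hx]
  · intro a b ha hb x hx; rw [map_add]; exact W.add_mem (ha x hx) (hb x hx)
  · intro a b ha hb x hx; rw [map_mul]; exact ha _ (hb x hx)
end rep
end
end QFLP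

namespace QFLP
section
variable {k : Type} [Field k] {n : ℕ} {q : k}
local notation "uK" => QFL.K k n q
local notation "uKh" => QFL.Kh k n q
local notation "uE" => QFL.E k n q
local notation "uF" => QFL.F k n q
local notation "uKi" => QFL.Kinv k n q
local notation "uLL" => uL k n q
local notation "uZZ" => uZ k n q

theorem QC.pow_right {A : Type} [Ring A] [Algebra k A] {c : k} {x y : A} (h : QC c x y) (r : ℕ) : QC (c ^ r) x (y ^ r) := by
  induction r with
  | zero => simp [QC]
  | succ r ih =>
    unfold QC at *
    rw [pow_succ, ← mul_assoc, ih, smul_mul_assoc, mul_assoc, h, mul_smul_comm, smul_smul, mul_assoc, pow_succ]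

variable (h : Hyp n q)
include h

theorem phi_eq (i : ℕ) : QFL.phi k n q i = ((n ^ 2 : k)⁻¹ * 2) • ∑ t ∈ Finset.range (n ^ 2 / 2),
    (q⁻¹ ^ (2 * i) • uLL) ^ t := by
  unfold QFL.phi
  congr 1
  refine Finset.sum_congr rfl fun t _ => ?_
  rw [smul_pow, ← pow_mul]; rfl

theorem L_phi (i : ℕ) : uLL * QFL.phi k n q i = q ^ (2 * i) • QFL.phi k n q i := by
  have h1 := mul_geom_sum (q⁻¹ ^ (2 * i) • uLL) (n ^ 2 / 2)
  have h2 : (q⁻¹ ^ (2 * i) • uLL) ^ (n ^ 2 / 2) = 1 := by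
    have := h.N4
    rw [smul_pow, rL h, ← pow_mul, show 2 * i * (n ^ 2 / 2) = n ^ 2 * i by
      rw [mul_right_comm, show 2 * (n ^ 2 / 2) = n ^ 2 by omega], inv_pow, pow_mul, h.qN]; simp
  rw [h2, sub_self, sub_mul, sub_eq_zero, one_mul, smul_mul_assoc, inv_pow, inv_smul_eq_iff₀ (pow_ne_zero _ h.q0)] at h1
  rw [phi_eq h, mul_smul_comm, inv_pow, h1, smul_comm]

theorem Z_one {j : ℕ} (hj : j ≤ 1) : uZZ * QFL.oneJ k n q j = (-1 : k) ^ j • QFL.oneJ k n q j := by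
  have h1 := rZ h
  have : QFL.oneJ k n q j = if j = 0 then (2 : k)⁻¹ • (1 + uZZ) else (2 : k)⁻¹ • (1 - uZZ) := rfl
  rw [this]
  interval_cases j
  · simp only [if_true, mul_smul_comm, mul_add, mul_one, h1, pow_zero, one_smul, add_comm]
  · simp only [one_ne_zero, if_false, mul_smul_comm, mul_sub, mul_one, h1, pow_one]
    rw [smul_comm]; congr 1
    have := neg_one_smul k ((1 : QFL.U k n q) - uZZ)
    rw [neg_sub] at this
    exact this.symm

theorem Z_phi (i : ℕ) : Commute uZZ (QFL.phi k n q i) := by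
  rw [phi_eq h]
  refine Commute.smul_right (Commute.sum_right _ _ _ fun t _ => ?_) _
  exact (cZL.smul_right _).pow_right _

theorem L_e (i j : ℕ) : uLL * QFL.eIdem k n q i j = q ^ (2 * i) • QFL.eIdem k n q i j := by
  unfold QFL.eIdem; rw [← mul_assoc, L_phi h, smul_mul_assoc]
theorem Z_e (i : ℕ) {j : ℕ} (hj : j ≤ 1) : uZZ * QFL.eIdem k n q i j = (-1:k) ^ j • QFL.eIdem k n q i j := by
  unfold QFL.eIdem; rw [← mul_assoc, (Z_phi h i).eq, mul_assoc, Z_one h hj, mul_smul_comm]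

theorem e_act [CharZero k] {M : Type} [AddCommGroup M] [Module k M] (ρ : QFL.U k n q →ₐ[k] Module.End k M)
    {v : M} {i j : ℕ} (hj : j ≤ 1) (hL : ρ uLL v = q ^ (2 * i) • v) (hZ : ρ uZZ v = (-1 : k) ^ j • v) :
    ρ (QFL.eIdem k n q i j) v = v := by
  have hp : ∀ t : ℕ, ((q⁻¹ ^ (2 * i) • ρ uLL) ^ t) v = v := by
    intro t
    induction t with
    | zero => simp
    | succ t ih =>
      rw [pow_succ, Module.End.mul_apply, LinearMap.smul_apply, hL, smul_smul, ← mul_pow,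
        inv_mul_cancel₀ h.q0, one_pow, one_smul, ih]
  have h1 : ρ (QFL.phi k n q i) v = v := by
    rw [phi_eq h]
    simp only [map_smul, map_sum, map_pow, LinearMap.smul_apply, LinearMap.sum_apply, hp]
    rw [Finset.sum_const, Finset.card_range, ← Nat.cast_smul_eq_nsmul k, smul_smul]
    have h2 : ((n ^ 2 / 2 : ℕ) : k) * 2 = (n : k) ^ 2 := by
      have := h.N4
      have e : n ^ 2 / 2 * 2 = n ^ 2 := by omega
      exact_mod_cast congrArg (Nat.cast : ℕ → k) e
    have h3 : (n : k) ^ 2 ≠ 0 := by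
      have := h.N0
      exact_mod_cast this.ne'
    rw [mul_assoc, mul_comm 2, h2, inv_mul_cancel₀ h3, one_smul]
  have h2 : ρ (QFL.oneJ k n q j) v = v := by
    have : QFL.oneJ k n q j = if j = 0 then (2 : k)⁻¹ • (1 + uZZ) else (2 : k)⁻¹ • (1 - uZZ) := rfl
    rw [this]
    interval_cases j
    · rw [if_pos rfl, map_smul, map_add, map_one, LinearMap.smul_apply, LinearMap.add_apply, hZ, pow_zero, one_smul,
        Module.End.one_apply, ← two_smul k v, smul_smul, inv_mul_cancel₀ two_ne_zero, one_smul]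
    · rw [if_neg one_ne_zero, map_smul, map_sub, map_one, LinearMap.smul_apply, LinearMap.sub_apply, hZ, pow_one, neg_smul, one_smul,
        Module.End.one_apply, sub_neg_eq_add, ← two_smul k v, smul_smul, inv_mul_cancel₀ two_ne_zero, one_smul]
  unfold QFL.eIdem
  rw [map_mul, Module.End.mul_apply, h2, h1]

omit h in
/-- span of `F^a K^c Kh^d E^b` with `a ≥ r` -/
def TT (k : Type) [Field k] (n : ℕ) (q : k) (r : ℕ) : Submodule k (QFL.U k n q) :=
  Submodule.span k {x | ∃ a b c d : ℕ, r ≤ a ∧ x = QFL.F k n q ^ a * QFL.K k n q ^ c * QFL.Kh k n q ^ d * QFL.E k n q ^ b}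

omit h in
theorem TT_ind {r : ℕ} {W : Submodule k (QFL.U k n q)} (f : QFL.U k n q →ₗ[k] QFL.U k n q)
   (hf : ∀ a b c d : ℕ, r ≤ a → f (uF ^ a * uK ^ c * uKh ^ d * uE ^ b) ∈ W) : ∀ x ∈ TT k n q r, f x ∈ W := by
  intro x hx
  have : TT k n q r ≤ W.comap f := by
    refine Submodule.span_le.2 ?_
    rintro _ ⟨a, b, c, d, ha, rfl⟩
    exact hf a b c d ha
  exact this hx

omit h in
theorem TT_mem {r a b c d : ℕ} (ha : r ≤ a) : uF ^ a * uK ^ c * uKh ^ d * uE ^ b ∈ TT k n q r :=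
  Submodule.subset_span ⟨a, b, c, d, ha, rfl⟩

omit h in
theorem TT_mono {r r' : ℕ} (hr : r' ≤ r) : TT k n q r ≤ TT k n q r' := fun x hx =>
  TT_ind LinearMap.id (fun a b c d ha => TT_mem (hr.trans ha)) x hx

omit h in
theorem TT_F {r : ℕ} {x : QFL.U k n q} (hx : x ∈ TT k n q r) : uF * x ∈ TT k n q (r+1) :=
  TT_ind (W := TT k n q (r+1)) (LinearMap.mulLeft k uF) (fun a b c d ha => by
    rw [LinearMap.mulLeft_apply, ← mul_assoc, ← mul_assoc, ← mul_assoc, ← pow_succ']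
    exact TT_mem (by omega)) x hx

theorem L_mono (a b c d : ℕ) : uLL * (uF ^ a * uK ^ c * uKh ^ d * uE ^ b) =
    (q ^ 2) ^ a • (uF ^ a * uK ^ (n - 1 + c) * uKh ^ (d + 1) * uE ^ b) := by
  have h1 := (qLF h).pow_right a
  unfold QC at h1
  rw [← mul_assoc, ← mul_assoc, ← mul_assoc, h1]
  simp only [smul_mul_assoc]
  congr 2
  unfold uL
  rw [mul_assoc _ _ (uK ^ c), mul_assoc uKi, (rKKh.symm.pow_right c).eq, ← mul_assoc, ← mul_assoc, mul_assoc _ uKh, ← pow_succ',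
    mul_assoc _ uKi, QFL.Kinv, ← pow_add]

theorem Z_mono (a b c d : ℕ) : uZZ * (uF ^ a * uK ^ c * uKh ^ d * uE ^ b) =
    (-1 : k) ^ a • (uF ^ a * uK ^ (1 + c) * uKh ^ (n / 2 + d) * uE ^ b) := by
  have h1 := (qZF h).pow_right a
  unfold QC at h1
  rw [← mul_assoc, ← mul_assoc, ← mul_assoc, h1]
  simp only [smul_mul_assoc]
  congr 2
  unfold uZ
  rw [mul_assoc _ _ (uK ^ c), mul_assoc uK, ((rKKh.symm.pow_right c).pow_left _).eq, ← mul_assoc, ← mul_assoc, mul_assoc _ (uKh ^ _), ← pow_add,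
    mul_assoc _ uK, ← pow_succ', add_comm c 1]

theorem TT_L {r : ℕ} {x : QFL.U k n q} (hx : x ∈ TT k n q r) : uLL * x ∈ TT k n q r :=
  TT_ind (W := TT k n q r) (LinearMap.mulLeft k uLL) (fun a b c d ha => by
    rw [LinearMap.mulLeft_apply, L_mono h]
    exact Submodule.smul_mem _ _ (TT_mem ha)) x hx

theorem TT_Z {r : ℕ} {x : QFL.U k n q} (hx : x ∈ TT k n q r) : uZZ * x ∈ TT k n q r :=
  TT_ind (W := TT k n q r) (LinearMap.mulLeft k uZZ) (fun a b c d ha => by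
    rw [LinearMap.mulLeft_apply, Z_mono h]
    exact Submodule.smul_mem _ _ (TT_mem ha)) x hx

theorem rEF (x : QFL.U k n q) : uE * (uF * x) = q • (uF * (uE * x) - x + uLL * x) := by
  have := rFE (k := k) (n := n) (q := q)
  rw [← mul_assoc, ← mul_assoc, this, add_mul, smul_mul_assoc, sub_mul, one_mul,
    show q⁻¹ • (uE * uF * x) + (x - uLL * x) - x + uLL * x = q⁻¹ • (uE * uF * x) by abel, smul_smul,
    mul_inv_cancel₀ h.q0, one_smul]

theorem TT_E {r : ℕ} {x : QFL.U k n q} (hx : x ∈ TT k n q r) : uE * x ∈ TT k n q (r - 1) := by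
  refine TT_ind (W := TT k n q (r-1)) (LinearMap.mulLeft k uE) (fun a b c d ha => ?_) x hx
  refine TT_mono (Nat.sub_le_sub_right ha 1) ?_
  clear ha
  rw [LinearMap.mulLeft_apply]
  induction a with
  | zero =>
    simp only [pow_zero, one_mul]
    have h1 := ((qKE h).pow c).mul ((qKhE h).pow d)
    unfold QC at h1
    have h0 : (q ^ n) ^ c * (q ^ n * (q ^ 2)⁻¹) ^ d ≠ 0 := by have := h.q0; positivity
    rw [eq_comm, ← eq_inv_smul_iff₀ h0] at h1
    rw [← mul_assoc, h1, smul_mul_assoc, mul_assoc _ uE, ← pow_succ']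
    refine Submodule.smul_mem _ _ ?_
    have := TT_mem (k := k) (n := n) (q := q) (a := 0) (b := b+1) (c := c) (d := d) (r := 0) le_rfl
    simpa using this
  | succ a ih =>
    rw [pow_succ', mul_assoc uF, mul_assoc uF, mul_assoc uF, rEF h]
    have h1 := TT_mem (k := k) (n := n) (q := q) (a := a) (b := b) (c := c) (d := d) (r := a) le_rfl
    refine Submodule.smul_mem _ _ (Submodule.add_mem _ (Submodule.sub_mem _ ?_ h1) (TT_L h h1))
    exact TT_mono (by omega) (TT_F ih)

theorem TT_Ep {r : ℕ} {x : QFL.U k n q} (hx : x ∈ TT k n q r) (s : ℕ) : uE ^ s * x ∈ TT k n q (r - s) := by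
  induction s with
  | zero => simpa using hx
  | succ s ih =>
    rw [pow_succ', mul_assoc, ← Nat.sub_sub]; exact TT_E h ih

theorem TT_Fp {r : ℕ} {x : QFL.U k n q} (hx : x ∈ TT k n q r) (s : ℕ) : uF ^ s * x ∈ TT k n q (r + s) := by
  induction s with
  | zero => simpa using hx
  | succ s ih =>
    rw [pow_succ', mul_assoc, ← add_assoc]; exact TT_F ih

theorem TT_e (i j : ℕ) : QFL.eIdem k n q i j ∈ TT k n q 0 := by
  have h0 : (1 : QFL.U k n q) ∈ TT k n q 0 := by
    have := TT_mem (k := k) (n := n) (q := q) (a := 0) (b := 0) (c := 0) (d := 0) (r := 0) le_rfl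
    simpa using this
  have h1 : QFL.oneJ k n q j ∈ TT k n q 0 := by
    have hz := TT_Z h h0
    rw [mul_one] at hz
    have : QFL.oneJ k n q j = if j = 0 then (2 : k)⁻¹ • (1 + uZZ) else (2 : k)⁻¹ • (1 - uZZ) := rfl
    rw [this]
    split_ifs
    · exact Submodule.smul_mem _ _ (Submodule.add_mem _ h0 hz)
    · exact Submodule.smul_mem _ _ (Submodule.sub_mem _ h0 hz)
  unfold QFL.eIdem
  rw [phi_eq h, smul_mul_assoc, Finset.sum_mul]
  refine Submodule.smul_mem _ _ (Submodule.sum_mem _ fun t _ => ?_)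
  rw [smul_pow, smul_mul_assoc]
  refine Submodule.smul_mem _ _ ?_
  clear * - h1 h
  induction t with
  | zero => simpa using h1
  | succ t ih => rw [pow_succ', mul_assoc]; exact TT_L h ih

theorem pbw_mem {a b c d : ℕ} (ha : a ≤ n ^ 2 - 2) : uF ^ a * uK ^ c * uKh ^ d * uE ^ b ∈ QFL.pbw k n q := by
  by_cases hb : b ≤ n ^ 2 - 1
  · rw [pow_eq_pow_mod c rK, pow_eq_pow_mod d rKhN]
    have h1 := Nat.mod_lt c h.hn
    have h2 := Nat.mod_lt d h.N0
    exact Submodule.subset_span ⟨a, b, _, _, ha, hb, by omega, by omega, rfl⟩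
  · rw [show b = n ^ 2 + (b - n ^ 2) by omega, pow_add, rE]; simp

theorem TT_pbw {x : QFL.U k n q} (hx : x ∈ TT k n q 1) : ∃ y ∈ QFL.pbw k n q, uF * y = x := by
  have : x ∈ (QFL.pbw k n q).map (LinearMap.mulLeft k uF) := by
    refine TT_ind (W := (QFL.pbw k n q).map (LinearMap.mulLeft k uF)) LinearMap.id (fun a b c d ha => ?_) x hx
    rw [LinearMap.id_apply]
    by_cases h1 : a ≤ n ^ 2 - 1
    · refine ⟨uF ^ (a-1) * uK ^ c * uKh ^ d * uE ^ b, pbw_mem h (by omega), ?_⟩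
      rw [LinearMap.mulLeft_apply, ← mul_assoc, ← mul_assoc, ← mul_assoc, ← pow_succ', Nat.sub_add_cancel ha]
    · rw [show a = n ^ 2 + (a - n ^ 2) by omega, pow_add, rF]; simp
  obtain ⟨y, hy, hy'⟩ := this
  exact ⟨y, hy, hy'⟩

theorem pbw_L {x : QFL.U k n q} (hx : x ∈ QFL.pbw k n q) : uLL * x ∈ QFL.pbw k n q := by
  have : QFL.pbw k n q ≤ (QFL.pbw k n q).comap (LinearMap.mulLeft k uLL) := by
    refine Submodule.span_le.2 ?_
    rintro _ ⟨a, b, c, d, ha, _, _, _, rfl⟩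
    show uLL * _ ∈ QFL.pbw k n q
    rw [L_mono h]
    exact Submodule.smul_mem _ _ (pbw_mem h ha)
  exact this hx
theorem pbw_Z {x : QFL.U k n q} (hx : x ∈ QFL.pbw k n q) : uZZ * x ∈ QFL.pbw k n q := by
  have : QFL.pbw k n q ≤ (QFL.pbw k n q).comap (LinearMap.mulLeft k uZZ) := by
    refine Submodule.span_le.2 ?_
    rintro _ ⟨a, b, c, d, ha, _, _, _, rfl⟩
    show uZZ * _ ∈ QFL.pbw k n q
    rw [Z_mono h]
    exact Submodule.smul_mem _ _ (pbw_mem h ha)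
  exact this hx

theorem gam_bad {i j : ℕ} (hb : ¬ ∀ x ∈ QFL.pbw k n q, uF * x = 0 → x = 0) : QFL.gam k n q i j = 0 := by
  push Not at hb
  obtain ⟨x, hx, hx0, hx1⟩ := hb
  unfold QFL.gam
  rw [dif_neg]
  rintro ⟨y, ⟨hy, hy'⟩, hu⟩
  have := hu (y + x) ⟨Submodule.add_mem _ hy hx, by rw [mul_add, hx0, add_zero, hy']⟩
  exact hx1 (by simpa using this)

theorem P_bad {i j : ℕ} (hb : ¬ ∀ x ∈ QFL.pbw k n q, uF * x = 0 → x = 0) : Subsingleton (QFL.P k n q i j) := by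
  unfold QFL.P
  rw [gam_bad h hb, Submodule.span_zero_singleton]
  infer_instance

theorem gam_spec {i j : ℕ} (hi : 1 ≤ i) (hi' : i ≤ n ^ 2 / 2) (hg : ∀ x ∈ QFL.pbw k n q, uF * x = 0 → x = 0) :
    QFL.gam k n q i j ∈ QFL.pbw k n q ∧ uF * QFL.gam k n q i j = QFL.beta k n q i j := by
  have hex : ∃! x, x ∈ QFL.pbw k n q ∧ uF * x = QFL.beta k n q i j := by
    have h1 : QFL.beta k n q i j ∈ TT k n q 1 := by
      have := TT_Ep h (TT_Fp h (TT_e h i j) (n ^ 2 - 1)) (2 * i - 2)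
      have h2 := h.N4
      have h3 := h.N0
      exact TT_mono (by omega) this
    obtain ⟨y, hy, hy'⟩ := TT_pbw h h1
    refine ⟨y, ⟨hy, hy'⟩, ?_⟩
    rintro z ⟨hz, hz'⟩
    exact sub_eq_zero.1 (hg _ (Submodule.sub_mem _ hz hy) (by rw [mul_sub, hz', hy', sub_self]))
  unfold QFL.gam
  rw [dif_pos hex]
  exact hex.choose_spec.1

/-- the canonical pair in `u` -/
theorem pairU {i j : ℕ} (hi : 1 ≤ i) (hi' : i ≤ n ^ 2 / 2) (hj : j ≤ 1) (hg : ∀ x ∈ QFL.pbw k n q, uF * x = 0 → x = 0) :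
    (qs h (Algebra.lsmul k k (QFL.U k n q))).PairZ i j (QFL.alpha k n q i j) (QFL.gam k n q i j) := by
  have hq0 := h.q0
  have N0 := h.N0
  have N4 := h.N4
  set S := qs h (Algebra.lsmul k k (QFL.U k n q)) with hS
  have la : S.L (QFL.alpha k n q i j) = q ^ (2 * (i:ℤ) - 2) • QFL.alpha k n q i j := by
    show uLL * (uF ^ (n^2-1) * _) = _
    have h1 := (qLF h).pow_right (n ^ 2 - 1)
    unfold QC at h1
    rw [← mul_assoc, h1, smul_mul_assoc, mul_assoc, L_e h, mul_smul_comm, smul_smul]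
    unfold QFL.alpha
    congr 1
    rw [← pow_mul, ← pow_add, ← zpow_natCast, show ((2 * (n ^ 2 - 1) + 2 * i : ℕ) : ℤ) = (2 * (i:ℤ) - 2) + (n ^ 2 : ℕ) * 2 by omega,
      zpow_add₀ hq0, zpow_mul q (n ^ 2 : ℕ), zpow_natCast q (n^2), h.qN]
    simp
  have za : S.Z (QFL.alpha k n q i j) = (-1 : k) ^ (j+1) • QFL.alpha k n q i j := by
    show uZZ * (uF ^ (n^2-1) * _) = _
    have h1 := (qZF h).pow_right (n ^ 2 - 1)
    unfold QC at h1
    rw [← mul_assoc, h1, smul_mul_assoc, mul_assoc, Z_e h _ hj, mul_smul_comm, smul_smul]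
    unfold QFL.alpha
    congr 1
    rw [Odd.neg_one_pow (by rw [Nat.odd_iff]; omega)]; ring
  have fa : S.F (QFL.alpha k n q i j) = 0 := by
    show uF * (uF ^ (n^2-1) * _) = _
    rw [← mul_assoc, ← pow_succ', Nat.sub_add_cancel N0, rF, zero_mul]
  obtain ⟨hgm, hgf⟩ := gam_spec (j := j) h hi hi' hg
  have fg : S.F (QFL.gam k n q i j) = (S.E ^ (2 * i - 2)) (QFL.alpha k n q i j) := by
    rw [hS, qs_Ep]; exact hgf
  refine ⟨⟨la, fa, ?_, fg⟩, za, ?_⟩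
  · have : uLL * QFL.gam k n q i j - q ^ (-(2 * (i:ℤ))) • QFL.gam k n q i j = 0 := by
      refine hg _ (Submodule.sub_mem _ (pbw_L h hgm) (Submodule.smul_mem _ _ hgm)) ?_
      have h1 := S.lf (QFL.gam k n q i j)
      rw [fg, S.lEs hq0 _ la, eq_comm, ← eq_inv_smul_iff₀ (pow_ne_zero _ hq0), ← fg, smul_smul] at h1
      rw [mul_sub, mul_smul_comm, sub_eq_zero]
      refine Eq.trans h1 ?_
      show _ • (uF * QFL.gam k n q i j) = _
      congr 1
      rw [← zpow_natCast, ← zpow_neg, ← zpow_add₀ hq0]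
      congr 1
      push_cast [Nat.cast_sub (show 2 ≤ 2 * i by omega)]; ring
    exact sub_eq_zero.1 this
  · have : uZZ * QFL.gam k n q i j - (-1 : k) ^ j • QFL.gam k n q i j = 0 := by
      refine hg _ (Submodule.sub_mem _ (pbw_Z h hgm) (Submodule.smul_mem _ _ hgm)) ?_
      have h1 := S.zf (QFL.gam k n q i j)
      rw [fg, S.zEs _ za, eq_comm, neg_eq_iff_eq_neg, ← fg, ← neg_smul] at h1
      rw [mul_sub, mul_smul_comm, sub_eq_zero]
      refine Eq.trans h1 ?_
      show _ • (uF * QFL.gam k n q i j) = _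
      congr 1
      rw [Even.neg_one_pow (n := 2 * i - 2) (by rw [Nat.even_iff]; omega), pow_succ]; ring
    exact sub_eq_zero.1 this
end
end QFLP

namespace QFLP
namespace Xm
section
variable {k : Type} [Field k] {N : ℕ} {q : k}

/-- `F^N` commutes with `E`. -/
theorem FN_comm {M : Type} [AddCommGroup M] [Module k M] {E F L : Module.End k M}
    (hq : IsPrimitiveRoot q N) (hN : 1 < N)
    (fe : ∀ x, F (E x) = q⁻¹ • E (F x) + (x - L x)) (lf : ∀ x, L (F x) = (q ^ 2) • F (L x)) (x : M) :
    (F ^ N) (E x) = E ((F ^ N) x) := by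
  have hq0 : q ≠ 0 := hq.ne_zero (by omega)
  have hlf : ∀ r : ℕ, ∀ x, L ((F ^ r) x) = (q ^ 2) ^ r • (F ^ r) (L x) := by
    intro r
    induction r with
    | zero => simp
    | succ r ih =>
      intro x
      rw [pow_succ', Module.End.mul_apply, lf, ih, map_smul, smul_smul, Module.End.mul_apply, pow_succ' (q ^ 2)]
  have key : ∀ r : ℕ, ∀ x, (F ^ (r+1)) (E x) = q⁻¹ ^ (r+1) • E ((F ^ (r+1)) x) + gs q⁻¹ (r+1) • (F ^ r) x
      - gs q (r+1) • (F ^ r) (L x) := by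
    intro r
    induction r with
    | zero => intro x; simp [gs, fe]; abel
    | succ r ih =>
      intro x
      rw [pow_succ' F (r+1), Module.End.mul_apply, ih, map_sub, map_add, map_smul, map_smul, map_smul, fe, hlf,
        ← Module.End.mul_apply F (F ^ r), ← Module.End.mul_apply F (F ^ r), ← pow_succ',
        show gs q (r+1+1) = gs q (r+1) + q ^ (r+1) from Finset.sum_range_succ _ _,
        show gs q⁻¹ (r+1+1) = gs q⁻¹ (r+1) + q⁻¹ ^ (r+1) from Finset.sum_range_succ _ _, ← Module.End.mul_apply F, ← pow_succ']
      have e : q⁻¹ ^ (r+1) * (q ^ 2) ^ (r+1) = q ^ (r+1) := by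
        rw [← mul_pow]; congr 1; field_simp
      simp only [smul_add, smul_sub, smul_smul, e, add_smul, pow_succ q⁻¹ (r+1)]
      abel
  obtain ⟨r, rfl⟩ : ∃ r, N = r + 1 := ⟨N - 1, by omega⟩
  have g1 : gs q (r+1) = 0 := hq.geom_sum_eq_zero hN
  have g2 : gs q⁻¹ (r+1) = 0 := hq.inv.geom_sum_eq_zero hN
  rw [key, g1, g2, inv_pow, hq.pow_eq_one]
  simp

variable (k N) in
abbrev X := (Bool × Fin N) →₀ k

def V (b : Bool) (s : ℕ) : X k N := if h : s < N then Finsupp.single (b, ⟨s, h⟩) 1 else 0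

theorem V_ge (b : Bool) {s : ℕ} (h : N ≤ s) : (V b s : X k N) = 0 := by
  unfold V; rw [dif_neg (by omega)]

def lin (f : Bool → ℕ → X k N) : Module.End k (X k N) :=
  Finsupp.linearCombination k (fun x : Bool × Fin N => f x.1 x.2)

theorem lin_V (f : Bool → ℕ → X k N) (hf : ∀ b s, N ≤ s → f b s = 0) (b : Bool) (s : ℕ) : lin f (V b s) = f b s := by
  unfold V lin
  split_ifs with h
  · simp
  · rw [hf b s (by omega), map_zero]

theorem ext' {M : Type} [AddCommGroup M] [Module k M] {f g : X k N →ₗ[k] M} (h : ∀ b s, f (V b s) = g (V b s)) : f = g := by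
  apply Finsupp.lhom_ext'
  rintro ⟨b, s⟩
  ext
  have := h b s
  unfold V at this
  simpa [s.2] using this

/-- degree -/
def dg (i : ℕ) (b : Bool) (s : ℕ) : ℤ := (if b then 2 * (i:ℤ) - 1 else 0) + s

def D (i : ℕ) (f : ℤ → k) : Module.End k (X k N) := lin fun b s => f (dg i b s) • V b s
theorem D_V (i : ℕ) (f : ℤ → k) (b : Bool) (s : ℕ) : D i f (V b s : X k N) = f (dg i b s) • V b s := by
  unfold D; rw [lin_V]; intro b s h; rw [V_ge b h, smul_zero]
theorem D_mul (i : ℕ) (f g : ℤ → k) : (D i f * D i g : Module.End k (X k N)) = D i (f * g) := by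
  apply ext'; intro b s
  rw [Module.End.mul_apply, D_V, map_smul, D_V, D_V, smul_smul, mul_comm]; rfl
theorem D_one (i : ℕ) : (D i (1 : ℤ → k) : Module.End k (X k N)) = 1 := by
  apply ext'; intro b s
  rw [D_V]; simp
theorem D_pow (i : ℕ) (f : ℤ → k) (r : ℕ) : (D i f ^ r : Module.End k (X k N)) = D i (f ^ r) := by
  induction r with
  | zero => simp [D_one]
  | succ r ih => rw [pow_succ, ih, D_mul, pow_succ]
theorem D_c (i : ℕ) (c : k) {f : ℤ → k} (hf : ∀ d, f d = c) : (D i f : Module.End k (X k N)) = c • 1 := by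
  apply ext'; intro b s
  rw [D_V]; simp [hf]

def oE : Module.End k (X k N) := lin fun b s => V b (s+1)
theorem oE_V (b : Bool) (s : ℕ) : oE (V b s : X k N) = V b (s+1) := by
  unfold oE; rw [lin_V]; intro b s h; rw [V_ge]; omega
theorem oE_p (b : Bool) (s r : ℕ) : (oE ^ r) (V b s : X k N) = V b (s+r) := by
  induction r with
  | zero => simp
  | succ r ih => rw [pow_succ', Module.End.mul_apply, ih, oE_V]; rfl

theorem D_E (i : ℕ) (f : ℤ → k) : (D i f * oE : Module.End k (X k N)) = oE * D i (fun d => f (d+1)) := by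
  apply ext'; intro b s
  rw [Module.End.mul_apply, Module.End.mul_apply, oE_V, D_V, D_V, map_smul, oE_V]
  congr 2; unfold dg; push_cast; ring

def cF (q : k) (s : ℕ) (x : ℤ) : k := match s with
  | 0 => 0
  | s+1 => cc q s x

theorem cF_rec (hq0 : q ≠ 0) (s : ℕ) (x : ℤ) : cF q (s+1) x = q⁻¹ * cF q s x + (1 - q ^ (x - 2 * s)) := by
  rcases s with _ | s
  · simp [cF, cc, gs]
  · simp only [cF, cc]
    have e1 : gs q (s+1+1) = q * gs q (s+1) + 1 := by
      unfold gs; rw [Finset.sum_range_succ', Finset.mul_sum]; simp [pow_succ']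
    have e2 : gs q (s+1+1) = gs q (s+1) + q ^ (s+1) := by unfold gs; rw [Finset.sum_range_succ]
    have e3 : q ^ (x - (s:ℤ)) = q * q ^ (x - ((s+1:ℕ):ℤ)) := by
      rw [← zpow_one_add₀ hq0]; congr 1; push_cast; ring
    have e4 : q ^ (x - 2 * ((s+1:ℕ):ℤ)) = q⁻¹ ^ (s+1) * q ^ (x - ((s+1:ℕ):ℤ)) := by
      rw [inv_pow, ← zpow_natCast, ← zpow_neg, ← zpow_add₀ hq0]; congr 1; push_cast; ring
    have e5 : q⁻¹ ^ (s+1) * q ^ (s+1) = 1 := by rw [← mul_pow, inv_mul_cancel₀ hq0, one_pow]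
    rw [e3, e4]
    generalize q ^ (x - ((s+1:ℕ):ℤ)) = w at *
    rw [pow_succ] at e5 ⊢
    linear_combination (q⁻¹ ^ s * q⁻¹) * e2 - (q⁻¹ ^ s * q⁻¹) * w * e1 + e5

theorem cF_N (hq : IsPrimitiveRoot q N) (hN : 1 < N) (x : ℤ) : cF q N x = 0 := by
  obtain ⟨r, rfl⟩ : ∃ r, N = r + 1 := ⟨N - 1, by omega⟩
  have g1 : gs q (r+1) = 0 := hq.geom_sum_eq_zero hN
  simp [cF, cc, g1]

def oF (q : k) (i : ℕ) : Module.End k (X k N) := lin fun b s => 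
  if b then q⁻¹ ^ s • V false (s + (2 * i - 2)) + cF q s (-(2 * (i:ℤ))) • V true (s-1)
    else cF q s (2 * (i:ℤ) - 2) • V false (s-1)
theorem oF_V (hq : IsPrimitiveRoot q N) (hN : 1 < N) (i : ℕ) (b : Bool) (s : ℕ) : oF q i (V b s : X k N) =
    if b then q⁻¹ ^ s • V false (s + (2 * i - 2)) + cF q s (-(2 * (i:ℤ))) • V true (s-1)
    else cF q s (2 * (i:ℤ) - 2) • V false (s-1) := by
  have key : ∀ x b s, N ≤ s → cF q s x • (V b (s-1) : X k N) = 0 := by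
    intro x b s hs
    rcases hs.eq_or_lt with h | h
    · rw [← h, cF_N hq hN, zero_smul]
    · rw [V_ge _ (by omega), smul_zero]
  unfold oF; rw [lin_V]
  intro b s h
  split_ifs
  · rw [V_ge _ (by omega), key _ _ _ h]; simp
  · rw [key _ _ _ h]

section
variable (hq : IsPrimitiveRoot q N) (hN : 1 < N) {i : ℕ} (hi : 1 ≤ i) (hiN : 2 * i ≤ N)
include hq hN hi

theorem D_F (f : ℤ → k) : (D i f * oF q i : Module.End k (X k N)) = oF q i * D i (fun d => f (d-1)) := by
  apply ext'; intro b s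
  rw [Module.End.mul_apply, Module.End.mul_apply, D_V, map_smul, oF_V hq hN]
  have key : ∀ x b, D i f (cF q s x • (V b (s-1) : X k N)) = f (dg i b s - 1) • cF q s x • (V b (s-1)) := by
    intro x b
    rcases s with _ | s
    · simp [cF]
    · rw [map_smul, D_V, smul_comm]; congr 2; unfold dg; push_cast
      first | ring | (split_ifs <;> ring) | (congr 1; ring)
  split_ifs with hb
  · rw [map_add, key, map_smul, D_V, smul_add, hb, smul_comm]
    congr 4; unfold dg; simp only [if_true]; push_cast [Nat.cast_sub (show 2 ≤ 2 * i by omega)]; simp; ring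
  · rw [key]; congr 3; simp at hb; rw [hb]

theorem FE_rel (L : Module.End k (X k N)) (hL : L = D i (fun d => q ^ (2 * ((i:ℤ) - 1 - d)))) (x : X k N) :
    oF q i (oE x) = q⁻¹ • oE (oF q i x) + (x - L x) := by
  have hq0 : q ≠ 0 := hq.ne_zero (by omega)
  subst hL
  have : (oF q i ∘ₗ oE : Module.End k (X k N)) = q⁻¹ • (oE ∘ₗ oF q i) + (LinearMap.id - D i (fun d => q ^ (2 * ((i:ℤ) - 1 - d)))) := by
    apply ext'; intro b s
    simp only [LinearMap.comp_apply, LinearMap.add_apply, LinearMap.smul_apply, LinearMap.sub_apply, LinearMap.id_apply,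
      oE_V, oF_V hq hN, D_V]
    have key : ∀ x b, oE (cF q s x • (V b (s-1) : X k N)) = cF q s x • V b s := by
      intro x b
      rcases s with _ | s
      · simp [cF]
      · rw [map_smul, oE_V]; rfl
    split_ifs with hb
    · subst hb
      rw [map_add, key, map_smul, oE_V, cF_rec hq0, Nat.add_sub_cancel,
        show s + (2 * i - 2) + 1 = s + 1 + (2 * i - 2) by omega,
        show (2 * ((i:ℤ) - 1 - dg i true s)) = -(2 * (i:ℤ)) - 2 * s by simp [dg]; ring]
      simp only [smul_add, add_smul, sub_smul, smul_smul, one_smul, pow_succ' q⁻¹ s]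
      abel
    · simp at hb; subst hb
      rw [key, cF_rec hq0, Nat.add_sub_cancel,
        show (2 * ((i:ℤ) - 1 - dg i false s)) = (2 * (i:ℤ) - 2) - 2 * s by simp [dg]; ring]
      simp only [smul_add, add_smul, sub_smul, smul_smul, one_smul]
  exact LinearMap.congr_fun this x

include hiN in
theorem oF_N : (oF q i : Module.End k (X k N)) ^ N = 0 := by
  have hq0 : q ≠ 0 := hq.ne_zero (by omega)
  have hlf : ∀ x : X k N, (D i (fun d => q ^ (2 * ((i:ℤ) - 1 - d)))) (oF q i x) = 
     (q ^ 2) • oF q i ((D i (fun d => q ^ (2 * ((i:ℤ) - 1 - d)))) x) := by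
    intro x
    have h1 := D_F hq hN hi (fun d => q ^ (2 * ((i:ℤ) - 1 - d)))
    rw [← Module.End.mul_apply, h1, ← map_smul, ← LinearMap.smul_apply, Module.End.mul_apply]
    congr 2
    apply ext'; intro b s
    rw [D_V, LinearMap.smul_apply, D_V, smul_smul]
    congr 1
    rw [← zpow_natCast, ← zpow_add₀ hq0]; congr 1; push_cast; ring
  have comm := FN_comm hq hN (FE_rel hq hN hi _ rfl) hlf
  have comm' : ∀ s b, (oF q i ^ N) (V b s : X k N) = (oE ^ s) ((oF q i ^ N) (V b 0)) := by
    intro s b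
    induction s with
    | zero => simp
    | succ s ih => rw [← oE_V, comm, ih, pow_succ']; rfl
  have h0 : ∀ r s : ℕ, s < r → (oF q i ^ r) (V false s : X k N) = 0 := by
    intro r
    induction r with
    | zero => intro s h; omega
    | succ r ih =>
      intro s h
      rw [pow_succ, Module.End.mul_apply, oF_V hq hN]
      rcases s with _ | s
      · simp [cF]
      · simp [ih s (by omega)]
  apply ext'; intro b s
  rw [comm', LinearMap.zero_apply]
  cases b
  · rw [h0 _ _ (by omega), map_zero]
  · obtain ⟨r, rfl⟩ : ∃ r, N = r + 1 := ⟨N - 1, by omega⟩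
    rw [pow_succ, Module.End.mul_apply, oF_V hq hN]
    simp [cF, h0 r (2 * i - 2) (by omega)]
end
end

section
variable {k : Type} [Field k] {n : ℕ} {q : k} (h : Hyp n q) {i j : ℕ} (hi : 1 ≤ i) (hi' : i ≤ n ^ 2 / 2)

/-- the `K`-exponent -/
def kx (n i j : ℕ) (d : ℤ) : ℤ := n * (-((i:ℤ) - 1) + (n / 2 : ℕ) * ((i:ℤ) + j) + d)
def lx (i : ℕ) (d : ℤ) : ℤ := 2 * ((i:ℤ) - 1 - d)

def gen (n : ℕ) (q : k) (i j : ℕ) : Fin 4 → Module.End k (X k (n ^ 2)) :=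
  ![D i (fun d => q ^ kx n i j d), D i (fun d => q ^ (kx n i j d + lx i d)), oE, oF q i]

theorem zN {q : k} (h : Hyp n q) {x y : ℤ} (hxy : ((n ^ 2 : ℕ) : ℤ) ∣ x - y) : q ^ x = q ^ y := by
  have h1 := (h.hq.zpow_eq_one_iff_dvd (x - y)).2 hxy
  rw [zpow_sub₀ h.q0, div_eq_one_iff_eq (zpow_ne_zero _ h.q0)] at h1
  exact h1

include h hi hi' in
theorem gen_rel {x y : FreeAlgebra k (Fin 4)} (r : QFL.Rel k n q x y) :
    FreeAlgebra.lift k (gen n q i j) x = FreeAlgebra.lift k (gen n q i j) y := by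
  have hq0 := h.q0
  have hn := h.hn
  have N0 := h.N0
  have N4 := h.N4
  have hN : 1 < n ^ 2 := by omega
  have hiN : 2 * i ≤ n ^ 2 := by omega
  obtain ⟨w, hw⟩ := h.h4
  have g0 : FreeAlgebra.lift k (gen n q i j) (FreeAlgebra.ι k 0) = D i (fun d => q ^ kx n i j d) := by
    rw [FreeAlgebra.lift_ι_apply]; rfl
  have g1 : FreeAlgebra.lift k (gen n q i j) (FreeAlgebra.ι k 1) = D i (fun d => q ^ (kx n i j d + lx i d)) := by
    rw [FreeAlgebra.lift_ι_apply]; rfl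
  have g2 : FreeAlgebra.lift k (gen n q i j) (FreeAlgebra.ι k 2) = oE := by
    rw [FreeAlgebra.lift_ι_apply]; rfl
  have g3 : FreeAlgebra.lift k (gen n q i j) (FreeAlgebra.ι k 3) = oF q i := by
    rw [FreeAlgebra.lift_ι_apply]; rfl
  have nn : ((n - 1 : ℕ) : ℤ) = n - 1 := by omega
  have NN : ((n ^ 2 - 1 : ℕ) : ℤ) = n * n - 1 := by rw [Nat.cast_sub N0]; push_cast; ring
  have hw2 : ((n / 2 : ℕ) : ℤ) = 2 * w := by omega
  have hwn : (n : ℤ) = 4 * w := by omega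
  have zp : ∀ (x : ℤ) (r : ℕ), (q ^ x) ^ r = q ^ (x * r) := fun x r => by rw [zpow_mul, zpow_natCast]
  cases r
  · simp only [map_pow, g0, map_one, D_pow]
    rw [D_c i 1, one_smul]
    intro d
    rw [Pi.pow_apply, zp, ← zpow_zero q]
    apply zN h; unfold kx; push_cast; exact ⟨-((i:ℤ) - 1) + (n / 2 : ℕ) * ((i:ℤ) + j) + d, by push_cast; ring⟩
  · simp only [map_pow, g0, g1, D_pow]
    congr 1; funext d
    simp only [Pi.pow_apply, zp]
    apply zN h; unfold kx lx; rw [nn, hw2, hwn]; push_cast; rw [hwn]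
    exact ⟨- (-((i:ℤ) - 1) + 2 * w * ((i:ℤ) + j) + d) + (i + j), by ring⟩
  · simp only [map_mul, g0, g1, D_mul]; rw [mul_comm]
  · simp only [map_mul, map_pow, map_smul, g0, g2, D_pow]
    rw [D_E, mul_assoc, D_mul, D_c i (q ^ n)]
    · simp
    · intro d
      simp only [Pi.mul_apply, Pi.pow_apply, zp, ← zpow_add₀ hq0]
      rw [← zpow_natCast]
      apply zN h; unfold kx; rw [nn]; push_cast
      exact ⟨_, show _ = _ * (-((i:ℤ) - 1) + (n / 2 : ℕ) * ((i:ℤ) + j) + d) by push_cast; ring⟩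
  · simp only [map_mul, map_pow, map_smul, g0, g3, D_pow]
    rw [D_F h.hq hN hi, mul_assoc, D_mul, D_c i (q ^ n)⁻¹]
    · simp
    · intro d
      simp only [Pi.mul_apply, Pi.pow_apply, zp, ← zpow_add₀ hq0]
      rw [← zpow_natCast, ← zpow_neg]
      apply zN h; unfold kx; rw [nn]; push_cast
      exact ⟨_, show _ = _ * (-((i:ℤ) - 1) + (n / 2 : ℕ) * ((i:ℤ) + j) + d) by push_cast; ring⟩
  · simp only [map_mul, map_pow, map_smul, g1, g2, D_pow]
    rw [D_E, mul_assoc, D_mul, D_c i (q ^ n * (q ^ 2)⁻¹)]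
    · simp
    · intro d
      simp only [Pi.mul_apply, Pi.pow_apply, zp, ← zpow_add₀ hq0]
      rw [← zpow_natCast q n, ← zpow_natCast q 2, ← zpow_neg, ← zpow_add₀ hq0]
      apply zN h; rw [NN]
      exact ⟨kx n i j d + lx i d, by unfold kx lx; push_cast; ring⟩
  · simp only [map_mul, map_pow, map_smul, g1, g3, D_pow]
    rw [D_F h.hq hN hi, mul_assoc, D_mul, D_c i ((q ^ n)⁻¹ * (q ^ 2))]
    · simp
    · intro d
      simp only [Pi.mul_apply, Pi.pow_apply, zp, ← zpow_add₀ hq0]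
      rw [← zpow_natCast q n, ← zpow_natCast q 2, ← zpow_neg, ← zpow_add₀ hq0]
      apply zN h; rw [NN]
      exact ⟨kx n i j d + lx i d, by unfold kx lx; push_cast; ring⟩
  · simp only [map_pow, map_zero, g2]
    apply ext'; intro b s
    rw [oE_p, V_ge _ (by omega)]; rfl
  · simp only [map_pow, map_zero, g3]
    exact oF_N h.hq hN hi hiN
  · simp only [map_sub, map_mul, map_pow, map_smul, map_one, g0, g1, g2, g3, D_pow, D_mul]
    refine LinearMap.ext fun x => ?_
    refine (sub_eq_iff_eq_add').2 (FE_rel h.hq hN hi _ ?_ x)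
    congr 1
    funext d
    simp only [Pi.mul_apply, Pi.pow_apply, zp, ← zpow_add₀ hq0]
    apply zN h; rw [nn]; unfold kx lx; push_cast
    first
    | exact ⟨(-((i:ℤ) - 1) + (n / 2 : ℕ) * ((i:ℤ) + j) + d), by push_cast; ring⟩
    | exact ⟨-(-((i:ℤ) - 1) + (n / 2 : ℕ) * ((i:ℤ) + j) + d), by push_cast; ring⟩

/-- the representation -/
def rep (j : ℕ) : QFL.U k n q →ₐ[k] Module.End k (X k (n ^ 2)) :=
  RingQuot.liftAlgHom k ⟨FreeAlgebra.lift k (gen n q i j), fun _ _ r => gen_rel h hi hi' r⟩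

theorem rep_K : rep h hi hi' j (QFL.K k n q) = D i (fun d => q ^ kx n i j d) := by
  unfold rep QFL.K; rw [RingQuot.liftAlgHom_mkAlgHom_apply, FreeAlgebra.lift_ι_apply]; rfl
theorem rep_Kh : rep h hi hi' j (QFL.Kh k n q) = D i (fun d => q ^ (kx n i j d + lx i d)) := by
  unfold rep QFL.Kh; rw [RingQuot.liftAlgHom_mkAlgHom_apply, FreeAlgebra.lift_ι_apply]; rfl
theorem rep_E : rep h hi hi' j (QFL.E k n q) = oE := by
  unfold rep QFL.E; rw [RingQuot.liftAlgHom_mkAlgHom_apply, FreeAlgebra.lift_ι_apply]; rfl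
theorem rep_F : rep h hi hi' j (QFL.F k n q) = oF q i := by
  unfold rep QFL.F; rw [RingQuot.liftAlgHom_mkAlgHom_apply, FreeAlgebra.lift_ι_apply]; rfl

theorem rep_L : rep h hi hi' j (uL k n q) = D i (fun d => q ^ lx i d) := by
  have hn := h.hn
  have nn : ((n - 1 : ℕ) : ℤ) = n - 1 := by omega
  unfold uL QFL.Kinv
  rw [map_mul, map_pow, rep_K, rep_Kh, D_pow, D_mul]
  congr 1; funext d
  rw [Pi.mul_apply, Pi.pow_apply, ← zpow_natCast, ← zpow_mul, ← zpow_add₀ h.q0]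
  apply zN h; rw [nn]; unfold kx lx; push_cast
  exact ⟨_, show _ = _ * (-((i:ℤ) - 1) + (n / 2 : ℕ) * ((i:ℤ) + j) + d) by push_cast; ring⟩

theorem rep_Z : rep h hi hi' j (uZ k n q) = D i (fun d => (-1 : k) ^ (j + 1 + d)) := by
  have hn := h.hn
  obtain ⟨w, hw⟩ := h.h4
  have hw2 : n / 2 = 2 * w := by omega
  have hwn : (n : ℤ) = 4 * w := by omega
  have hm : (-1 : k) ≠ 0 := by simp
  unfold uZ
  rw [map_mul, map_pow, rep_K, rep_Kh, D_pow, D_mul]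
  congr 1; funext d
  rw [Pi.mul_apply, Pi.pow_apply, ← zpow_natCast, ← zpow_mul, ← zpow_add₀ h.q0]
  have e : (-1 : k) ^ ((j:ℤ) + 1 + d) = q ^ (((n ^ 2 / 2 : ℕ) : ℤ) * (j + 1 + d)) := by
    rw [zpow_mul, zpow_natCast, h.qhalf]
  have e2 : n ^ 2 / 2 = 8 * w ^ 2 := by rw [hw, show (4 * w) ^ 2 = (8 * w ^ 2) * 2 by ring]; omega
  rw [e]
  apply zN h
  rw [hw2, e2]
  unfold kx lx; rw [hw2]; push_cast; rw [hwn]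
  exact ⟨w * ((i:ℤ)+j), by ring⟩

theorem pair : (qs h (rep h hi hi' j)).PairL i (V false 0) (V true 0) := by
  have N0 := h.N0
  have N4 := h.N4
  refine ⟨?_, ?_, ?_, ?_⟩
  · rw [qs_L, rep_L, D_V]; congr 2; simp [lx, dg]; ring
  · rw [qs_F, rep_F, oF_V h.hq (by omega)]; simp [cF]
  · rw [qs_L, rep_L, D_V]; congr 2; simp [lx, dg]; ring
  · rw [qs_F, rep_F, oF_V h.hq (by omega), qs_Ep, map_pow, rep_E, oE_p]; simp [cF]
end
end Xm

theorem Ealpha_ne {k : Type} [Field k] [CharZero k] {n : ℕ} {q : k} (h : Hyp n q) {i j : ℕ} (hi : 1 ≤ i) (hi' : i ≤ n ^ 2 / 2) (hj : j ≤ 1) :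
    QFL.E k n q ^ (n ^ 2 - 1) * QFL.alpha k n q i j ≠ 0 := by
  intro h0
  have N0 := h.N0
  have N4 := h.N4
  obtain ⟨c, hc, hcc⟩ := (Xm.pair h hi hi' (j := j)).p1 h.hq hi (by omega)
  rw [qs_Fp, qs_Ep, map_pow _ (QFL.E k n q), Xm.rep_E, Xm.oE_p, zero_add] at hcc
  have he := e_act h (Xm.rep h hi hi' j) (v := Xm.V true (n ^ 2 - 2 * i)) (i := i) (j := j) hj
    (by
      rw [Xm.rep_L, Xm.D_V]; congr 1
      rw [← zpow_natCast]
      apply Xm.zN h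
      refine ⟨-2, ?_⟩
      simp only [Xm.lx, Xm.dg, if_true]; push_cast [Nat.cast_sub (show 2 * i ≤ n ^ 2 by omega)]; ring)
    (by
      rw [Xm.rep_Z, Xm.D_V]; congr 1
      have : ((j:ℤ) + 1 + Xm.dg i true (n ^ 2 - 2 * i)) = ((j + n ^ 2 : ℕ) : ℤ) := by
        simp only [Xm.dg, if_true]; push_cast [Nat.cast_sub (show 2 * i ≤ n ^ 2 by omega)]; ring
      rw [this, zpow_natCast, pow_add, Even.neg_one_pow (n := n ^ 2) (by rw [Nat.even_iff]; omega), mul_one])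
  have h1 : Xm.rep h hi hi' j (QFL.E k n q ^ (n ^ 2 - 1) * QFL.alpha k n q i j) (Xm.V true (n ^ 2 - 2 * i)) = 0 := by
    rw [h0, map_zero]; rfl
  unfold QFL.alpha at h1
  rw [map_mul, map_mul, Module.End.mul_apply, Module.End.mul_apply, he, hcc, map_smul, map_pow, Xm.rep_E, Xm.oE_p, smul_eq_zero] at h1
  rcases h1 with h1 | h1
  · exact hc h1
  · unfold Xm.V at h1
    rw [dif_pos (by omega)] at h1
    simp at h1
end QFLP

namespace QFLP
section
variable {k : Type} [Field k] {n : ℕ} {q : k} (h : Hyp n q)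
local notation "uE" => QFL.E k n q
local notation "uF" => QFL.F k n q
local notation "uLL" => uL k n q
local notation "uZZ" => uZ k n q

section gen
variable {M : Type} [AddCommGroup M] [Module k M] {N : ℕ} (S : QS k N q M)

theorem fam_mem_a (a g : M) (s : ℕ) : (S.E ^ s) a ∈ Submodule.span k (Set.range (S.fam a g)) := by
  by_cases hs : s < N
  · exact Submodule.subset_span ⟨(Sum.inl (), ⟨s, hs⟩), rfl⟩
  · rw [S.E_ge (by omega)]; exact zero_mem _
theorem fam_mem_g (a g : M) (s : ℕ) : (S.E ^ s) g ∈ Submodule.span k (Set.range (S.fam a g)) := by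
  by_cases hs : s < N
  · exact Submodule.subset_span ⟨(Sum.inr (), ⟨s, hs⟩), rfl⟩
  · rw [S.E_ge (by omega)]; exact zero_mem _
theorem fam_map {a g : M} (W : Submodule k M) (f : Module.End k M) 
    (ha : ∀ s, f ((S.E ^ s) a) ∈ W)
    (hg : ∀ s, f ((S.E ^ s) g) ∈ W) : 
    ∀ x ∈ Submodule.span k (Set.range (S.fam a g)), f x ∈ W := by
  intro x hx
  induction hx using Submodule.span_induction with
  | mem x hx =>
    obtain ⟨⟨⟨⟩ | ⟨⟩, s⟩, rfl⟩ := hx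
    · exact ha s
    · exact hg s
  | zero => rw [map_zero]; exact zero_mem _
  | add x y _ _ hx hy => rw [map_add]; exact add_mem hx hy
  | smul c x _ hx => rw [map_smul]; exact Submodule.smul_mem _ _ hx
end gen

theorem fam_stable {M : Type} [AddCommGroup M] [Module k M] (ρ : QFL.U k n q →ₐ[k] Module.End k M) {i j : ℕ} {a g : M}
    (hp : (qs h ρ).PairZ i j a g) (hi : 1 ≤ i) (hi' : 2 * i ≤ n ^ 2) (u : QFL.U k n q) :
    ∀ x ∈ Submodule.span k (Set.range ((qs h ρ).fam a g)), ρ u x ∈ Submodule.span k (Set.range ((qs h ρ).fam a g)) := by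
  have fa := fam_mem_a (qs h ρ) a g
  have fg := fam_mem_g (qs h ρ) a g
  apply stable h ρ
  · refine fam_map (qs h ρ) _ (ρ uE) (fun s => ?_) (fun s => ?_)
    · rw [← qs_E h ρ, (qs h ρ).pE]; exact fa _
    · rw [← qs_E h ρ, (qs h ρ).pE]; exact fg _
  · refine fam_map (qs h ρ) _ (ρ uF) (fun s => ?_) (fun s => ?_)
    · rw [← qs_F h ρ]
      rcases s with _ | s
      · rw [pow_zero, Module.End.one_apply, hp.fa]; exact zero_mem _
      · rw [(qs h ρ).fEs0 h.q0 _ hp.la hp.fa]; exact Submodule.smul_mem _ _ (fa _)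
    · rw [← qs_F h ρ]
      rcases s with _ | s
      · rw [pow_zero, Module.End.one_apply, hp.fg]; exact fa _
      · rw [hp.toPairL.f_g h.hq hi hi']; exact add_mem (Submodule.smul_mem _ _ (fa _)) (Submodule.smul_mem _ _ (fg _))
  · refine fam_map (qs h ρ) _ (ρ uLL) (fun s => ?_) (fun s => ?_)
    · rw [← qs_L h ρ, (qs h ρ).lEs h.q0 _ hp.la]; exact Submodule.smul_mem _ _ (fa _)
    · rw [← qs_L h ρ, (qs h ρ).lEs h.q0 _ hp.lg]; exact Submodule.smul_mem _ _ (fg _)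
  · refine fam_map (qs h ρ) _ (ρ uZZ) (fun s => ?_) (fun s => ?_)
    · rw [← qs_Z h ρ, (qs h ρ).zEs _ hp.za]; exact Submodule.smul_mem _ _ (fa _)
    · rw [← qs_Z h ρ, (qs h ρ).zEs _ hp.zg]; exact Submodule.smul_mem _ _ (fg _)

/-- a pair in a representation gives a map from any full one -/
theorem exists_map {M M' : Type} [AddCommGroup M] [Module k M] (ρ : QFL.U k n q →ₐ[k] Module.End k M) {i j : ℕ} {a g : M}
    [AddCommGroup M'] [Module k M'] (ρ' : QFL.U k n q →ₐ[k] Module.End k M') {a' g' : M'}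
    (H : (qs h ρ).Full i j a g) (hp : (qs h ρ').PairZ i j a' g') :
    ∃ f : M →ₗ[k] M', (∀ u x, f (ρ u x) = ρ' u (f x)) ∧ f a = a' ∧ f g = g' := by
  have hi := H.hi
  have hi' := H.hiN
  let f : M →ₗ[k] M' := H.bas.constr k ((qs h ρ').fam a' g')
  have ha : ∀ s, f (((qs h ρ).E ^ s) a) = ((qs h ρ').E ^ s) a' := by
    intro s
    by_cases hs : s < n ^ 2
    · have := H.bas.constr_basis k ((qs h ρ').fam a' g') (Sum.inl (), ⟨s, hs⟩)
      rw [H.bas_a] at this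
      exact this
    · rw [QS.E_ge _ (by omega), QS.E_ge _ (by omega), map_zero]
  have hg : ∀ s, f (((qs h ρ).E ^ s) g) = ((qs h ρ').E ^ s) g' := by
    intro s
    by_cases hs : s < n ^ 2
    · have := H.bas.constr_basis k ((qs h ρ').fam a' g') (Sum.inr (), ⟨s, hs⟩)
      rw [H.bas_g] at this
      exact this
    · rw [QS.E_ge _ (by omega), QS.E_ge _ (by omega), map_zero]
  refine ⟨f, ?_, by simpa using ha 0, by simpa using hg 0⟩
  have key : ∀ (A : Module.End k M) (A' : Module.End k M'), (∀ s, f (A (((qs h ρ).E ^ s) a)) = A' (((qs h ρ').E ^ s) a')) → 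
      (∀ s, f (A (((qs h ρ).E ^ s) g)) = A' (((qs h ρ').E ^ s) g')) → ∀ x, f (A x) = A' (f x) := by
    intro A A' h1 h2 x
    have : f ∘ₗ A = A' ∘ₗ f := by
      apply H.ext'
      · intro s; rw [LinearMap.comp_apply, LinearMap.comp_apply, h1, ha]
      · intro s; rw [LinearMap.comp_apply, LinearMap.comp_apply, h2, hg]
    exact LinearMap.congr_fun this x
  apply intertwine h ρ ρ' f
  · refine key (qs h ρ).E (qs h ρ').E (fun s => ?_) (fun s => ?_)
    · rw [QS.pE, QS.pE, ha]
    · rw [QS.pE, QS.pE, hg]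
  · refine key (qs h ρ).F (qs h ρ').F (fun s => ?_) (fun s => ?_)
    · rcases s with _ | s
      · rw [pow_zero, pow_zero, Module.End.one_apply, Module.End.one_apply, hp.fa, H.fa, map_zero]
      · rw [QS.fEs0 _ h.q0 _ hp.la hp.fa, QS.fEs0 _ h.q0 _ H.la H.fa, map_smul, ha]
    · rcases s with _ | s
      · rw [pow_zero, pow_zero, Module.End.one_apply, Module.End.one_apply, hp.fg, H.fg, ha]
      · rw [hp.toPairL.f_g h.hq hi hi', H.toPairL.f_g h.hq hi hi', map_add, map_smul, map_smul, ha, hg]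
  · refine key (qs h ρ).L (qs h ρ').L (fun s => ?_) (fun s => ?_)
    · rw [QS.lEs _ h.q0 _ hp.la, QS.lEs _ h.q0 _ H.la, map_smul, ha]
    · rw [QS.lEs _ h.q0 _ hp.lg, QS.lEs _ h.q0 _ H.lg, map_smul, hg]
  · refine key (qs h ρ).Z (qs h ρ').Z (fun s => ?_) (fun s => ?_)
    · rw [QS.zEs _ _ hp.za, QS.zEs _ _ H.za, map_smul, ha]
    · rw [QS.zEs _ _ hp.zg, QS.zEs _ _ H.zg, map_smul, hg]

theorem gam_mem (i j : ℕ) : QFL.gam k n q i j ∈ QFL.P k n q i j := Submodule.subset_span rfl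

variable {i j : ℕ} (hi : 1 ≤ i) (hi' : i ≤ n ^ 2 / 2) (hj : j ≤ 1) (hg : ∀ x ∈ QFL.pbw k n q, QFL.F k n q * x = 0 → x = 0)
include h hi hi' hj hg

theorem alpha_mem : QFL.alpha k n q i j ∈ QFL.P k n q i j := by
  have hp := pairU h hi hi' hj hg
  have N4 := h.N4
  obtain ⟨c, h1, h2⟩ := QS.down h.q0 hp.la hp.fa (2 * i - 2) 0
  have hc := h2 (fun s _ hs => hp.toPairL.cca h.hq hi (by omega) (by omega) (by omega))
  rw [add_zero, ← hp.fg, qs_Fp, qs_F, pow_zero, Module.End.one_apply] at h1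
  have : QFL.alpha k n q i j = c⁻¹ • (uF ^ (2 * i - 2) * (uF * QFL.gam k n q i j)) := by
    change uF ^ (2 * i - 2) * (uF * QFL.gam k n q i j) = _ at h1
    rw [h1, smul_smul, inv_mul_cancel₀ hc, one_smul]
  rw [this]
  exact Submodule.smul_of_tower_mem _ _ (Submodule.smul_mem _ _ (Submodule.smul_mem _ uF (gam_mem i j)))

/-- the action on P -/
abbrev rhoP (k : Type) [Field k] (n : ℕ) (q : k) (i j : ℕ) : QFL.U k n q →ₐ[k] Module.End k (QFL.P k n q i j) := Algebra.lsmul k k (QFL.P k n q i j)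

theorem rhoP_val (u : QFL.U k n q) (x : QFL.P k n q i j) : ((rhoP k n q i j u x : QFL.P k n q i j) : QFL.U k n q) = u * x := rfl

theorem pairP : (qs (M := QFL.P k n q i j) h (rhoP k n q i j)).PairZ i j ⟨_, alpha_mem h hi hi' hj hg⟩ ⟨_, gam_mem i j⟩ := by
  have hp := pairU h hi hi' hj hg
  refine ⟨⟨?_, ?_, ?_, ?_⟩, ?_, ?_⟩
  · exact Subtype.ext hp.la
  · exact Subtype.ext hp.fa
  · exact Subtype.ext hp.lg
  · rw [qs_Ep]; apply Subtype.ext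
    have := hp.fg
    rw [qs_Ep] at this
    exact this
  · exact Subtype.ext hp.za
  · exact Subtype.ext hp.zg

theorem fullP [CharZero k] : (qs (M := QFL.P k n q i j) h (rhoP k n q i j)).Full i j ⟨_, alpha_mem h hi hi' hj hg⟩ ⟨_, gam_mem i j⟩ := by
  have N4 := h.N4
  have hp := pairP h hi hi' hj hg
  refine ⟨hp, h.hq, hi, by omega, ?_, ?_⟩
  · have := QS.pairs_indep h.hq (ι := Unit) (fun _ => i) (fun _ => _) (fun _ => _) (fun _ => hi) (fun _ => by omega) (fun _ => hp.toPairL) (by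
      refine (linearIndependent_unique_iff (M := QFL.P k n q i j)).2 ?_
      intro h0
      rw [qs_Ep] at h0
      exact Ealpha_ne h hi hi' hj (congrArg Subtype.val h0))
    exact this
  · have st := fam_stable (M := QFL.P k n q i j) h (rhoP k n q i j) hp hi (by omega)
    rintro ⟨x, hx⟩ -
    obtain ⟨u, rfl⟩ := Submodule.mem_span_singleton.1 hx
    exact st u _ (fam_mem_g (M := QFL.P k n q i j) _ _ _ 0)
end
end QFLP

namespace QFLP
section
theorem indep_transfer {k : Type} [Field k] {M M' X ι : Type} [AddCommGroup M] [Module k M] [AddCommGroup M'] [Module k M']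
    [AddCommGroup X] [Module k X] [Fintype ι] (f : M →ₗ[k] X) (f' : M' →ₗ[k] X) (hf : Function.Injective f) {v : ι → M} {v' : ι → M'}
    (hv : LinearIndependent k v) (hh : ∀ t, f (v t) = f' (v' t)) : LinearIndependent k v' := by
  refine LinearIndependent.of_comp f' ?_
  have := hv.map' f (LinearMap.ker_eq_bot.2 hf)
  have e : f' ∘ v' = f ∘ v := funext fun t => (hh t).symm
  rw [e]; exact this

namespace QS.Full
variable {k : Type} [Field k] {N : ℕ} {q : k} {M : Type} [AddCommGroup M] [Module k M]
variable {S : QS k N q M} {i j : ℕ} {a g : M} (H : S.Full i j a g)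
include H

theorem ker_E (y : M) (hy : S.E y = 0) : ∃ x z : k, y = x • (S.E ^ (N-1)) a + z • (S.E ^ (N-1)) g := by
  have := H.fin
  have hN := H.hN
  obtain ⟨y, rfl⟩ := nilp_exact (ι := Unit ⊕ Unit) S.E S.en (Sum.elim (fun _ => a) (fun _ => g)) (by
    have h3 := H.ind.comp (fun x : Unit ⊕ Unit => (x, (⟨N - 1, by omega⟩ : Fin N))) (fun x y hxy => congrArg Prod.fst hxy)
    exact h3) (by rw [H.rank]; simp) H.hN y hy
  have hys : y ∈ Submodule.span k (Set.range (S.fam a g)) := H.sp trivial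
  clear hy
  induction hys using Submodule.span_induction with
  | mem x hx =>
    obtain ⟨⟨b, s⟩, rfl⟩ := hx
    unfold fam
    rw [S.pEE]
    by_cases hs : (s:ℕ) = 0
    · rw [hs, add_zero]
      rcases b with b | b
      · exact ⟨1, 0, by simp⟩
      · exact ⟨0, 1, by simp⟩
    · exact ⟨0, 0, by rw [S.E_ge (s := N - 1 + (s:ℕ)) (by omega)]; simp⟩
  | zero => exact ⟨0, 0, by simp⟩
  | add y y' _ _ h1 h2 =>
    obtain ⟨x, z, h1⟩ := h1
    obtain ⟨x', z', h2⟩ := h2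
    exact ⟨x + x', z + z', by rw [map_add, h1, h2]; module⟩
  | smul c y _ h1 =>
    obtain ⟨x, z, h1⟩ := h1
    exact ⟨c * x, c * z, by rw [map_smul, h1]; module⟩

theorem soc (W : Submodule k M) (hE : ∀ x ∈ W, S.E x ∈ W) (hF : ∀ x ∈ W, S.F x ∈ W) (y : M) (hyW : y ∈ W) (hy : y ≠ 0) :
    (S.E ^ (2 * i - 1)) a ∈ W := by
  have hN := H.hN
  have hi := H.hi
  have hiN := H.hiN
  have hEs : ∀ s, ∀ x ∈ W, (S.E ^ s) x ∈ W := by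
    intro s
    induction s with
    | zero => intro x hx; exact hx
    | succ s ih => intro x hx; rw [← S.pE]; exact hE _ (ih x hx)
  have hFs : ∀ s, ∀ x ∈ W, (S.F ^ s) x ∈ W := by
    intro s
    induction s with
    | zero => intro x hx; exact hx
    | succ s ih => intro x hx; rw [← S.pF]; exact hF _ (ih x hx)
  have hex : ∃ r, (S.E ^ r) y = 0 := ⟨N, S.E_ge le_rfl _⟩
  classical
  have h1 := Nat.find_spec hex
  have hr0 : Nat.find hex ≠ 0 := by
    intro h0; rw [h0] at h1; exact hy h1
  obtain ⟨r, hr⟩ := Nat.exists_eq_succ_of_ne_zero hr0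
  have h2 := Nat.find_min hex (m := r) (by omega)
  rw [hr, Nat.succ_eq_add_one, ← S.pE] at h1
  have hW := hEs r y hyW
  obtain ⟨x, z, h3⟩ := H.ker_E _ h1
  rw [h3] at h2 hW
  by_cases hz : z = 0
  · subst hz
    rw [zero_smul, add_zero] at h2 hW
    have hx : x ≠ 0 := fun h => h2 (by rw [h, zero_smul])
    have hW' := (Submodule.smul_mem_iff _ hx).1 hW
    obtain ⟨c, h4, h5⟩ := down H.hq0 H.la H.fa (N - 2 * i) (2 * i - 1)
    have hc := h5 (fun s hs hs' => H.toPairL.cca H.hq hi hiN (by omega) (by omega))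
    rw [show N - 2 * i + (2 * i - 1) = N - 1 by omega] at h4
    have := hFs (N - 2 * i) _ hW'
    rw [h4] at this
    exact (Submodule.smul_mem_iff _ hc).1 this
  · obtain ⟨c, hc, h4⟩ := H.toPairL.p2 H.hq hi hiN
    have := hFs (N-1) _ hW
    rw [map_add, map_smul, map_smul, H.toPairL.p3 H.hq hi hiN, h4, smul_zero, zero_add] at this
    exact (Submodule.smul_mem_iff _ hc).1 ((Submodule.smul_mem_iff _ hz).1 this)

theorem ind_top : LinearIndependent k (fun t : Fin (N - 2 * i + 1) => (S.E ^ (2 * i - 1 + (t:ℕ))) a) := by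
  have hi := H.hi
  have hiN := H.hiN
  exact H.ind.comp (fun t : Fin (N - 2 * i + 1) => (Sum.inl (), (⟨2 * i - 1 + t, by omega⟩ : Fin N))) (by
      intro t t' htt; simp at htt; exact Fin.ext htt)
end QS.Full

variable {k : Type} [Field k] {n : ℕ} {q : k} (h : Hyp n q)
local notation "uE" => QFL.E k n q
local notation "uF" => QFL.F k n q
local notation "uLL" => uL k n q
local notation "uZZ" => uZ k n q

/-- the inclusion, over `k` -/
def subl (N : Submodule (QFL.U k n q) (QFL.U k n q)) : N →ₗ[k] QFL.U k n q where
  toFun x := x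
  map_add' _ _ := rfl
  map_smul' _ _ := rfl

variable {i j : ℕ} (hi : 1 ≤ i) (hi' : i ≤ n ^ 2 / 2) (hj : j ≤ 1) (hg : ∀ x ∈ QFL.pbw k n q, QFL.F k n q * x = 0 → x = 0)
include h hi hi' hj hg

theorem S_eq [CharZero k] : QFL.S k n q i j = Submodule.span (QFL.U k n q) {uE ^ (2 * i - 1) * QFL.alpha k n q i j} := by
  have H := fullP h hi hi' hj hg
  have N4 := h.N4
  set T := Submodule.span (QFL.U k n q) {uE ^ (2 * i - 1) * QFL.alpha k n q i j} with hT
  have hTP : T ≤ QFL.P k n q i j := by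
    rw [hT, Submodule.span_singleton_le_iff_mem]
    exact Submodule.smul_mem _ (uE ^ (2 * i - 1)) (alpha_mem h hi hi' hj hg)
  have hmin : ∀ N' : Submodule (QFL.U k n q) (QFL.U k n q), N' ≤ QFL.P k n q i j → N' ≠ ⊥ → T ≤ N' := by
    intro N' hN' hb
    rw [hT, Submodule.span_singleton_le_iff_mem]
    obtain ⟨y, hy, hy0⟩ := (Submodule.ne_bot_iff _).1 hb
    have := H.soc ((N'.comap (QFL.P k n q i j).subtype).restrictScalars k) (fun x hx => N'.smul_mem uE hx)
      (fun x hx => N'.smul_mem uF hx) ⟨y, hN' hy⟩ hy (fun h0 => hy0 (congrArg Subtype.val h0))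
    rw [qs_Ep] at this
    exact this
  have hT0 : T ≠ ⊥ := by
    rw [hT, Ne, Submodule.span_singleton_eq_bot]
    intro h0
    apply Ealpha_ne h hi hi' hj
    rw [show n ^ 2 - 1 = (n ^ 2 - 2 * i) + (2 * i - 1) by omega, pow_add, mul_assoc, h0, mul_zero]
  have hTa : IsAtom T := by
    refine ⟨hT0, fun N' hN' => ?_⟩
    by_contra hb
    exact absurd (hmin N' (hN'.le.trans hTP) hb) (not_le_of_gt hN')
  apply le_antisymm
  · apply sSup_le
    rintro N' ⟨h1, h2⟩
    have h3 := isSimpleModule_iff_isAtom.1 h2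
    have h4 := hmin N' h1 h3.1
    rcases h3.le_iff.1 h4 with h5 | h5
    · exact absurd h5 hT0
    · exact h5.ge
  · exact le_sSup ⟨hTP, isSimpleModule_iff_isAtom.2 hTa⟩

section act
variable {v : ℕ → QFL.S k n q i j} (hv : ∀ t, (v t : QFL.U k n q) = QFL.E k n q ^ (2 * i - 1 + t) * QFL.alpha k n q i j)
include hv
omit hi hi' hj hg h in
theorem v_E (t : ℕ) : uE • v t = v (t+1) := by
  apply Subtype.ext
  rw [hv]
  show uE * (v t : QFL.U k n q) = _
  rw [hv, ← add_assoc, ← mul_assoc, ← pow_succ']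
omit hi hi' hj hg h in
theorem v_ge (t : ℕ) (ht : n ^ 2 - 2 * i + 1 ≤ t) : v t = 0 := by
  apply Subtype.ext
  rw [hv, show 2 * i - 1 + t = n ^ 2 + (2 * i - 1 + t - n ^ 2) by omega, pow_add, rE, zero_mul, zero_mul]
  rfl
theorem v_F0 : uF • v 0 = 0 := by
  have N4 := h.N4
  apply Subtype.ext
  have := (pairU h hi hi' hj hg).toPairL.f_top h.hq hi (by omega)
  rw [qs_Ep] at this
  show uF * (v 0 : QFL.U k n q) = 0
  rw [hv]
  exact this
theorem v_F (t : ℕ) : uF • v (t+1) = cc q (2 * i - 1 + t) (2 * (i:ℤ) - 2) • v t := by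
  have hp := pairU h hi hi' hj hg
  apply Subtype.ext
  have := (qs h (Algebra.lsmul k k (QFL.U k n q))).fEs0 h.q0 (2 * i - 1 + t) hp.la hp.fa
  rw [qs_Ep, qs_Ep] at this
  show uF * (v (t+1) : QFL.U k n q) = cc q (2 * i - 1 + t) (2 * (i:ℤ) - 2) • (v t : QFL.U k n q)
  rw [hv, hv]
  exact this
theorem v_L (t : ℕ) : uLL • v t = q ^ (2 * (i:ℤ) - 2 - 2 * (2 * i - 1 + t : ℕ)) • v t := by
  have hp := pairU h hi hi' hj hg
  apply Subtype.ext
  have := (qs h (Algebra.lsmul k k (QFL.U k n q))).lEs h.q0 (2 * i - 1 + t) hp.la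
  rw [qs_Ep] at this
  show uLL * (v t : QFL.U k n q) = q ^ (2 * (i:ℤ) - 2 - 2 * (2 * i - 1 + t : ℕ)) • (v t : QFL.U k n q)
  rw [hv]
  exact this
theorem v_Z (t : ℕ) : uZZ • v t = ((-1:k) ^ (j + 1) * (-1) ^ (2 * i - 1 + t)) • v t := by
  have hp := pairU h hi hi' hj hg
  apply Subtype.ext
  have := (qs h (Algebra.lsmul k k (QFL.U k n q))).zEs (2 * i - 1 + t) hp.za
  rw [qs_Ep] at this
  show uZZ * (v t : QFL.U k n q) = ((-1:k) ^ (j + 1) * (-1) ^ (2 * i - 1 + t)) • (v t : QFL.U k n q)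
  rw [hv]
  exact this
end act

theorem S_struct [CharZero k] : ∃ v : ℕ → QFL.S k n q i j, (∀ t, (v t : QFL.U k n q) = uE ^ (2 * i - 1 + t) * QFL.alpha k n q i j) ∧
    LinearIndependent k (fun t : Fin (n ^ 2 - 2 * i + 1) => v t) ∧
    ⊤ ≤ Submodule.span k (Set.range (fun t : Fin (n ^ 2 - 2 * i + 1) => v t)) := by
  have H := fullP h hi hi' hj hg
  have N4 := h.N4
  have hS := S_eq h hi hi' hj hg
  have hv : ∀ t, uE ^ (2 * i - 1 + t) * QFL.alpha k n q i j ∈ QFL.S k n q i j := by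
    intro t
    rw [hS, add_comm, pow_add, mul_assoc]
    exact Submodule.smul_mem _ (uE ^ t) (Submodule.subset_span rfl)
  let v : ℕ → QFL.S k n q i j := fun t => ⟨_, hv t⟩
  have hp := pairU h hi hi' hj hg
  refine ⟨v, fun t => rfl, ?_, ?_⟩
  · have h3 := H.ind_top
    refine indep_transfer (M := QFL.P k n q i j) (M' := QFL.S k n q i j) (X := QFL.U k n q) (subl _) (subl _)
      Subtype.val_injective h3 ?_
    intro t
    rw [qs_Ep]
    rfl
  · set W : Submodule k (QFL.S k n q i j) := Submodule.span k (Set.range (fun t : Fin (n ^ 2 - 2 * i + 1) => v t)) with hW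
    have hv' : ∀ t, (v t : QFL.U k n q) = uE ^ (2 * i - 1 + t) * QFL.alpha k n q i j := fun t => rfl
    clear_value v
    let ρ : QFL.U k n q →ₐ[k] Module.End k (QFL.S k n q i j) := Algebra.lsmul k k (QFL.S k n q i j)
    have hm : ∀ t, v t ∈ W := by
      intro t
      by_cases ht : t < n ^ 2 - 2 * i + 1
      · exact Submodule.subset_span ⟨⟨t, ht⟩, rfl⟩
      · rw [v_ge hv' t (by omega)]; exact zero_mem _
    have key : ∀ f : Module.End k (QFL.S k n q i j), (∀ t, f (v t) ∈ W) → ∀ x ∈ W, f x ∈ W := by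
      intro f hf
      change W ≤ W.comap f
      rw [hW, Submodule.span_le]
      rintro _ ⟨t, rfl⟩
      exact hf t
    have st := stable (M := QFL.S k n q i j) h ρ W (key (ρ uE) fun t => by
        show uE • v t ∈ W
        rw [v_E hv']; exact hm _) (key (ρ uF) fun t => by
        show uF • v t ∈ W
        rcases t with _ | t
        · rw [v_F0 h hi hi' hj hg hv']; exact zero_mem _
        · rw [v_F h hi hi' hj hg hv']; exact Submodule.smul_mem _ _ (hm _)) (key (ρ uLL) fun t => by
        show uLL • v t ∈ W
        rw [v_L h hi hi' hj hg hv']; exact Submodule.smul_mem _ _ (hm _)) (key (ρ uZZ) fun t => by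
        show uZZ • v t ∈ W
        rw [v_Z h hi hi' hj hg hv']; exact Submodule.smul_mem _ _ (hm _))
    rintro ⟨x, hx⟩ -
    have hx' := hx
    rw [hS] at hx'
    obtain ⟨u, rfl⟩ := Submodule.mem_span_singleton.1 hx'
    have := st u _ (hm 0)
    have e : ρ u (v 0) = ⟨_, hx⟩ := Subtype.ext (by
      show u * (v 0 : QFL.U k n q) = _
      rw [hv' 0]; rfl)
    rwa [e] at this
end
end QFLP

namespace QFLP
section
open scoped TensorProduct
variable {k : Type} [Field k] {n : ℕ} {q : k} (h : Hyp n q)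
local notation "uE" => QFL.E k n q
local notation "uF" => QFL.F k n q
local notation "uK" => QFL.K k n q
local notation "uKh" => QFL.Kh k n q
local notation "uKi" => QFL.Kinv k n q
local notation "uLL" => uL k n q
local notation "uZZ" => uZ k n q

include h
theorem qb : IsPrimitiveRoot (q ^ n) n := h.hq.pow (by have := h.hn; positivity) (by rw [sq])

theorem oneIdem_act [CharZero k] {M : Type} [AddCommGroup M] [Module k M] [Module (QFL.U k n q) M] [IsScalarTower k (QFL.U k n q) M]
    (d : ℕ) (v : M) (hv : uK • v = ((q ^ n) ^ d) • v) (r : ℕ) (hr : r < n) :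
    QFL.oneIdem k n q r • v = if r = d % n then v else 0 := by
  have hn := h.hn
  have hz := qb h
  have hvt : ∀ t : ℕ, (uK ^ t) • v = (((q ^ n) ^ d) ^ t) • v := by
    have hK : ∀ (c : k) (x : M), uK • c • x = c • uK • x := by
      intro c x
      rw [← algebraMap_smul (QFL.U k n q) c x, ← algebraMap_smul (QFL.U k n q) c (uK • x), smul_smul, smul_smul, Algebra.commutes]
    intro t
    induction t with
    | zero => simp
    | succ t ih => rw [pow_succ', mul_smul, ih, hK, hv, smul_smul, pow_succ]
  unfold QFL.oneIdem
  rw [smul_assoc, Finset.sum_smul]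
  have e : ∀ t ∈ Finset.range n, ((q ^ n) ^ ((n - r) * t) • uK ^ t) • v = (((q ^ n) ^ (n - r + d)) ^ t) • v := by
    intro t _
    rw [smul_assoc, hvt, smul_smul]; congr 1
    rw [← pow_mul, ← pow_mul, ← pow_mul, ← pow_mul, ← pow_add, ← pow_mul]; congr 1; ring
  rw [Finset.sum_congr rfl e, ← Finset.sum_smul]
  have hiff : (q ^ n) ^ (n - r + d) = 1 ↔ r = d % n := by
    rw [hz.pow_eq_one_iff_dvd, Nat.dvd_iff_mod_eq_zero]
    have h1 := Nat.mod_add_div d n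
    have h2 := Nat.mod_lt d hn
    generalize d % n = a at *
    generalize d / n = b at *
    subst h1
    rw [← add_assoc, Nat.add_mul_mod_self_left]
    constructor
    · intro h3
      obtain ⟨w, hw⟩ := Nat.dvd_of_mod_eq_zero h3
      have : w = 1 := by
        have h4 : w < 2 := by by_contra h5; nlinarith [Nat.mul_le_mul_left n (not_lt.1 h5), Nat.sub_add_cancel hr.le]
        have h5 : w ≠ 0 := by rintro rfl; omega
        omega
      subst this; omega
    · rintro rfl
      rw [Nat.sub_add_cancel hr.le, Nat.mod_self]
  split_ifs with h3
  · rw [hiff.2 h3]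
    simp only [one_pow, Finset.sum_const, Finset.card_range, nsmul_eq_mul, mul_one]
    rw [smul_smul, inv_mul_cancel₀ (by exact_mod_cast hn.ne'), one_smul]
  · have h4 : (q ^ n) ^ (n - r + d) ≠ 1 := fun h => h3 (hiff.1 h)
    have h5 := mul_neg_geom_sum ((q ^ n) ^ (n - r + d)) n
    rw [← pow_mul (q ^ n), mul_comm _ n, pow_mul (q ^ n), hz.pow_eq_one, one_pow, sub_self] at h5
    rcases mul_eq_zero.1 h5 with h6 | h6
    · exact absurd (sub_eq_zero.1 h6).symm h4
    · rw [h6, zero_smul, smul_zero]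

theorem K_oneIdem (s : ℕ) (hs : s < n) : uK * QFL.oneIdem k n q s = ((q ^ n) ^ s) • QFL.oneIdem k n q s := by
  have hz := qb h
  unfold QFL.oneIdem
  rw [mul_smul_comm, smul_comm, Finset.mul_sum]
  congr 1
  have e : ∀ t, uK * ((q ^ n) ^ ((n - s) * t) • uK ^ t) = (q ^ n) ^ s • ((q ^ n) ^ ((n - s) * (t+1)) • uK ^ (t+1)) := by
    intro t
    rw [mul_smul_comm, ← pow_succ', smul_smul]; congr 1
    rw [mul_add, pow_add, mul_one, mul_comm _ ((q ^ n) ^ (n - s)), ← mul_assoc, ← pow_add, Nat.add_sub_cancel' hs.le, hz.pow_eq_one, one_mul]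
  simp_rw [e]
  rw [← Finset.smul_sum]; congr 1
  have h1 := Finset.sum_range_succ (fun t => (q ^ n) ^ ((n - s) * t) • uK ^ t) n
  have h2 := Finset.sum_range_succ' (fun t => (q ^ n) ^ ((n - s) * t) • uK ^ t) n
  rw [h1, rK, mul_comm _ n, pow_mul (q ^ n), hz.pow_eq_one, one_pow, mul_zero, pow_zero, pow_zero] at h2
  exact (add_right_cancel h2).symm

theorem sum_oneIdem [CharZero k] : ∑ r ∈ Finset.range n, QFL.oneIdem k n q r = 1 := by
  have hn := h.hn
  have hz := qb h
  unfold QFL.oneIdem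
  rw [← Finset.smul_sum, Finset.sum_comm]
  rw [Finset.sum_eq_single 0]
  · simp only [mul_zero, pow_zero, one_smul, Finset.sum_const, Finset.card_range]
    rw [← Nat.cast_smul_eq_nsmul k, smul_smul, inv_mul_cancel₀ (by exact_mod_cast hn.ne'), one_smul]
  · intro t ht ht0
    have ht := Finset.mem_range.1 ht
    rw [← Finset.sum_smul]
    have h1 : ∑ r ∈ Finset.range n, (q ^ n) ^ ((n - r) * t) = ∑ r ∈ Finset.range n, (q ^ n) ^ ((r + 1) * t) := by
      rw [← Finset.sum_range_reflect]
      refine Finset.sum_congr rfl fun r hr => ?_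
      have := Finset.mem_range.1 hr
      congr 2; omega
    have h2 : ∀ r, (q ^ n) ^ ((r + 1) * t) = (q ^ n) ^ t * ((q ^ n) ^ t) ^ r := by
      intro r; rw [← pow_succ', ← pow_mul (q ^ n), mul_comm]
    simp_rw [h1, h2]
    rw [← Finset.mul_sum]
    have h4 : (q ^ n) ^ t ≠ 1 := hz.pow_ne_one_of_pos_of_lt ht0 ht
    have h5 := mul_neg_geom_sum ((q ^ n) ^ t) n
    rw [← pow_mul (q ^ n), mul_comm _ n, pow_mul (q ^ n), hz.pow_eq_one, one_pow, sub_self] at h5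
    rcases mul_eq_zero.1 h5 with h6 | h6
    · exact absurd (sub_eq_zero.1 h6).symm h4
    · rw [h6, mul_zero, zero_smul]
  · intro h0; exact absurd (Finset.mem_range.2 hn) h0

theorem flat_mul [CharZero k] (f g : ℕ → k) (hfg : ∀ r, f r * g r = 1) :
    (∑ r ∈ Finset.range n, f r • QFL.oneIdem k n q r) * (∑ r ∈ Finset.range n, g r • QFL.oneIdem k n q r) = 1 := by
  have hn := h.hn
  rw [← sum_oneIdem h, Finset.mul_sum]
  refine Finset.sum_congr rfl fun s hs => ?_
  have hs := Finset.mem_range.1 hs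
  rw [Finset.sum_mul, Finset.sum_eq_single s]
  · have := oneIdem_act h s (QFL.oneIdem k n q s) (K_oneIdem h s hs) s hs
    rw [if_pos (Nat.mod_eq_of_lt hs).symm] at this
    rw [smul_mul_smul_comm, hfg, one_smul]; exact this
  · intro r hr hrs
    have := oneIdem_act h s (QFL.oneIdem k n q s) (K_oneIdem h s hs) r (Finset.mem_range.1 hr)
    rw [Nat.mod_eq_of_lt hs, if_neg hrs] at this
    rw [smul_mul_smul_comm]
    change QFL.oneIdem k n q r * QFL.oneIdem k n q s = 0 at this
    rw [this, smul_zero]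
  · intro h0; exact absurd (Finset.mem_range.2 hs) h0

theorem flat_unit [CharZero k] : IsUnit (QFL.flat k n q) := by
  have h0 : ∀ r : ℕ, q⁻¹ ^ r * q ^ r = 1 := fun r => by rw [← mul_pow, inv_mul_cancel₀ h.q0, one_pow]
  exact ⟨⟨QFL.flat k n q, ∑ r ∈ Finset.range n, q ^ r • QFL.oneIdem k n q r, flat_mul h _ _ h0,
    flat_mul h _ _ (fun r => by rw [mul_comm, h0])⟩, rfl⟩

section act
variable [CharZero k] {M : Type} [AddCommGroup M] [Module k M] [Module (QFL.U k n q) M] [IsScalarTower k (QFL.U k n q) M]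
    (d : ℕ) (v : M) (hv : QFL.K k n q • v = ((q ^ n) ^ d) • v)
include hv h
theorem flat_act : QFL.flat k n q • v = q⁻¹ ^ (d % n) • v := by
  have hd := Nat.mod_lt d h.hn
  unfold QFL.flat
  rw [Finset.sum_smul, Finset.sum_eq_single (d % n)]
  · rw [smul_assoc, oneIdem_act h d v hv _ hd, if_pos rfl]
  · intro r hr hrd
    rw [smul_assoc, oneIdem_act h d v hv _ (Finset.mem_range.1 hr), if_neg hrd, smul_zero]
  · intro h0; exact absurd (Finset.mem_range.2 hd) h0
theorem flatinv_act : Ring.inverse (QFL.flat k n q) • v = q ^ (d % n) • v := by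
  have h1 : Ring.inverse (QFL.flat k n q) • QFL.flat k n q • v = v := by
    rw [smul_smul, Ring.inverse_mul_cancel _ (flat_unit h), one_smul]
  rw [flat_act h d v hv] at h1
  have h2 : ∀ (c : k) (u : QFL.U k n q) (x : M), u • c • x = c • u • x := by
    intro c u x
    rw [← algebraMap_smul (QFL.U k n q) c x, ← algebraMap_smul (QFL.U k n q) c (u • x), smul_smul, smul_smul, Algebra.commutes]
  rw [h2] at h1
  nth_rewrite 2 [← h1]
  rw [smul_smul, ← mul_pow, mul_inv_cancel₀ h.q0, one_pow, one_smul]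
theorem sumIdem_act : (∑ r ∈ Finset.Icc 1 (n - 1), QFL.oneIdem k n q r) • v = if d % n = 0 then 0 else v := by
  have hn := h.hn
  have hd := Nat.mod_lt d h.hn
  rw [Finset.sum_smul]
  split_ifs with h0
  · refine Finset.sum_eq_zero fun r hr => ?_
    have := Finset.mem_Icc.1 hr
    rw [oneIdem_act h d v hv _ (by omega), if_neg (by omega)]
  · rw [Finset.sum_eq_single (d % n)]
    · rw [oneIdem_act h d v hv _ hd, if_pos rfl]
    · intro r hr hrd
      have := Finset.mem_Icc.1 hr
      rw [oneIdem_act h d v hv _ (by omega), if_neg hrd]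
    · intro h1; exact absurd (Finset.mem_Icc.2 ⟨by omega, by omega⟩) h1
theorem zeroIdem_act : QFL.oneIdem k n q 0 • v = if d % n = 0 then v else 0 := by
  rw [oneIdem_act h d v hv _ h.hn]; simp only [eq_comm]
end act
end
end QFLP

namespace QFLP
section
open scoped TensorProduct
variable {k : Type} [Field k] {n : ℕ} {q : k} (h : Hyp n q)
local notation "uE" => QFL.E k n q
local notation "uF" => QFL.F k n q
local notation "uK" => QFL.K k n q
local notation "uKh" => QFL.Kh k n q
local notation "uKi" => QFL.Kinv k n q
local notation "uLL" => uL k n q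
local notation "uZZ" => uZ k n q

variable (M N : Type) [AddCommGroup M] [Module k M] [Module (QFL.U k n q) M]
    [IsScalarTower k (QFL.U k n q) M] [SMulCommClass (QFL.U k n q) k M]
    [AddCommGroup N] [Module k N] [Module (QFL.U k n q) N]
    [IsScalarTower k (QFL.U k n q) N] [SMulCommClass (QFL.U k n q) k N]

/-- the action of `u ⊗ u` on the tensor product -/
def sig : (QFL.U k n q ⊗[k] QFL.U k n q) →ₐ[k] Module.End k (M ⊗[k] N) :=
  (Module.endTensorEndAlgHom (R := k) (S := k) (A := k) (M := M) (N := N)).comp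
      (Algebra.TensorProduct.map (Algebra.lsmul k k M) (Algebra.lsmul k k N))

/-- the representation on the tensor product -/
def tau (Δ : QFL.U k n q →ₐ[k] (QFL.U k n q ⊗[k] QFL.U k n q)) : QFL.U k n q →ₐ[k] Module.End k (M ⊗[k] N) :=
  (Module.endTensorEndAlgHom (R := k) (S := k) (A := k) (M := M) (N := N)).comp
      ((Algebra.TensorProduct.map (Algebra.lsmul k k M) (Algebra.lsmul k k N)).comp Δ)

theorem tau_smul (Δ : QFL.U k n q →ₐ[k] (QFL.U k n q ⊗[k] QFL.U k n q)) (u : QFL.U k n q) (x : M ⊗[k] N) :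
    (QFL.tensorModule k n q Δ M N).smul u x = tau M N Δ u x := rfl

variable {M N}
theorem sig_tmul (a b : QFL.U k n q) (x : M) (y : N) : sig M N (a ⊗ₜ b) (x ⊗ₜ y) = (a • x) ⊗ₜ[k] (b • y) := rfl
theorem tau_sig (Δ : QFL.U k n q →ₐ[k] (QFL.U k n q ⊗[k] QFL.U k n q)) (u : QFL.U k n q) : tau M N Δ u = sig M N (Δ u) := rfl

variable {Δ : QFL.U k n q →ₐ[k] (QFL.U k n q ⊗[k] QFL.U k n q)} (hΔ : QFL.IsComul k n q Δ)
include h hΔ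
omit h in
theorem dL : Δ uLL = uLL ⊗ₜ uLL := by
  unfold uL QFL.Kinv
  rw [map_mul, map_pow, hΔ.1, hΔ.2.1, Algebra.TensorProduct.tmul_pow, Algebra.TensorProduct.tmul_mul_tmul]
omit h in
theorem dZ : Δ uZZ = uZZ ⊗ₜ uZZ := by
  unfold uZ
  rw [map_mul, map_pow, hΔ.1, hΔ.2.1, Algebra.TensorProduct.tmul_pow, Algebra.TensorProduct.tmul_mul_tmul]


omit hΔ in
theorem E_Ki (a : ℕ) : uE * uKi ^ a = (q ^ n) ^ a • (uKi ^ a * uE) := by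
  have e := (qKiE h).pow a
  unfold QC at e
  rw [e, smul_smul, ← mul_pow, mul_inv_cancel₀ (pow_ne_zero _ h.q0), one_pow, one_smul]
omit hΔ in
theorem F_Ki (a : ℕ) : uF * uKi ^ a = (q ^ n)⁻¹ ^ a • (uKi ^ a * uF) := by
  have e := (qKiF h).pow a
  unfold QC at e
  rw [e, smul_smul, ← mul_pow, inv_mul_cancel₀ (pow_ne_zero _ h.q0), one_pow, one_smul]

section ten
variable [CharZero k] (m c j2 : ℕ) (v : ℕ → N) (vE : ∀ t, QFL.E k n q • v t = v (t+1)) (v0 : ∀ t, m ≤ t → v t = 0)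
  (φ : ℕ → k) (vF0 : QFL.F k n q • v 0 = 0) (vF : ∀ t, QFL.F k n q • v (t+1) = φ t • v t)
  (vL : ∀ t, uL k n q • v t = q ^ ((m:ℤ) - 1 - 2 * t) • v t)
  (vZ : ∀ t, uZ k n q • v t = (-1 : k) ^ ((j2:ℤ) + t) • v t)
  (vK : ∀ t, QFL.K k n q • v t = (q ^ n) ^ (c + t) • v t)
  (ind : LinearIndependent k (fun t : Fin m => v t)) (sp : ⊤ ≤ Submodule.span k (Set.range (fun t : Fin m => v t)))

/-- the maps `x ↦ K^{-a} x ⊗ v t` -/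
def th (n : ℕ) (q : k) {N : Type} [AddCommGroup N] [Module k N] (M : Type) [AddCommGroup M] [Module k M] [Module (QFL.U k n q) M]
    [IsScalarTower k (QFL.U k n q) M] [SMulCommClass (QFL.U k n q) k M] (c : ℕ) (v : ℕ → N) (t : ℕ) : M →ₗ[k] M ⊗[k] N :=
  ((TensorProduct.mk k M N).flip (v t)) ∘ₗ (Algebra.lsmul k k M (QFL.Kinv k n q ^ ((c + t) / n)))
omit h hΔ [CharZero k] in
theorem th_apply (t : ℕ) (x : M) : th n q M c v t x = (uKi ^ ((c + t) / n) • x) ⊗ₜ[k] v t := rfl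

omit hΔ in
include vK vE in
theorem tau_E_aux (t : ℕ) (x : M) : sig M N ((uE ⊗ₜ[k] Ring.inverse (QFL.flat k n q)) +
    (uKi ⊗ₜ[k] (QFL.oneIdem k n q 0 * uE)) +
    ((1 : QFL.U k n q) ⊗ₜ[k] ((∑ r ∈ Finset.Icc 1 (n - 1), QFL.oneIdem k n q r) * uE))) (th n q M c v t x) = 
    q ^ (c + t) • th n q M c v t (uE • x) + th n q M c v (t+1) x := by
  rw [map_add, map_add, LinearMap.add_apply, LinearMap.add_apply, th_apply, th_apply, th_apply, sig_tmul, sig_tmul, sig_tmul,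
    mul_smul, mul_smul, vE, flatinv_act h (c + t) (v t) (vK t), zeroIdem_act h (c + t + 1) (v (t+1)) (vK (t+1)),
    sumIdem_act h (c + t + 1) (v (t+1)) (vK (t+1)), add_assoc]
  congr 1
  · have hK := (qKiE h).pow ((c + t) / n)
    have e : uE * uKi ^ ((c + t) / n) = (q ^ n) ^ ((c+t)/n) • (uKi ^ ((c + t) / n) * uE) := E_Ki h _
    rw [smul_smul, e, smul_assoc, mul_smul, TensorProduct.tmul_smul, TensorProduct.smul_tmul', smul_smul]
    congr 1
    rw [← pow_mul, ← pow_add, Nat.mod_add_div]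
  · have hd : (c + t + 1) / n = (c + t) / n + if n ∣ c + t + 1 then 1 else 0 := Nat.succ_div
    by_cases h0 : (c + t + 1) % n = 0
    · rw [if_pos h0, if_pos h0, ← add_assoc, hd, if_pos (Nat.dvd_of_mod_eq_zero h0), pow_succ', mul_smul]; simp
    · rw [if_neg h0, if_neg h0, ← add_assoc, hd, if_neg (fun h => h0 (Nat.mod_eq_zero_of_dvd h))]; simp

omit hΔ in
include vK vF in
theorem tau_F_aux (t : ℕ) (x : M) : sig M N ((uF ⊗ₜ[k] QFL.flat k n q) +
    ((uKi * uKh) ⊗ₜ[k] (uF * ∑ r ∈ Finset.Icc 1 (n - 1), QFL.oneIdem k n q r)) +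
    (uKh ⊗ₜ[k] (uF * QFL.oneIdem k n q 0))) (th n q M c v (t+1) x) = 
    q⁻¹ ^ (c + t + 1) • th n q M c v (t+1) (uF • x) + φ t • th n q M c v t (uLL • x) := by
  rw [map_add, map_add, LinearMap.add_apply, LinearMap.add_apply, th_apply, th_apply, th_apply, sig_tmul, sig_tmul, sig_tmul,
    mul_smul uF, mul_smul uF, flat_act h (c + t + 1) (v (t+1)) (vK (t+1)), zeroIdem_act h (c + t + 1) (v (t+1)) (vK (t+1)),
    sumIdem_act h (c + t + 1) (v (t+1)) (vK (t+1)), add_assoc]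
  congr 1
  · have e : uF * uKi ^ ((c + t + 1) / n) = (q ^ n)⁻¹ ^ ((c+t+1)/n) • (uKi ^ ((c + t + 1) / n) * uF) := F_Ki h _
    rw [smul_smul, ← add_assoc, e, smul_assoc, mul_smul, TensorProduct.tmul_smul, TensorProduct.smul_tmul', smul_smul]
    congr 1
    rw [← inv_pow, ← pow_mul, ← pow_add, Nat.mod_add_div]
  · have hd : (c + t + 1) / n = (c + t) / n + if n ∣ c + t + 1 then 1 else 0 := Nat.succ_div
    have hc : Commute uLL (uKi ^ ((c + t) / n)) := (cLKi).pow_right _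
    by_cases h0 : (c + t + 1) % n = 0
    · rw [if_pos h0, if_pos h0, ← add_assoc, hd, if_pos (Nat.dvd_of_mod_eq_zero h0), smul_zero, TensorProduct.tmul_zero, zero_add, vF,
        TensorProduct.tmul_smul, smul_smul, smul_smul]
      congr 3
      rw [pow_succ', ← mul_assoc, rKhL h, mul_assoc uK, cLKi.eq, ← mul_assoc, rKKi h, one_mul, hc.eq]
    · rw [if_neg h0, if_neg h0, ← add_assoc, hd, if_neg (fun h => h0 (Nat.mod_eq_zero_of_dvd h)), smul_zero, TensorProduct.tmul_zero, add_zero, vF,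
        TensorProduct.tmul_smul, smul_smul, smul_smul, add_zero]
      congr 3

omit hΔ in
include vK vF0 in
theorem tau_F_aux0 (x : M) : sig M N ((uF ⊗ₜ[k] QFL.flat k n q) +
    ((uKi * uKh) ⊗ₜ[k] (uF * ∑ r ∈ Finset.Icc 1 (n - 1), QFL.oneIdem k n q r)) +
    (uKh ⊗ₜ[k] (uF * QFL.oneIdem k n q 0))) (th n q M c v 0 x) = 
    q⁻¹ ^ c • th n q M c v 0 (uF • x) := by
  rw [map_add, map_add, LinearMap.add_apply, LinearMap.add_apply, th_apply, th_apply, sig_tmul, sig_tmul, sig_tmul,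
    mul_smul uF, mul_smul uF, flat_act h (c + 0) (v 0) (vK 0), zeroIdem_act h (c + 0) (v 0) (vK 0),
    sumIdem_act h (c + 0) (v 0) (vK 0)]
  have e1 : (uF • if (c + 0) % n = 0 then 0 else v 0) = 0 := by split_ifs <;> simp [vF0]
  have e2 : (uF • if (c + 0) % n = 0 then v 0 else 0) = 0 := by split_ifs <;> simp [vF0]
  rw [e1, e2, TensorProduct.tmul_zero, TensorProduct.tmul_zero, add_zero, add_zero, add_zero]
  have e : uF * uKi ^ (c / n) = (q ^ n)⁻¹ ^ (c/n) • (uKi ^ (c / n) * uF) := F_Ki h _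
  rw [smul_smul, e, smul_assoc, mul_smul, TensorProduct.tmul_smul, TensorProduct.smul_tmul', smul_smul]
  congr 1
  rw [← inv_pow, ← pow_mul, ← pow_add, Nat.mod_add_div]

end ten
end
end QFLP

namespace QFLP
section
open scoped TensorProduct
variable {k : Type} [Field k] {n : ℕ} {q : k} (h : Hyp n q)
local notation "uE" => QFL.E k n q
local notation "uF" => QFL.F k n q
local notation "uK" => QFL.K k n q
local notation "uKh" => QFL.Kh k n q
local notation "uKi" => QFL.Kinv k n q
local notation "uLL" => uL k n q
local notation "uZZ" => uZ k n q

variable (M : Type) {N : Type} [AddCommGroup M] [Module k M] [Module (QFL.U k n q) M]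
    [IsScalarTower k (QFL.U k n q) M] [SMulCommClass (QFL.U k n q) k M]
    [AddCommGroup N] [Module k N] [Module (QFL.U k n q) N]
    [IsScalarTower k (QFL.U k n q) N] [SMulCommClass (QFL.U k n q) k N]
variable {Δ : QFL.U k n q →ₐ[k] (QFL.U k n q ⊗[k] QFL.U k n q)} (hΔ : QFL.IsComul k n q Δ)
variable [CharZero k] {m c j2 : ℕ} {v : ℕ → N} (vE : ∀ t, QFL.E k n q • v t = v (t+1)) (v0 : ∀ t, m ≤ t → v t = 0)
  {φ : ℕ → k} (vF0 : QFL.F k n q • v 0 = 0) (vF : ∀ t, QFL.F k n q • v (t+1) = φ t • v t)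
  (vL : ∀ t, uL k n q • v t = q ^ ((m:ℤ) - 1 - 2 * t) • v t)
  (vZ : ∀ t, uZ k n q • v t = (-1 : k) ^ ((j2:ℤ) + t) • v t)
  (vK : ∀ t, QFL.K k n q • v t = (q ^ n) ^ (c + t) • v t)
  (ind : LinearIndependent k (fun t : Fin m => v t)) (sp : ⊤ ≤ Submodule.span k (Set.range (fun t : Fin m => v t)))

/-- the coordinate maps of the tensor product -/
def pit (n : ℕ) (q : k) (M : Type) {N : Type} [AddCommGroup M] [Module k M] [Module (QFL.U k n q) M]
    [IsScalarTower k (QFL.U k n q) M] [SMulCommClass (QFL.U k n q) k M]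
    [AddCommGroup N] [Module k N] {m : ℕ} (c : ℕ) (b : Module.Basis (Fin m) k N) (t : ℕ) : M ⊗[k] N →ₗ[k] M :=
  if ht : t < m then (Algebra.lsmul k k M (QFL.K k n q ^ ((c + t) / n))) ∘ₗ (TensorProduct.rid k M).toLinearMap ∘ₗ
    (LinearMap.lTensor M (b.coord ⟨t, ht⟩)) else 0

omit [CharZero k] in
theorem pit_tmul (b : Module.Basis (Fin m) k N) (t : ℕ) (ht : t < m) (x : M) (y : N) :
    pit n q M c b t (x ⊗ₜ y) = b.coord ⟨t, ht⟩ y • (QFL.K k n q ^ ((c + t) / n) • x) := by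
  unfold pit
  rw [dif_pos ht]
  simp only [LinearMap.comp_apply, LinearMap.lTensor_tmul, LinearEquiv.coe_coe, TensorProduct.rid_tmul, Algebra.lsmul_coe]
  rw [smul_comm]

include h in
omit [CharZero k] in
theorem KKi_act (a : ℕ) (x : M) : uK ^ a • uKi ^ a • x = x := by
  have : Commute uK uKi := (Commute.refl uK).pow_right _
  rw [smul_smul, ← this.mul_pow, rKKi h, one_pow, one_smul]
include h in
omit [CharZero k] in
theorem KiK_act (a : ℕ) (x : M) : uKi ^ a • uK ^ a • x = x := by
  have : Commute uKi uK := (Commute.refl uK).pow_left _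
  rw [smul_smul, ← this.mul_pow, rKiK h, one_pow, one_smul]

/-- the tensor product as an instance of the abstract situation -/
def tenOf : Ten (qs (M := M) h (Algebra.lsmul k k M)) (qs (M := M ⊗[k] N) h (tau M N Δ)) m c j2 where
  θ := th n q M c v
  π := pit n q M c (Module.Basis.mk ind sp)
  φ := φ
  πθ := by
    intro s t x ht
    rw [th_apply]
    by_cases hs : s < m
    · rw [pit_tmul M _ s hs]
      have : v t = Module.Basis.mk ind sp ⟨t, ht⟩ := by rw [Module.Basis.mk_apply]
      rw [this, Module.Basis.coord_apply, Module.Basis.repr_self, Finsupp.single_apply]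
      by_cases e : s = t
      · subst e; simp [KKi_act h M]
      · rw [if_neg e, if_neg (by intro h; exact e (Fin.mk.inj h).symm), zero_smul]
    · rw [if_neg (by omega), pit, dif_neg hs]; rfl
  θ0 := by
    intro t ht; ext x; rw [th_apply, v0 t ht, TensorProduct.tmul_zero]; rfl
  π0 := by intro t ht; rw [pit, dif_neg (by omega)]
  sum := by
    intro x
    induction x using TensorProduct.induction_on with
    | zero => simp
    | add x y hx hy => simp only [map_add, Finset.sum_add_distrib, hx, hy]
    | tmul x y =>
      conv_rhs => rw [← (Module.Basis.mk ind sp).sum_repr y]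
      rw [Finset.sum_range, TensorProduct.tmul_sum]
      refine Finset.sum_congr rfl fun t _ => ?_
      rw [pit_tmul M _ _ t.2, th_apply, Module.Basis.mk_apply, Module.Basis.coord_apply,
        smul_comm (uKi ^ _) (_ : k), KiK_act h M, TensorProduct.tmul_smul, TensorProduct.smul_tmul']
  tE := by
    intro t x ht
    rw [qs_E, qs_E, tau_sig, hΔ.2.2.1]
    exact tau_E_aux h c v vE vK t x
  tF := by
    intro t x ht
    rw [qs_F, qs_F, qs_L, tau_sig, hΔ.2.2.2]
    exact tau_F_aux h c v φ vF vK t x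
  tF0 := by
    intro x ht
    rw [qs_F, qs_F, tau_sig, hΔ.2.2.2]
    exact tau_F_aux0 h c v vF0 vK x
  tL := by
    intro t x ht
    rw [qs_L, qs_L, tau_sig, dL hΔ, th_apply, th_apply, sig_tmul, vL, TensorProduct.tmul_smul, smul_smul, Algebra.lsmul_coe, smul_smul,
      (cLKi.pow_right _).eq]
  tZ := by
    intro t x ht
    have hc : Commute uZZ (uKi ^ ((c+t)/n)) := ((cKiK.mul_right (cKi.pow_right _)).symm).pow_right _
    rw [qs_Z, qs_Z, tau_sig, dZ hΔ, th_apply, th_apply, sig_tmul, vZ, TensorProduct.tmul_smul, smul_smul, Algebra.lsmul_coe, smul_smul,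
      hc.eq]

include h in
omit [CharZero k] in
theorem K_weights {v : ℕ → N} (vE : ∀ t, uE • v t = v (t+1)) {cl cz : k} (vL : uLL • v 0 = cl • v 0) (vZ : uZZ • v 0 = cz • v 0)
    (hv0 : v 0 ≠ 0) : ∃ c : ℕ, ∀ t, uK • v t = (q ^ n) ^ (c + t) • v t := by
  have hcomm : ∀ (c : k) (u : QFL.U k n q) (x : N), u • c • x = c • u • x := fun c u x => smul_comm _ _ _
  have hpow : ∀ (u : QFL.U k n q) (c : k) (x : N), u • x = c • x → ∀ s : ℕ, u ^ s • x = c ^ s • x := by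
    intro u c x hx s
    induction s with
    | zero => simp
    | succ s ih => rw [pow_succ, mul_smul, hx, hcomm, ih, smul_smul, pow_succ']
  obtain ⟨κ, hκ⟩ : ∃ κ : k, uK • v 0 = κ • v 0 := by
    refine ⟨cl ^ (n ^ 2 / 4 - n / 2) * cz, ?_⟩
    rw [rKZ h, mul_smul, hpow _ _ _ vL, hcomm, vZ]; exact smul_smul _ _ _
  have hκn : κ ^ n = 1 := by
    have := hpow _ _ _ hκ n
    rw [rK, one_smul] at this
    have h1 : (κ ^ n - 1) • v 0 = 0 := by rw [sub_smul, ← this, one_smul, sub_self]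
    rcases smul_eq_zero.1 h1 with h2 | h2
    · exact sub_eq_zero.1 h2
    · exact absurd h2 hv0
  haveI : NeZero n := ⟨h.hn.ne'⟩
  obtain ⟨c, -, hc⟩ := (qb h).eq_pow_of_pow_eq_one hκn
  have vK : ∀ t, uK • v t = (q ^ n) ^ (c + t) • v t := by
    intro t
    induction t with
    | zero => rw [hκ, add_zero, hc]
    | succ t ih =>
      rw [← vE t, smul_smul, show uK * uE = q ^ n • (uE * uK) from qKE h, smul_assoc, mul_smul, ih, hcomm, smul_smul, ← add_assoc, pow_succ']
  exact ⟨c, vK⟩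

section inst
variable {i j : ℕ} (hi : 1 ≤ i) (hi' : i ≤ n ^ 2 / 2) (hj : j ≤ 1) (hg : ∀ x ∈ QFL.pbw k n q, QFL.F k n q * x = 0 → x = 0)
include hi hi' hj hg hΔ h
theorem tenS : ∃ c : ℕ, Nonempty (Ten (qs (M := M) h (Algebra.lsmul k k M))
    (qs (M := M ⊗[k] QFL.S k n q i j) h (tau M (QFL.S k n q i j) Δ)) (n ^ 2 - 2 * i + 1) c j) := by
  obtain ⟨v, hv, ind, sp⟩ := S_struct h hi hi' hj hg
  have N4 := h.N4
  have N0 := h.N0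
  have q0 := h.q0
  have vL := v_L h hi hi' hj hg hv
  have vZ := v_Z h hi hi' hj hg hv
  obtain ⟨c, vK⟩ := K_weights (N := QFL.S k n q i j) h (v_E hv) (vL 0) (vZ 0) (ind.ne_zero ⟨0, by omega⟩)
  refine ⟨c, ⟨tenOf h M hΔ (v_E hv) (fun t ht => v_ge hv t ht) (v_F0 h hi hi' hj hg hv) (v_F h hi hi' hj hg hv) ?_ ?_ vK ind sp⟩⟩
  · intro t
    rw [vL]
    congr 1
    have e : ((n ^ 2 - 2 * i + 1 : ℕ) : ℤ) - 1 - 2 * t = (2*(i:ℤ)-2-2*(2*i-1+t:ℕ)) + (n ^ 2 : ℕ) := by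
      omega
    rw [e, zpow_add₀ q0, zpow_natCast, h.hq.pow_eq_one, mul_one]
  · intro t
    rw [vZ]
    congr 1
    have e : ((j:ℤ) + t) = ((j + t : ℕ):ℤ) := by push_cast; ring
    rw [e, zpow_natCast, ← pow_add, show j + 1 + (2 * i - 1 + t) = j + t + 2 * i by omega, pow_add _ _ (2 * i), pow_mul]
    simp
end inst
end
end QFLP

namespace QFLP
section
open scoped TensorProduct
variable {k : Type} [Field k] {n : ℕ} {q : k} (h : Hyp n q)
include h

theorem iso_abs {ι : Type} [Fintype ι] [DecidableEq ι] {T : Type} [AddCommGroup T] [Module k T]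
    (ρT : QFL.U k n q →ₐ[k] Module.End k T)
    (Pl : ι → Type) [∀ l, AddCommGroup (Pl l)] [∀ l, Module k (Pl l)] (ρ : ∀ l, QFL.U k n q →ₐ[k] Module.End k (Pl l))
    (i j : ι → ℕ) (a g : ∀ l, Pl l) (H : ∀ l, (qs h (ρ l)).Full (i l) (j l) (a l) (g l)) (a' g' : ι → T)
    (hp : ∀ l, (qs h ρT).PairZ (i l) (j l) (a' l) (g' l))
    (hs : ⊤ ≤ Submodule.span k (Set.range
        (fun x : (ι ⊕ ι) × Fin (n ^ 2) => ((qs h ρT).E ^ (x.2 : ℕ)) (Sum.elim a' g' x.1))))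
    (hfin : Module.Finite k T) (hr : Module.finrank k T = Fintype.card ι * (2 * n ^ 2)) :
    ∃ f : (∀ l, Pl l) ≃ₗ[k] T, ∀ u x, f (fun l => ρ l u (x l)) = ρT u (f x) := by
  choose f hf fa fg using fun l => exists_map h (ρ l) ρT (H l) (hp l)
  have := fun l => (H l).fin
  let f' : (∀ l, Pl l) →ₗ[k] T := ∑ l, f l ∘ₗ LinearMap.proj l
  have f'a : ∀ x, f' x = ∑ l, f l (x l) := by intro x; simp [f']
  have f's : ∀ l x, f' (Pi.single l x) = f l x := by
    intro l x
    rw [f'a, Finset.sum_eq_single l]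
    · simp
    · intro b _ hb; simp [hb]
    · simp
  have fE : ∀ l x s, f l (((qs h (ρ l)).E ^ s) x) = ((qs h ρT).E ^ s) (f l x) := by
    intro l x s
    rw [qs_Ep, qs_Ep, hf]
  have sur : Function.Surjective f' := by
    rw [← LinearMap.range_eq_top, ← top_le_iff]
    refine hs.trans ?_
    rw [Submodule.span_le]
    rintro _ ⟨⟨l | l, s⟩, rfl⟩
    · refine ⟨Pi.single l (((qs h (ρ l)).E ^ (s:ℕ)) (a l)), ?_⟩
      rw [f's, fE, fa]; rfl
    · refine ⟨Pi.single l (((qs h (ρ l)).E ^ (s:ℕ)) (g l)), ?_⟩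
      rw [f's, fE, fg]; rfl
  have hd : Module.finrank k (∀ l, Pl l) = Module.finrank k T := by
    rw [hr, Module.finrank_pi_fintype]
    simp [fun l => (H l).rank]
  have inj : Function.Injective f' := (LinearMap.injective_iff_surjective_of_finrank_eq_finrank hd).2 sur
  refine ⟨LinearEquiv.ofBijective f' ⟨inj, sur⟩, ?_⟩
  intro u x
  change f' _ = ρT u (f' x)
  rw [f'a, f'a, map_sum]
  exact Finset.sum_congr rfl fun l _ => hf l u (x l)

variable {Δ : QFL.U k n q →ₐ[k] (QFL.U k n q ⊗[k] QFL.U k n q)} (hΔ : QFL.IsComul k n q Δ)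
variable [CharZero k] {i1 i2 j1 j2 : ℕ} (hi1 : 1 ≤ i1) (hi1' : i1 ≤ n ^ 2 / 2) (hj1 : j1 ≤ 1) (hi2 : 1 ≤ i2) (hi2' : i2 ≤ n ^ 2 / 2) (hj2 : j2 ≤ 1)
include hΔ hi1 hi1' hj1 hi2 hi2' hj2

omit hi1 hi1' hj1 in
theorem iso_pre (M : Type) [AddCommGroup M] [Module k M] [Module (QFL.U k n q) M]
    [IsScalarTower k (QFL.U k n q) M] [SMulCommClass (QFL.U k n q) k M] {a g : M}
    (H : (qs h (Algebra.lsmul k k M)).Full i1 j1 a g)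
    {ι : Type} [Fintype ι] (hι : Fintype.card ι = n ^ 2 - 2 * i2 + 1) (e : ι → ℕ ⊕ ℕ) (he : Function.Injective e)
    (i' j' : ι → ℕ) (hG : ∀ l, Ten.Good (n ^ 2) (n ^ 2 - 2 * i2 + 1) i1 j1 j2 (e l) (i' l) (j' l)) (hj' : ∀ l, j' l ≤ 1)
    (hg : ∀ x ∈ QFL.pbw k n q, QFL.F k n q * x = 0 → x = 0) :
    ∃ f : (∀ l, QFL.P k n q (i' l) (j' l)) ≃ₗ[k] (M ⊗[k] (QFL.S k n q i2 j2)),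
      ∀ u x, f (fun l => rhoP k n q (i' l) (j' l) u (x l)) = tau M (QFL.S k n q i2 j2) Δ u (f x) := by
  classical
  obtain ⟨c, ⟨T⟩⟩ := tenS h M hΔ hi2 hi2' hj2 hg
  obtain ⟨a', g', hp, hs⟩ := T.main H hι e he i' j' hG
  have hi' : ∀ l, 1 ≤ i' l := fun l => (hG l).1
  have hi'' : ∀ l, i' l ≤ n ^ 2 / 2 := fun l => by have := (hG l).2.1; omega
  have hfin := T.finM H
  have hr := T.rankM H
  rw [← hι] at hr
  exact iso_abs h (tau M (QFL.S k n q i2 j2) Δ)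
      (fun l => QFL.P k n q (i' l) (j' l)) (fun l => rhoP k n q (i' l) (j' l)) i' j' _ _
      (fun l => fullP h (hi' l) (hi'' l) (hj' l) hg) a' g' hp hs hfin hr

theorem iso_pi {ι : Type} [Fintype ι] (hι : Fintype.card ι = n ^ 2 - 2 * i2 + 1) (e : ι → ℕ ⊕ ℕ) (he : Function.Injective e)
    (i' j' : ι → ℕ) (hG : ∀ l, Ten.Good (n ^ 2) (n ^ 2 - 2 * i2 + 1) i1 j1 j2 (e l) (i' l) (j' l)) (hj' : ∀ l, j' l ≤ 1) :
    letI := QFL.tensorModule k n q Δ (QFL.P k n q i1 j1) (QFL.S k n q i2 j2)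
    Nonempty (((QFL.P k n q i1 j1) ⊗[k] (QFL.S k n q i2 j2)) ≃ₗ[QFL.U k n q] (∀ l, QFL.P k n q (i' l) (j' l))) := by
  letI := QFL.tensorModule k n q Δ (QFL.P k n q i1 j1) (QFL.S k n q i2 j2)
  classical
  have N4 := h.N4
  by_cases hg : ∀ x ∈ QFL.pbw k n q, QFL.F k n q * x = 0 → x = 0
  · have H := fullP h hi1 hi1' hj1 hg
    obtain ⟨f, hf⟩ := iso_pre h hΔ hi2 hi2' hj2 (QFL.P k n q i1 j1) H hι e he i' j' hG hj' hg
    exact ⟨LinearEquiv.symm { f with map_smul' := fun u x => hf u x }⟩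
  · have h1 : ∀ i j, Subsingleton (QFL.P k n q i j) := fun i j => P_bad h hg
    have h2 : Subsingleton ((QFL.P k n q i1 j1) ⊗[k] (QFL.S k n q i2 j2)) := by
      refine subsingleton_of_forall_eq 0 fun x => ?_
      induction x using TensorProduct.induction_on with
      | zero => rfl
      | add x y hx hy => rw [hx, hy, add_zero]
      | tmul x y => rw [Subsingleton.elim x 0, TensorProduct.zero_tmul]
    exact ⟨{ toFun := fun _ => 0, invFun := fun _ => 0, map_add' := fun _ _ => Subsingleton.elim _ _, map_smul' := fun _ _ => Subsingleton.elim _ _, left_inv := fun _ => Subsingleton.elim _ _, right_inv := fun _ => Subsingleton.elim _ _ }⟩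
end

section shapes
variable {R : Type} [Semiring R]
/-- doubling a family -/
def dbl {α : Type} (X : α → Type) [∀ a, AddCommMonoid (X a)] [∀ a, Module R (X a)] :
    ((∀ a, X a) × (∀ a, X a)) ≃ₗ[R] (∀ a, X a × X a) where
  toFun x a := (x.1 a, x.2 a)
  invFun y := (fun a => (y a).1, fun a => (y a).2)
  map_add' _ _ := rfl
  map_smul' _ _ := rfl
  left_inv _ := rfl
  right_inv _ := rfl

/-- splitting a family over a sum type -/
def spl {α β : Type} (X : α ⊕ β → Type) [∀ a, AddCommMonoid (X a)] [∀ a, Module R (X a)] :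
    (∀ a, X a) ≃ₗ[R] ((∀ a, X (Sum.inl a)) × (∀ b, X (Sum.inr b))) where
  toFun x := (fun a => x (Sum.inl a), fun b => x (Sum.inr b))
  invFun y := fun z => match z with | Sum.inl a => y.1 a | Sum.inr b => y.2 b
  map_add' _ _ := rfl
  map_smul' _ _ := rfl
  left_inv _ := by funext z; cases z <;> rfl
  right_inv _ := rfl
open DirectSum in
/-- direct sums of finite families -/
def ds {m : ℕ} (X : Fin m → Type) [∀ a, AddCommMonoid (X a)] [∀ a, Module R (X a)] : (∀ a, X a) ≃ₗ[R] (⨁ a, X a) :=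
  (DirectSum.linearEquivFunOnFintype R (Fin m) X).symm
end shapes
end QFLP

open QFL DirectSum in
/-- Theorem 4.2: decomposition of the tensor products `P_{2i₁,j₁} ⊗ S_{2i₂,j₂}` of an
indecomposable projective with a simple module into indecomposable projectives.
Subscripts `P_{2r,j}` are encoded via the index `i = r`, and `\overline{x}` via `x % 2`. -/
theorem statement15 (k : Type) [Field k] [IsAlgClosed k] [CharZero k]
    (n : ℕ) (hn : 0 < n) (h4 : 4 ∣ n) (q : k) (hq : IsPrimitiveRoot q (n ^ 2))
    (Δ : U k n q →ₐ[k] (U k n q ⊗[k] U k n q)) (hΔ : IsComul k n q Δ) :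
    ∀ i₁ i₂ j₁ j₂ : ℕ, 1 ≤ i₁ → i₁ ≤ n ^ 2 / 2 → 1 ≤ i₂ → i₂ ≤ n ^ 2 / 2 →
      j₁ ≤ 1 → j₂ ≤ 1 →
      letI := tensorModule k n q Δ (P k n q i₁ j₁) (S k n q i₂ j₂)
      -- (a)
      ((n ^ 2 - 2 * i₂ + 1 ≤ 2 * i₁ - 1 → i₁ ≤ i₂ →
        Nonempty (((P k n q i₁ j₁) ⊗[k] (S k n q i₂ j₂)) ≃ₗ[U k n q]
          (⨁ l : Fin (n ^ 2 - 2 * i₂ + 1),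
            (P k n q (n ^ 2 / 2 + i₁ - i₂ - l) ((j₁ + j₂ + l) % 2))))) ∧
      -- (b)
      (n ^ 2 - 2 * i₂ + 1 ≤ 2 * i₁ - 1 → i₂ < i₁ →
        Nonempty (((P k n q i₁ j₁) ⊗[k] (S k n q i₂ j₂)) ≃ₗ[U k n q]
          ((⨁ l : Fin (i₁ - i₂),
            ((P k n q (i₁ - i₂ - l) ((j₁ + j₂ + l) % 2)) ×
              (P k n q (i₁ - i₂ - l) ((j₁ + j₂ + l) % 2)))) ×
          (⨁ l : Fin (n ^ 2 - 2 * i₁ + 1),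
            (P k n q (n ^ 2 / 2 - i₁ + i₂ - l) ((j₁ + j₂ + l) % 2)))))) ∧
      -- (c)
      (2 * i₁ - 1 < n ^ 2 - 2 * i₂ + 1 → i₁ ≤ i₂ →
        Nonempty (((P k n q i₁ j₁) ⊗[k] (S k n q i₂ j₂)) ≃ₗ[U k n q]
          ((⨁ l : Fin (2 * i₁ - 1),
            (P k n q (n ^ 2 / 2 + i₁ - i₂ - l) ((j₁ + j₂ + l) % 2))) ×
          (⨁ l : Fin (n ^ 2 / 2 - i₁ - i₂ + 1),
            ((P k n q (n ^ 2 / 2 - i₁ - i₂ + 1 - l) ((j₁ + j₂ + l + 1) % 2)) ×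
              (P k n q (n ^ 2 / 2 - i₁ - i₂ + 1 - l) ((j₁ + j₂ + l + 1) % 2))))))) ∧
      -- (d)
      (2 * i₁ - 1 < n ^ 2 - 2 * i₂ + 1 → i₂ < i₁ →
        Nonempty (((P k n q i₁ j₁) ⊗[k] (S k n q i₂ j₂)) ≃ₗ[U k n q]
          ((⨁ l : Fin (i₁ - i₂),
            ((P k n q (i₁ - i₂ - l) ((j₁ + j₂ + l) % 2)) ×
              (P k n q (i₁ - i₂ - l) ((j₁ + j₂ + l) % 2)))) ×
          (⨁ l : Fin (2 * i₂ - 1),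
            (P k n q (n ^ 2 / 2 - i₁ + i₂ - l) ((j₁ + j₂ + l) % 2))) ×
          (⨁ l : Fin (n ^ 2 / 2 - i₁ - i₂ + 1),
            ((P k n q (n ^ 2 / 2 - i₁ - i₂ + 1 - l) ((j₁ + j₂ + l + 1) % 2)) ×
              (P k n q (n ^ 2 / 2 - i₁ - i₂ + 1 - l) ((j₁ + j₂ + l + 1) % 2)))))))) := by
  intro i₁ i₂ j₁ j₂ hi1 hi1' hi2 hi2' hj1 hj2
  have h : QFLP.Hyp n q := ⟨hn, h4, hq⟩
  have N4 := h.N4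
  have iso := @QFLP.iso_pi k _ n q h Δ hΔ _ i₁ i₂ j₁ j₂ hi1 hi1' hj1 hi2 hi2' hj2
  letI := tensorModule k n q Δ (P k n q i₁ j₁) (S k n q i₂ j₂)
  let eA : ((∀ l : Fin (i₁ - i₂), P k n q (i₁ - i₂ - l) ((j₁ + j₂ + l) % 2)) × (∀ l : Fin (i₁ - i₂), P k n q (i₁ - i₂ - l) ((j₁ + j₂ + l) % 2))) ≃ₗ[U k n q]
      (⨁ l : Fin (i₁ - i₂), (P k n q (i₁ - i₂ - l) ((j₁ + j₂ + l) % 2)) × (P k n q (i₁ - i₂ - l) ((j₁ + j₂ + l) % 2))) :=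
    (QFLP.dbl (fun l : Fin (i₁ - i₂) => P k n q (i₁ - i₂ - l) ((j₁ + j₂ + l) % 2))).trans (QFLP.ds _)
  let eC : ((∀ l : Fin (n ^ 2 / 2 - i₁ - i₂ + 1), P k n q (n ^ 2 / 2 - i₁ - i₂ + 1 - l) ((j₁ + j₂ + l + 1) % 2)) × (∀ l : Fin (n ^ 2 / 2 - i₁ - i₂ + 1), P k n q (n ^ 2 / 2 - i₁ - i₂ + 1 - l) ((j₁ + j₂ + l + 1) % 2))) ≃ₗ[U k n q]
      (⨁ l : Fin (n ^ 2 / 2 - i₁ - i₂ + 1), (P k n q (n ^ 2 / 2 - i₁ - i₂ + 1 - l) ((j₁ + j₂ + l + 1) % 2)) × (P k n q (n ^ 2 / 2 - i₁ - i₂ + 1 - l) ((j₁ + j₂ + l + 1) % 2))) :=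
    (QFLP.dbl (fun l : Fin (n ^ 2 / 2 - i₁ - i₂ + 1) => P k n q (n ^ 2 / 2 - i₁ - i₂ + 1 - l) ((j₁ + j₂ + l + 1) % 2))).trans (QFLP.ds _)
  refine ⟨fun hA hB => ?_, fun hA hB => ?_, fun hA hB => ?_, fun hA hB => ?_⟩
  · obtain ⟨f⟩ := iso (ι := Fin (n ^ 2 - 2 * i₂ + 1)) (by simp) (fun l => Sum.inl (l:ℕ))
      (fun a b hab => Fin.ext (Sum.inl.inj hab)) (fun l => n ^ 2 / 2 + i₁ - i₂ - l) (fun l => (j₁ + j₂ + l) % 2)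
      (fun l => QFLP.good_a N4 hi1 hi1' hi2 hi2' hA hB l) (fun l => by omega)
    exact ⟨f.trans (QFLP.ds (fun l : Fin (n ^ 2 - 2 * i₂ + 1) => P k n q (n ^ 2 / 2 + i₁ - i₂ - l) ((j₁ + j₂ + l) % 2)))⟩
  · obtain ⟨f⟩ := iso (ι := (Fin (i₁ - i₂) ⊕ Fin (i₁ - i₂)) ⊕ Fin (n ^ 2 - 2 * i₁ + 1)) (by simp; omega) (QFLP.eB (n ^ 2) i₁ i₂ _)
      (QFLP.inj_b N4 hi1 hi1' hi2 hi2' _ hB) (QFLP.iB (n ^ 2) i₁ i₂ _) (QFLP.jB i₁ i₂ _ j₁ j₂)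
      (fun l => QFLP.good_b N4 hi1 hi1' hi2 hi2' _ le_rfl (by omega) hB l)
      (fun l => by rcases l with (l | l) | l <;> simp only [QFLP.jB, Sum.elim_inl, Sum.elim_inr] <;> omega)
    have g1 := f.trans (QFLP.spl _)
    exact ⟨g1.trans (LinearEquiv.prodCongr ((QFLP.spl _).trans eA)
      (QFLP.ds (fun l : Fin (n ^ 2 - 2 * i₁ + 1) => P k n q (n ^ 2 / 2 - i₁ + i₂ - l) ((j₁ + j₂ + l) % 2))))⟩
  · obtain ⟨f⟩ := iso (ι := Fin (2 * i₁ - 1) ⊕ (Fin (n ^ 2 / 2 - i₁ - i₂ + 1) ⊕ Fin (n ^ 2 / 2 - i₁ - i₂ + 1))) (by simp; omega)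
      (Sum.elim (fun l => Sum.inl (l:ℕ)) (QFLP.eD i₁ i₂ _))
      (QFLP.inj_c N4 hi1 hi1' hi2 hi2') 
      (Sum.elim (fun l => n ^ 2 / 2 + i₁ - i₂ - l) (QFLP.iD (n ^ 2) i₁ i₂ _))
      (Sum.elim (fun l => (j₁ + j₂ + l) % 2) (QFLP.jD _ j₁ j₂))
      (fun l => by
        rcases l with l | l
        · exact QFLP.good_c N4 hi1 hi1' hi2 hi2' hA hB l
        · exact QFLP.good_d N4 hi1 hi1' hi2 hi2' hA l)
      (fun l => by rcases l with l | (l | l) <;> simp only [QFLP.jD, Sum.elim_inl, Sum.elim_inr] <;> omega)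
    have g1 := f.trans (QFLP.spl _)
    exact ⟨g1.trans (LinearEquiv.prodCongr (QFLP.ds (fun l : Fin (2 * i₁ - 1) => P k n q (n ^ 2 / 2 + i₁ - i₂ - l) ((j₁ + j₂ + l) % 2)))
      ((QFLP.spl _).trans eC))⟩
  · obtain ⟨f⟩ := iso (ι := ((Fin (i₁ - i₂) ⊕ Fin (i₁ - i₂)) ⊕ Fin (2 * i₂ - 1)) ⊕
        (Fin (n ^ 2 / 2 - i₁ - i₂ + 1) ⊕ Fin (n ^ 2 / 2 - i₁ - i₂ + 1))) (by simp; omega)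
      (Sum.elim (QFLP.eB (n ^ 2) i₁ i₂ _) (QFLP.eD i₁ i₂ _))
      (QFLP.inj_d N4 hi1 hi1' hi2 hi2' hA hB) 
      (Sum.elim (QFLP.iB (n ^ 2) i₁ i₂ _) (QFLP.iD (n ^ 2) i₁ i₂ _))
      (Sum.elim (QFLP.jB i₁ i₂ _ j₁ j₂) (QFLP.jD _ j₁ j₂))
      (fun l => by
        rcases l with l | l
        · exact QFLP.good_b N4 hi1 hi1' hi2 hi2' _ (by omega) (by omega) hB l
        · exact QFLP.good_d N4 hi1 hi1' hi2 hi2' hA l)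
      (fun l => by rcases l with ((l | l) | l) | (l | l) <;> simp only [QFLP.jB, QFLP.jD, Sum.elim_inl, Sum.elim_inr] <;> omega)
    have g1 := f.trans (QFLP.spl _)
    have g2 := g1.trans (LinearEquiv.prodCongr (QFLP.spl _) (QFLP.spl _))
    have g3 := g2.trans (LinearEquiv.prodAssoc _ _ _ _)
    have g4 := g3.trans (LinearEquiv.prodCongr (QFLP.spl _) (LinearEquiv.refl _ _))
    exact ⟨g4.trans (LinearEquiv.prodCongr eA (LinearEquiv.prodCongr
      (QFLP.ds (fun l : Fin (2 * i₂ - 1) => P k n q (n ^ 2 / 2 - i₁ + i₂ - l) ((j₁ + j₂ + l) % 2))) eC))⟩
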